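/- Let J : ℕ → ℝ satisfy J(k) ≥ 0 for all k ≥ 1, ∑_{k=1}^∞ J(k) < ∞, and additionally J(k) = O(k^{−1}), i.e. there is c > 0 with J(k) ≤ c/k for all k ≥ 1. Then for every β with 0 ≤ β < β_c(Φ), letting ν be the unique eigenprobability of L*_{βφ} with eigenvalue λ > 0, there exists a nonnegative function h ∈ L¹(X₊, ν) with ∫ h dν > 0 such that L_{βφ} h = λ·h ν-almost everywhere. -/

import Mathlib

open MeasureTheory Real

noncomputable section

/-- The configuration space `X = {-1,+1}^ℤ`, with spins encoded by booleans. -/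
abbrev Config : Type := ℤ → Bool

/-- The real value of a spin: `true ↦ +1`, `false ↦ -1`. -/
def spin (b : Bool) : ℝ := if b then 1 else -1

/-- Spin flipAt at site `i`. -/
def flipAt (i : ℤ) (ω : Config) : Config := fun j => if j = i then !(ω j) else ω j

/-- A function is local if it depends on finitely many coordinates. -/
def IsLocal (F : Config → ℝ) : Prop :=
  ∃ S : Finset ℤ, ∀ ω η : Config, (∀ i ∈ S, ω i = η i) → F ω = F η

/-- The oscillation `δ_k F` at site `k`. -/
def osc (F : Config → ℝ) (k : ℤ) : ℝ :=
  sSup {d : ℝ | ∃ ξ η : Config, (∀ j : ℤ, j ≠ k → ξ j = η j) ∧ d = F ξ - F η}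

/-- The total squared oscillation `‖δ(F)‖₂²`. -/
def oscSq (F : Config → ℝ) : ℝ := ∑' k : ℤ, (osc F k) ^ 2

/-- The Gaussian Concentration Bound with constant `D`. -/
def GCB (μ : Measure Config) (D : ℝ) : Prop :=
  ∀ F : Config → ℝ, IsLocal F → Continuous F →
    (∫ ω, exp (F ω - ∫ η, F η ∂μ) ∂μ) ≤ exp (D * oscSq F)

/-- The entropy functional `Ent_μ(g)`. -/
def entropy (μ : Measure Config) (g : Config → ℝ) : ℝ :=
  (∫ ω, g ω * log (g ω) ∂μ) - (∫ ω, g ω ∂μ) * log (∫ ω, g ω ∂μ)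

/-- The log-Sobolev inequality with constant `D`. -/
def SatisfiesLSI (μ : Measure Config) (D : ℝ) : Prop :=
  ∀ f : Config → ℝ, IsLocal f → Continuous f →
    entropy μ (fun ω => (f ω) ^ 2) ≤ 2 * D * ∫ ω, ∑' i : ℤ, (f ω - f (flipAt i ω)) ^ 2 ∂μ

/-- The Hamiltonian `H^{βK}_Λ(ω) = -β ∑_{{i,j}∩Λ≠∅, i≠j} K(i,j) ω_i ω_j`,
where the sum runs over ordered pairs with `i < j`. -/
def hamiltonian (K : ℤ → ℤ → ℝ) (β : ℝ) (Λ : Finset ℤ) (ω : Config) : ℝ :=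
  -β * ∑' p : ℤ × ℤ,
      (if p.1 < p.2 ∧ (p.1 ∈ Λ ∨ p.2 ∈ Λ) then K p.1 p.2 * spin (ω p.1) * spin (ω p.2) else 0)

/-- The configuration equal to `a` in `Λ` and to `ω` off `Λ`. -/
def concat (Λ : Finset ℤ) (a : Λ → Bool) (ω : Config) : Config :=
  fun j => if h : j ∈ Λ then a ⟨j, h⟩ else ω j

/-- The Gibbs kernel `γ^{βK}_Λ(a | ω)`. -/
def gibbsKernel (K : ℤ → ℤ → ℝ) (β : ℝ) (Λ : Finset ℤ) (a : Λ → Bool) (ω : Config) : ℝ :=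
  exp (-(hamiltonian K β Λ (concat Λ a ω))) /
    ∑ b : Λ → Bool, exp (-(hamiltonian K β Λ (concat Λ b ω)))

/-- The σ-algebra `F_{Λᶜ}` generated by the coordinates outside `Λ`. -/
def outsideAlgebra (Λ : Finset ℤ) : MeasurableSpace Config :=
  MeasurableSpace.comap (fun (ω : Config) (j : {j : ℤ // j ∉ Λ}) => ω j.1) inferInstance

/-- The cylinder event `{σ_Λ = a}`. -/
def cylinderEvent (Λ : Finset ℤ) (a : Λ → Bool) : Set Config :=
  {ω | ∀ i : Λ, ω i.1 = a i}

/-- `μ` is a Gibbs measure for the pair coupling `K` at inverse temperature `β`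
(the DLR equations). -/
def IsGibbs (K : ℤ → ℤ → ℝ) (β : ℝ) (μ : Measure Config) : Prop :=
  IsProbabilityMeasure μ ∧
  ∀ (Λ : Finset ℤ) (a : Λ → Bool) (B : Set Config),
    MeasurableSet[outsideAlgebra Λ] B →
    (μ (cylinderEvent Λ a ∩ B)).toReal = ∫ ω in B, gibbsKernel K β Λ a ω ∂μ

/-- The Dyson pair couplings `K(i,j) = J(|i-j|)` for `i ≠ j`. -/
def dysonK (J : ℕ → ℝ) : ℤ → ℤ → ℝ := fun i j => if i = j then 0 else J (i - j).natAbs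

/-- The critical inverse temperature `β_c(K)`. -/
def betaC (K : ℤ → ℤ → ℝ) : ℝ :=
  sSup {β : ℝ | 0 ≤ β ∧ ∃! μ : Measure Config, IsGibbs K β μ}

/-- The susceptibility `χ(μ) = ∑_{i∈ℤ} ∫ ω₀ ω_i dμ`. -/
def suscept (μ : Measure Config) : ℝ := ∑' i : ℤ, ∫ ω, spin (ω 0) * spin (ω i) ∂μ

/-- The half-line configuration space `X₊ = {-1,+1}^{ℤ₊}`. -/
abbrev ConfigP : Type := ℕ → Bool

/-- Concatenation `ax`: `(ax)₀ = a`, `(ax)ₙ = x_{n-1}` for `n ≥ 1`. -/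
def consP (a : Bool) (x : ConfigP) : ConfigP := fun n =>
  match n with
  | 0 => a
  | Nat.succ m => x m

/-- The half-line potential `φ(x) = ∑_{n≥1} J(n) x₀ xₙ`. -/
def potential (J : ℕ → ℝ) (x : ConfigP) : ℝ :=
  ∑' n : ℕ, J (n + 1) * spin (x 0) * spin (x (n + 1))

/-- The transfer operator `L_{βφ}`. -/
def transfer (J : ℕ → ℝ) (β : ℝ) (f : ConfigP → ℝ) (x : ConfigP) : ℝ :=
  ∑ a : Bool, exp (β * potential J (consP a x)) * f (consP a x)

/-- `ν` is an eigenprobability of the adjoint transfer operator `L*_{βφ}`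
with eigenvalue `lam`. -/
def IsEigenprob (J : ℕ → ℝ) (β lam : ℝ) (ν : Measure ConfigP) : Prop :=
  IsProbabilityMeasure ν ∧
  ∀ f : ConfigP → ℝ, Continuous f → (∫ x, transfer J β f x ∂ν) = lam * ∫ x, f x ∂ν

/-- A local function on the half-line configuration space. -/
def IsLocalP (F : ConfigP → ℝ) : Prop :=
  ∃ S : Finset ℕ, ∀ ω η : ConfigP, (∀ i ∈ S, ω i = η i) → F ω = F η

/-- The oscillation `δ_k F` at site `k ∈ ℤ₊`. -/
def oscP (F : ConfigP → ℝ) (k : ℕ) : ℝ :=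
  sSup {d : ℝ | ∃ ξ η : ConfigP, (∀ j : ℕ, j ≠ k → ξ j = η j) ∧ d = F ξ - F η}

/-- The total squared oscillation on the half-line. -/
def oscSqP (F : ConfigP → ℝ) : ℝ := ∑' k : ℕ, (oscP F k) ^ 2

/-- The Gaussian Concentration Bound on the half-line with constant `D`. -/
def GCBP (ν : Measure ConfigP) (D : ℝ) : Prop :=
  ∀ F : ConfigP → ℝ, IsLocalP F → Continuous F →
    (∫ x, exp (F x - ∫ y, F y ∂ν) ∂ν) ≤ exp (D * oscSqP F)

section Ferro

set_option linter.unusedSectionVars false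

variable {V : Type*} [Fintype V] [DecidableEq V]

lemma spin_mul_self (b : Bool) : spin b * spin b = 1 := by cases b <;> simp [spin]

lemma spin_not (b : Bool) : spin (!b) = -spin b := by cases b <;> simp [spin]

lemma spin_beq (a b : Bool) : spin (a == b) = spin a * spin b := by
  cases a <;> cases b <;> simp [spin]

lemma abs_spin (b : Bool) : |spin b| = 1 := by cases b <;> simp [spin]

lemma spin_mul_spin_eq (a b : Bool) : spin a * spin b = if a = b then 1 else -1 := by
  cases a <;> cases b <;> simp [spin]

/-- The spin monomial with support `A`. -/
def spinMonomial (A : Finset V) (σ : V → Bool) : ℝ := ∏ i ∈ A, spin (σ i)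

/-- Functions of the spins that are nonnegative combinations of spin monomials. -/
def IsFerro (F : (V → Bool) → ℝ) : Prop :=
  ∃ c : Finset V → ℝ, (∀ A, 0 ≤ c A) ∧ ∀ σ, F σ = ∑ A, c A * spinMonomial A σ

lemma spinMonomial_mul (A B : Finset V) (σ : V → Bool) :
    spinMonomial A σ * spinMonomial B σ = spinMonomial (symmDiff A B) σ := by
  have key : ∀ A : Finset V, spinMonomial A σ = ∏ i, if i ∈ A then spin (σ i) else 1 := by
    intro A
    simp [spinMonomial, Finset.prod_ite_mem]
  rw [key, key, key, ← Finset.prod_mul_distrib]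
  refine Finset.prod_congr rfl fun i _ => ?_
  by_cases hA : i ∈ A <;> by_cases hB : i ∈ B <;>
    simp [hA, hB, Finset.mem_symmDiff, spin_mul_self]

lemma sum_spinMonomial_nonneg (A : Finset V) : 0 ≤ ∑ σ : V → Bool, spinMonomial A σ := by
  have key : ∀ σ : V → Bool, spinMonomial A σ = ∏ i, if i ∈ A then spin (σ i) else 1 := by
    intro σ
    simp [spinMonomial, Finset.prod_ite_mem]
  simp_rw [key]
  have h := Finset.prod_univ_sum (fun _ : V => (Finset.univ : Finset Bool))
    (fun i b => if i ∈ A then spin b else 1)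
  rw [Fintype.piFinset_univ] at h
  rw [← h]
  refine Finset.prod_nonneg fun i _ => ?_
  by_cases hA : i ∈ A <;> simp [hA, spin]

namespace IsFerro

lemma sum_nonneg {F : (V → Bool) → ℝ} (hF : IsFerro F) : 0 ≤ ∑ σ, F σ := by
  obtain ⟨c, hc, h⟩ := hF
  simp_rw [h]
  rw [Finset.sum_comm]
  refine Finset.sum_nonneg fun A _ => ?_
  rw [← Finset.mul_sum]
  exact mul_nonneg (hc A) (sum_spinMonomial_nonneg A)

lemma const {r : ℝ} (hr : 0 ≤ r) : IsFerro fun _ : V → Bool => r := by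
  refine ⟨fun A => if A = ∅ then r else 0, fun A => by dsimp only; split_ifs <;> simp [hr], fun σ => ?_⟩
  simp [spinMonomial]

lemma spin (i : V) : IsFerro fun σ : V → Bool => _root_.spin (σ i) := by
  refine ⟨fun A => if A = {i} then 1 else 0, fun A => by dsimp only; split_ifs <;> simp, fun σ => ?_⟩
  simp [spinMonomial]

lemma add {F G : (V → Bool) → ℝ} (hF : IsFerro F) (hG : IsFerro G) :
    IsFerro fun σ => F σ + G σ := by
  obtain ⟨c, hc, h⟩ := hF
  obtain ⟨d, hd, h'⟩ := hG
  refine ⟨fun A => c A + d A, fun A => add_nonneg (hc A) (hd A), fun σ => ?_⟩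
  simp only [h, h', add_mul, Finset.sum_add_distrib]

lemma mul {F G : (V → Bool) → ℝ} (hF : IsFerro F) (hG : IsFerro G) :
    IsFerro fun σ => F σ * G σ := by
  obtain ⟨c, hc, h⟩ := hF
  obtain ⟨d, hd, h'⟩ := hG
  refine ⟨fun D => ∑ p : Finset V × Finset V, if symmDiff p.1 p.2 = D then c p.1 * d p.2 else 0,
    fun D => Finset.sum_nonneg fun p _ => ?_, fun σ => ?_⟩
  · split_ifs
    · exact mul_nonneg (hc _) (hd _)
    · exact le_rfl
  · simp_rw [Finset.sum_mul]
    rw [Finset.sum_comm, h, h', Finset.sum_mul_sum, Fintype.sum_prod_type]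
    refine Finset.sum_congr rfl fun A _ => Finset.sum_congr rfl fun B _ => ?_
    simp only [ite_mul, zero_mul, Finset.sum_ite_eq, Finset.mem_univ, if_true]
    rw [← spinMonomial_mul]
    ring

lemma finset_sum {ι : Type*} {s : Finset ι} {F : ι → (V → Bool) → ℝ}
    (hF : ∀ i ∈ s, IsFerro (F i)) : IsFerro fun σ => ∑ i ∈ s, F i σ := by
  classical
  induction s using Finset.induction_on with
  | empty => simpa using const le_rfl
  | insert a s ha ih =>
    simp_rw [Finset.sum_insert ha]
    exact (hF a (by simp)).add (ih fun i hi => hF i (by simp [hi]))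

lemma finset_prod {ι : Type*} {s : Finset ι} {F : ι → (V → Bool) → ℝ}
    (hF : ∀ i ∈ s, IsFerro (F i)) : IsFerro fun σ => ∏ i ∈ s, F i σ := by
  classical
  induction s using Finset.induction_on with
  | empty => simpa using const zero_le_one
  | insert a s ha ih =>
    simp_rw [Finset.prod_insert ha]
    exact (hF a (by simp)).mul (ih fun i hi => hF i (by simp [hi]))

lemma spin_mul_spin (i j : V) : IsFerro fun σ : V → Bool => _root_.spin (σ i) * _root_.spin (σ j) :=
  (spin i).mul (spin j)

lemma congr {F G : (V → Bool) → ℝ} (hF : IsFerro F) (h : ∀ σ, G σ = F σ) : IsFerro G := by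
  rwa [show G = F from funext h]

lemma affine_pair {a b : ℝ} (ha : 0 ≤ a) (hb : 0 ≤ b) (i j : V) :
    IsFerro fun σ : V → Bool => a + b * (_root_.spin (σ i) * _root_.spin (σ j)) :=
  (const ha).add ((const hb).mul (spin_mul_spin i j))

end IsFerro

lemma exp_mul_spin_mul_spin (a : ℝ) (b c : Bool) :
    exp (a * (spin b * spin c)) = cosh a + sinh a * (spin b * spin c) := by
  rw [spin_mul_spin_eq]
  split_ifs
  · simp [Real.cosh_add_sinh]
  · rw [mul_neg_one, mul_neg_one, ← sub_eq_add_neg, Real.cosh_sub_sinh]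

namespace IsFerro

lemma exp_pair {a : ℝ} (ha : 0 ≤ a) (i j : V) :
    IsFerro fun σ : V → Bool => Real.exp (a * (_root_.spin (σ i) * _root_.spin (σ j))) :=
  (affine_pair (Real.cosh_pos a).le (Real.sinh_nonneg_iff.2 ha) i j).congr
    fun _ => exp_mul_spin_mul_spin _ _ _

lemma exp_pair_sub_one {a : ℝ} (ha : 0 ≤ a) (i j : V) :
    IsFerro fun σ : V → Bool => Real.exp (a * (_root_.spin (σ i) * _root_.spin (σ j))) - 1 :=
  (affine_pair (sub_nonneg.2 (Real.one_le_cosh a)) (Real.sinh_nonneg_iff.2 ha) i j).congr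
    fun σ => by rw [exp_mul_spin_mul_spin]; ring

/-- `a s e^{a s} - e^{a s} + 1` has nonnegative coefficients in `s`. -/
lemma mul_exp_pair_sub {a : ℝ} (ha : 0 ≤ a) (i j : V) :
    IsFerro fun σ : V → Bool =>
      a * (_root_.spin (σ i) * _root_.spin (σ j)) *
          Real.exp (a * (_root_.spin (σ i) * _root_.spin (σ j))) -
        Real.exp (a * (_root_.spin (σ i) * _root_.spin (σ j))) + 1 := by
  have h1 : Real.sinh a ≤ a * Real.cosh a := by
    have hmono : MonotoneOn (fun x => x * Real.cosh x - Real.sinh x) (Set.Ici 0) := by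
      refine monotoneOn_of_deriv_nonneg (convex_Ici 0) (by fun_prop) (by fun_prop) ?_
      intro x hx
      rw [interior_Ici] at hx
      have hd : HasDerivAt (fun x => x * Real.cosh x - Real.sinh x)
          (1 * Real.cosh x + x * Real.sinh x - Real.cosh x) x :=
        ((hasDerivAt_id x).mul (Real.hasDerivAt_cosh x)).sub (Real.hasDerivAt_sinh x)
      rw [hd.deriv]
      have := mul_nonneg (le_of_lt hx) (Real.sinh_nonneg_iff.2 (le_of_lt hx))
      linarith
    have := hmono (Set.mem_Ici.2 le_rfl) (Set.mem_Ici.2 ha) ha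
    simp only [Real.cosh_zero, Real.sinh_zero] at this
    linarith
  have h2 : Real.cosh a - 1 ≤ a * Real.sinh a := by
    have hmono : MonotoneOn (fun x => x * Real.sinh x - Real.cosh x) (Set.Ici 0) := by
      refine monotoneOn_of_deriv_nonneg (convex_Ici 0) (by fun_prop) (by fun_prop) ?_
      intro x hx
      rw [interior_Ici] at hx
      have hd : HasDerivAt (fun x => x * Real.sinh x - Real.cosh x)
          (1 * Real.sinh x + x * Real.cosh x - Real.sinh x) x :=
        ((hasDerivAt_id x).mul (Real.hasDerivAt_sinh x)).sub (Real.hasDerivAt_cosh x)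
      rw [hd.deriv]
      have := mul_nonneg (le_of_lt hx) (Real.cosh_pos x).le
      linarith
    have := hmono (Set.mem_Ici.2 le_rfl) (Set.mem_Ici.2 ha) ha
    simp only [Real.cosh_zero, Real.sinh_zero] at this
    linarith
  refine (affine_pair (a := a * Real.sinh a - Real.cosh a + 1)
    (b := a * Real.cosh a - Real.sinh a) (by linarith) (by linarith) i j).congr fun σ => ?_
  rw [exp_mul_spin_mul_spin]
  have : (_root_.spin (σ i) * _root_.spin (σ j)) * (_root_.spin (σ i) * _root_.spin (σ j)) = 1 := by
    rw [mul_mul_mul_comm, spin_mul_self, spin_mul_self, one_mul]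
  linear_combination (a * Real.sinh a) * this

lemma exp_sum {ι : Type*} (s : Finset ι) (a : ι → ℝ) (ha : ∀ k ∈ s, 0 ≤ a k) (p q : ι → V) :
    IsFerro fun σ : V → Bool =>
      Real.exp (∑ k ∈ s, a k * (_root_.spin (σ (p k)) * _root_.spin (σ (q k)))) := by
  simp_rw [Real.exp_sum]
  exact finset_prod fun k hk => exp_pair (ha k hk) _ _

lemma exp_sum_sub_one {ι : Type*} (s : Finset ι) (a : ι → ℝ) (ha : ∀ k ∈ s, 0 ≤ a k)
    (p q : ι → V) : IsFerro fun σ : V → Bool =>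
      Real.exp (∑ k ∈ s, a k * (_root_.spin (σ (p k)) * _root_.spin (σ (q k)))) - 1 := by
  classical
  induction s using Finset.induction_on with
  | empty => simpa using const le_rfl
  | insert k s hk ih =>
    refine (((exp_pair (ha k (by simp)) (p k) (q k)).mul (ih fun i hi => ha i (by simp [hi]))).add
      (exp_pair_sub_one (ha k (by simp)) (p k) (q k))).congr fun σ => ?_
    rw [Finset.sum_insert hk, Real.exp_add]
    ring

/-- `H e^H - e^H + 1` has nonnegative coefficients when the pair Hamiltonian `H` has. -/
lemma mul_exp_sum_sub {ι : Type*} (s : Finset ι) (a : ι → ℝ) (ha : ∀ k ∈ s, 0 ≤ a k)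
    (p q : ι → V) : IsFerro fun σ : V → Bool =>
      (∑ k ∈ s, a k * (_root_.spin (σ (p k)) * _root_.spin (σ (q k)))) *
          Real.exp (∑ k ∈ s, a k * (_root_.spin (σ (p k)) * _root_.spin (σ (q k)))) -
        Real.exp (∑ k ∈ s, a k * (_root_.spin (σ (p k)) * _root_.spin (σ (q k)))) + 1 := by
  classical
  induction s using Finset.induction_on with
  | empty => simpa using const le_rfl
  | insert k s hk ih =>
    have hk0 := ha k (by simp)
    have hs : ∀ i ∈ s, 0 ≤ a i := fun i hi => ha i (by simp [hi])
    refine (((exp_pair hk0 (p k) (q k)).mul (ih hs)).add ((mul_exp_pair_sub hk0 (p k) (q k)).add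
      (((const hk0).mul (spin_mul_spin (p k) (q k))).mul ((exp_pair hk0 (p k) (q k)).mul
        (exp_sum_sub_one s a hs p q))))).congr fun σ => ?_
    rw [Finset.sum_insert hk, Real.exp_add]
    ring

end IsFerro

end Ferro

section Cluster

set_option linter.unusedSectionVars false

variable {V : Type*} [DecidableEq V]

/-- `a` and `b` are joined by a path of edges of `ω`, ignoring orientation. -/
def EdgeJoined (ω : Finset (V × V)) (a b : V) : Prop :=
  Relation.EqvGen (fun x y => (x, y) ∈ ω) a b

lemma EdgeJoined.mono {ω ω' : Finset (V × V)} (h : ω ⊆ ω') {a b : V} (hab : EdgeJoined ω a b) :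
    EdgeJoined ω' a b :=
  Relation.EqvGen.mono (fun _ _ hxy => h hxy) _ _ hab

lemma EdgeJoined.mem_iff {ω : Finset (V × V)} {C : Finset V}
    (hC : ∀ e ∈ ω, (e.1 ∈ C ↔ e.2 ∈ C)) {a b : V} (hab : EdgeJoined ω a b) : a ∈ C ↔ b ∈ C := by
  induction hab with
  | rel x y h => exact hC _ h
  | refl x => exact Iff.rfl
  | symm x y _ ih => exact ih.symm
  | trans x y z _ _ ih1 ih2 => exact ih1.trans ih2

lemma EdgeJoined.restrict {ω : Finset (V × V)} {C : Finset V}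
    (hC : ∀ e ∈ ω, (e.1 ∈ C ↔ e.2 ∈ C)) {a b : V} (hab : EdgeJoined ω a b) (ha : a ∈ C) :
    EdgeJoined (ω.filter fun e => e.1 ∈ C) a b := by
  induction hab with
  | rel x y h => exact .rel _ _ (Finset.mem_filter.2 ⟨h, ha⟩)
  | refl x => exact .refl _
  | symm x y h ih => exact .symm _ _ (ih ((EdgeJoined.mem_iff hC h).2 ha))
  | trans x y z h _ ih1 ih2 =>
    exact .trans _ _ _ (ih1 ha) (ih2 ((EdgeJoined.mem_iff hC h).1 ha))

/-- All vertices of `C` are joined to each other by `ω`. -/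
def Connects (ω : Finset (V × V)) (C : Finset V) : Prop :=
  ∀ a ∈ C, ∀ b ∈ C, EdgeJoined ω a b

open Classical in
/-- The total weight of the edge sets within `C` that connect all of `C`. -/
def clusterWt (u : V → V → ℝ) (C : Finset V) : ℝ :=
  ∑ ω ∈ (C ×ˢ C).powerset with Connects ω C, ∏ e ∈ ω, u e.1 e.2

/-- The total weight of all edge sets within `U`. -/
def fullWt (u : V → V → ℝ) (U : Finset V) : ℝ := ∏ e ∈ U ×ˢ U, (1 + u e.1 e.2)

lemma fullWt_eq_sum (u : V → V → ℝ) (U : Finset V) :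
    fullWt u U = ∑ ω ∈ (U ×ˢ U).powerset, ∏ e ∈ ω, u e.1 e.2 :=
  Finset.prod_one_add _

/-- Decomposition of the total weight according to the cluster of a vertex. -/
lemma fullWt_eq_sum_cluster (u : V → V → ℝ) {U : Finset V} {v : V} (hv : v ∈ U) :
    fullWt u U = ∑ C ∈ U.powerset with v ∈ C, clusterWt u C * fullWt u (U \ C) := by
  classical
  rw [fullWt_eq_sum]
  have hmaps : ∀ ω ∈ (U ×ˢ U).powerset,
      (U.filter fun x => EdgeJoined ω v x) ∈ U.powerset.filter fun C => v ∈ C := fun ω _ =>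
    Finset.mem_filter.2 ⟨Finset.mem_powerset.2 (Finset.filter_subset _ _),
      Finset.mem_filter.2 ⟨hv, .refl _⟩⟩
  rw [← Finset.sum_fiberwise_of_maps_to hmaps]
  refine Finset.sum_congr rfl fun C hC => ?_
  obtain ⟨hCU, hvC⟩ : C ⊆ U ∧ v ∈ C := by simpa using hC
  rw [clusterWt, fullWt_eq_sum, Finset.sum_mul_sum, ← Finset.sum_product']
  symm
  refine Finset.sum_nbij' (fun p => p.1 ∪ p.2)
    (fun ω => (ω.filter fun e => e.1 ∈ C, ω.filter fun e => e.1 ∉ C)) ?_ ?_ ?_ ?_ ?_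
  · rintro ⟨ω₁, ω₂⟩ hp
    obtain ⟨⟨h1, hcon⟩, h2⟩ : (ω₁ ⊆ C ×ˢ C ∧ Connects ω₁ C) ∧ ω₂ ⊆ (U \ C) ×ˢ (U \ C) := by
      simpa using hp
    have hcl : ∀ e ∈ ω₁ ∪ ω₂, (e.1 ∈ C ↔ e.2 ∈ C) := by
      intro e he
      rcases Finset.mem_union.1 he with he | he
      · have := Finset.mem_product.1 (h1 he)
        simp [this.1, this.2]
      · have := Finset.mem_product.1 (h2 he)
        have h3 := (Finset.mem_sdiff.1 this.1).2
        have h4 := (Finset.mem_sdiff.1 this.2).2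
        simp [h3, h4]
    refine Finset.mem_filter.2 ⟨Finset.mem_powerset.2 (Finset.union_subset ?_ ?_), ?_⟩
    · exact h1.trans (Finset.product_subset_product hCU hCU)
    · exact h2.trans (Finset.product_subset_product Finset.sdiff_subset Finset.sdiff_subset)
    · ext x
      simp only [Finset.mem_filter]
      constructor
      · rintro ⟨_, hx⟩
        exact (hx.mem_iff hcl).1 hvC
      · exact fun hx => ⟨hCU hx, (hcon v hvC x hx).mono Finset.subset_union_left⟩
  · intro ω hω
    obtain ⟨hωU, hωC⟩ := Finset.mem_filter.1 hω
    rw [Finset.mem_powerset] at hωU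
    have hmem : ∀ x, x ∈ C ↔ x ∈ U ∧ EdgeJoined ω v x := fun x => by
      rw [← hωC, Finset.mem_filter]
    have hcl : ∀ e ∈ ω, (e.1 ∈ C ↔ e.2 ∈ C) := by
      intro e he
      have heU := Finset.mem_product.1 (hωU he)
      rw [hmem, hmem]
      constructor
      · exact fun h => ⟨heU.2, .trans _ _ _ h.2 (.rel _ _ he)⟩
      · exact fun h => ⟨heU.1, .trans _ _ _ h.2 (.symm _ _ (.rel _ _ he))⟩
    refine Finset.mem_product.2 ⟨Finset.mem_filter.2 ⟨Finset.mem_powerset.2 ?_, ?_⟩,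
      Finset.mem_powerset.2 ?_⟩
    · intro e he
      obtain ⟨he, h1⟩ := Finset.mem_filter.1 he
      exact Finset.mem_product.2 ⟨h1, (hcl e he).1 h1⟩
    · intro a ha b hb
      exact EdgeJoined.restrict hcl (.trans _ _ _ (.symm _ _ ((hmem a).1 ha).2) ((hmem b).1 hb).2) ha
    · intro e he
      obtain ⟨he, h1⟩ := Finset.mem_filter.1 he
      have heU := Finset.mem_product.1 (hωU he)
      exact Finset.mem_product.2 ⟨Finset.mem_sdiff.2 ⟨heU.1, h1⟩,
        Finset.mem_sdiff.2 ⟨heU.2, fun h => h1 ((hcl e he).2 h)⟩⟩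
  · rintro ⟨ω₁, ω₂⟩ hp
    obtain ⟨⟨h1, hcon⟩, h2⟩ : (ω₁ ⊆ C ×ˢ C ∧ Connects ω₁ C) ∧ ω₂ ⊆ (U \ C) ×ˢ (U \ C) := by
      simpa using hp
    have h1' : ∀ e ∈ ω₁, e.1 ∈ C := fun e he => (Finset.mem_product.1 (h1 he)).1
    have h2' : ∀ e ∈ ω₂, e.1 ∉ C := fun e he =>
      (Finset.mem_sdiff.1 (Finset.mem_product.1 (h2 he)).1).2
    simp only [Prod.mk.injEq]
    constructor <;> ext e <;> simp only [Finset.mem_filter, Finset.mem_union]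
    · exact ⟨fun h => h.1.resolve_right fun h' => h2' e h' h.2, fun h => ⟨.inl h, h1' e h⟩⟩
    · exact ⟨fun h => h.1.resolve_left fun h' => h.2 (h1' e h'), fun h => ⟨.inr h, h2' e h⟩⟩
  · intro ω _
    exact Finset.filter_union_filter_not_eq _ _
  · rintro ⟨ω₁, ω₂⟩ hp
    obtain ⟨⟨h1, hcon⟩, h2⟩ : (ω₁ ⊆ C ×ˢ C ∧ Connects ω₁ C) ∧ ω₂ ⊆ (U \ C) ×ˢ (U \ C) := by
      simpa using hp
    refine (Finset.prod_union ?_).symm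
    rw [Finset.disjoint_left]
    intro e he he'
    exact (Finset.mem_sdiff.1 (Finset.mem_product.1 (h2 he')).1).2 (Finset.mem_product.1 (h1 he)).1

end Cluster

section Ising

set_option linter.unusedSectionVars false

variable {V : Type*} [Fintype V] [DecidableEq V]

/-- The pair energy of a spin configuration, summed over ordered pairs. -/
def pairEnergy (J : V → V → ℝ) (σ : V → Bool) : ℝ :=
  ∑ p : V × V, J p.1 p.2 * (spin (σ p.1) * spin (σ p.2))

/-- The Boltzmann weight of a spin configuration. -/
def isingWt (J : V → V → ℝ) (σ : V → Bool) : ℝ := exp (pairEnergy J σ)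

/-- The unnormalised expectation. -/
def isingSum (J : V → V → ℝ) (f : (V → Bool) → ℝ) : ℝ := ∑ σ, f σ * isingWt J σ

/-- The partition function. -/
def isingZ (J : V → V → ℝ) : ℝ := ∑ σ, isingWt J σ

/-- The expectation in the finite Ising model. -/
def isingEx (J : V → V → ℝ) (f : (V → Bool) → ℝ) : ℝ := isingSum J f / isingZ J

/-- The product of two spins. -/
def spinPair (i j : V) (σ : V → Bool) : ℝ := spin (σ i) * spin (σ j)

/-- The two-point function of the finite Ising model. -/
def corr (J : V → V → ℝ) (i j : V) : ℝ := isingEx J (spinPair i j)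

/-- Couplings restricted to pairs in `U`. -/
def restrictTo (J : V → V → ℝ) (U : Finset V) (i j : V) : ℝ := if i ∈ U ∧ j ∈ U then J i j else 0

/-- The sitewise product of two spin configurations. -/
def mulConf (σ τ : V → Bool) : V → Bool := fun i => σ i == τ i

/-- The configuration with the spins in `C` flipped. -/
def flipOn (C : Finset V) (σ : V → Bool) : V → Bool := fun i => if i ∈ C then !(σ i) else σ i

lemma isingWt_pos (J : V → V → ℝ) (σ : V → Bool) : 0 < isingWt J σ := exp_pos _

lemma isingZ_pos (J : V → V → ℝ) : 0 < isingZ J :=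
  Finset.sum_pos (fun σ _ => isingWt_pos J σ) Finset.univ_nonempty

lemma isingSum_eq (J : V → V → ℝ) (f : (V → Bool) → ℝ) : isingSum J f = isingEx J f * isingZ J :=
  (div_mul_cancel₀ _ (isingZ_pos J).ne').symm

lemma isingSum_one (J : V → V → ℝ) : isingSum J (fun _ => 1) = isingZ J := by
  simp [isingSum, isingZ]

lemma mulConf_mulConf (σ τ : V → Bool) : mulConf σ (mulConf σ τ) = τ := by
  funext i
  simp only [mulConf]
  cases σ i <;> cases τ i <;> rfl

lemma spin_mulConf (σ τ : V → Bool) (i : V) : spin (mulConf σ τ i) = spin (σ i) * spin (τ i) :=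
  spin_beq _ _

lemma sum_comp_mulConf (σ : V → Bool) (f : (V → Bool) → ℝ) :
    ∑ τ, f (mulConf σ τ) = ∑ τ, f τ :=
  Equiv.sum_comp (Function.Involutive.toPerm (mulConf σ) (mulConf_mulConf σ)) f

lemma flipOn_flipOn (C : Finset V) (σ : V → Bool) : flipOn C (flipOn C σ) = σ := by
  funext i
  by_cases h : i ∈ C <;> simp [flipOn, h]

lemma sum_comp_flipOn (C : Finset V) (f : (V → Bool) → ℝ) :
    ∑ σ, f (flipOn C σ) = ∑ σ, f σ :=
  Equiv.sum_comp (Function.Involutive.toPerm (flipOn C) (flipOn_flipOn C)) f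

lemma sum_eq_zero_of_flipOn (C : Finset V) (f : (V → Bool) → ℝ)
    (hf : ∀ σ, f (flipOn C σ) = -f σ) : ∑ σ, f σ = 0 := by
  have := sum_comp_flipOn C f
  simp_rw [hf, Finset.sum_neg_distrib] at this
  linarith

lemma spin_flipOn (C : Finset V) (σ : V → Bool) (i : V) :
    spin (flipOn C σ i) = if i ∈ C then -spin (σ i) else spin (σ i) := by
  by_cases h : i ∈ C <;> simp [flipOn, h, spin_not]

lemma spinPair_flipOn (C : Finset V) (σ : V → Bool) {i j : V} (h : i ∈ C ↔ j ∈ C) :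
    spinPair i j (flipOn C σ) = spinPair i j σ := by
  unfold spinPair
  rw [spin_flipOn, spin_flipOn]
  by_cases hi : i ∈ C
  · rw [if_pos hi, if_pos (h.1 hi)]; ring
  · rw [if_neg hi, if_neg fun hj => hi (h.2 hj)]

lemma spinPair_flipOn_neg (C : Finset V) (σ : V → Bool) {i j : V} (h : ¬(i ∈ C ↔ j ∈ C)) :
    spinPair i j (flipOn C σ) = -spinPair i j σ := by
  unfold spinPair
  rw [spin_flipOn, spin_flipOn]
  by_cases hi : i ∈ C <;> by_cases hj : j ∈ C <;> simp_all

lemma spinPair_mul_self (i j : V) (σ : V → Bool) : spinPair i j σ * spinPair i j σ = 1 := by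
  unfold spinPair
  rw [mul_mul_mul_comm, spin_mul_self, spin_mul_self, one_mul]

lemma spinPair_mulConf (i j : V) (σ τ : V → Bool) :
    spinPair i j (mulConf σ τ) = spinPair i j σ * spinPair i j τ := by
  simp only [spinPair, spin_mulConf]; ring

lemma spinPair_comm (i j : V) (σ : V → Bool) : spinPair i j σ = spinPair j i σ := mul_comm _ _

lemma corr_comm (J : V → V → ℝ) (i j : V) : corr J i j = corr J j i := by
  unfold corr
  congr 1
  funext σ
  exact spinPair_comm i j σ

lemma abs_spinPair (i j : V) (σ : V → Bool) : |spinPair i j σ| = 1 := by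
  rw [spinPair, abs_mul, abs_spin, abs_spin, one_mul]

lemma isFerro_spinPair (i j : V) : IsFerro (spinPair i j) := IsFerro.spin_mul_spin i j

lemma isingEx_le_of_le (J : V → V → ℝ) {f g : (V → Bool) → ℝ} (h : ∀ σ, f σ ≤ g σ) :
    isingEx J f ≤ isingEx J g := by
  refine div_le_div_of_nonneg_right (Finset.sum_le_sum fun σ _ => ?_) (isingZ_pos J).le
  exact mul_le_mul_of_nonneg_right (h σ) (isingWt_pos J σ).le

lemma isingEx_const (J : V → V → ℝ) (r : ℝ) : isingEx J (fun _ => r) = r := by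
  rw [isingEx, isingSum, ← Finset.mul_sum, ← isingZ, mul_div_assoc, div_self (isingZ_pos J).ne',
    mul_one]

lemma corr_le_one (J : V → V → ℝ) (i j : V) : corr J i j ≤ 1 := by
  rw [← isingEx_const J 1]
  exact isingEx_le_of_le J fun σ => (le_abs_self _).trans (abs_spinPair i j σ).le

/-- Summation over a pair of independent replicas, in relative coordinates. -/
lemma isingSum_mul_isingSum (J J' : V → V → ℝ) (f g : (V → Bool) → ℝ) :
    isingSum J f * isingSum J' g =
      ∑ σ, ∑ τ, f σ * g (mulConf σ τ) * (isingWt J σ * isingWt J' (mulConf σ τ)) := by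
  rw [isingSum, isingSum, Finset.sum_mul_sum]
  refine Finset.sum_congr rfl fun σ _ => ?_
  rw [← sum_comp_mulConf σ]
  exact Finset.sum_congr rfl fun τ _ => by ring

lemma isingWt_mul_isingWt (J J' : V → V → ℝ) (σ τ : V → Bool) :
    isingWt J σ * isingWt J' (mulConf σ τ) =
      exp (∑ p : V × V, (J p.1 p.2 + J' p.1 p.2 * spinPair p.1 p.2 τ) *
        (spin (σ p.1) * spin (σ p.2))) := by
  rw [isingWt, isingWt, ← exp_add, pairEnergy, pairEnergy, ← Finset.sum_add_distrib]
  congr 1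
  refine Finset.sum_congr rfl fun p _ => ?_
  simp only [spinPair, spin_mulConf]
  ring

/-- The replica weight is ferromagnetic in the first replica. -/
lemma isFerro_isingWt_mul {J J' : V → V → ℝ} (h : ∀ i j, |J' i j| ≤ J i j) (τ : V → Bool) :
    IsFerro fun σ => isingWt J σ * isingWt J' (mulConf σ τ) := by
  simp_rw [isingWt_mul_isingWt]
  refine IsFerro.exp_sum _ (fun p : V × V => J p.1 p.2 + J' p.1 p.2 * spinPair p.1 p.2 τ)
    (fun p _ => ?_) Prod.fst Prod.snd
  have h1 := neg_abs_le (J' p.1 p.2 * spinPair p.1 p.2 τ)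
  rw [abs_mul, abs_spinPair, mul_one] at h1
  linarith [h p.1 p.2]

lemma isFerro_isingWt {J : V → V → ℝ} (h : ∀ i j, 0 ≤ J i j) : IsFerro (isingWt J) :=
  IsFerro.exp_sum _ (fun p : V × V => J p.1 p.2) (fun p _ => h p.1 p.2) Prod.fst Prod.snd

/-- Griffiths' first inequality. -/
lemma isingEx_nonneg {J : V → V → ℝ} (h : ∀ i j, 0 ≤ J i j) {f : (V → Bool) → ℝ}
    (hf : IsFerro f) : 0 ≤ isingEx J f :=
  div_nonneg (hf.mul (isFerro_isingWt h)).sum_nonneg (isingZ_pos J).le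

lemma corr_nonneg {J : V → V → ℝ} (h : ∀ i j, 0 ≤ J i j) (i j : V) : 0 ≤ corr J i j :=
  isingEx_nonneg h (isFerro_spinPair i j)

/-- Monotonicity of correlations in the couplings, also against signed couplings. -/
lemma corr_le_corr {J J' : V → V → ℝ} (h : ∀ i j, |J' i j| ≤ J i j) (i j : V) :
    corr J' i j ≤ corr J i j := by
  have key : 0 ≤ isingSum J (spinPair i j) * isingSum J' (fun _ => 1) -
      isingSum J (fun _ => 1) * isingSum J' (spinPair i j) := by
    rw [isingSum_mul_isingSum, isingSum_mul_isingSum, ← Finset.sum_sub_distrib]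
    simp_rw [← Finset.sum_sub_distrib]
    rw [Finset.sum_comm]
    refine Finset.sum_nonneg fun τ _ => ?_
    have h1 : 0 ≤ 1 - spinPair i j τ := by
      have := (le_abs_self _).trans (abs_spinPair i j τ).le
      linarith
    refine (((IsFerro.const h1).mul (isFerro_spinPair i j)).mul
      (isFerro_isingWt_mul h τ)).congr (fun σ => ?_) |>.sum_nonneg
    rw [spinPair_mulConf]
    ring
  rw [isingSum_one, isingSum_one, isingSum_eq, isingSum_eq] at key
  have hZ := mul_pos (isingZ_pos J) (isingZ_pos J')
  have : 0 ≤ (corr J i j - corr J' i j) * (isingZ J * isingZ J') := by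
    unfold corr; linarith
  exact sub_nonneg.1 (nonneg_of_mul_nonneg_left this hZ)

/-- Griffiths' second inequality for pairs. -/
lemma corr_mul_corr_le {J : V → V → ℝ} (h : ∀ i j, 0 ≤ J i j) (i j k l : V) :
    corr J i j * corr J k l ≤ isingEx J (fun σ => spinPair i j σ * spinPair k l σ) := by
  have key : 0 ≤ isingSum J (fun σ => spinPair i j σ * spinPair k l σ) * isingSum J (fun _ => 1) -
      isingSum J (spinPair i j) * isingSum J (spinPair k l) := by
    rw [isingSum_mul_isingSum, isingSum_mul_isingSum, ← Finset.sum_sub_distrib]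
    simp_rw [← Finset.sum_sub_distrib]
    rw [Finset.sum_comm]
    refine Finset.sum_nonneg fun τ _ => ?_
    have h1 : 0 ≤ 1 - spinPair k l τ := by
      have := (le_abs_self _).trans (abs_spinPair k l τ).le
      linarith
    refine (((IsFerro.const h1).mul ((isFerro_spinPair i j).mul (isFerro_spinPair k l))).mul
      (isFerro_isingWt_mul (fun a b => (abs_of_nonneg (h a b)).le) τ)).congr
      (fun σ => ?_) |>.sum_nonneg
    rw [spinPair_mulConf]
    ring
  rw [isingSum_one, isingSum_eq, isingSum_eq, isingSum_eq] at key
  have hZ := mul_pos (isingZ_pos J) (isingZ_pos J)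
  have : 0 ≤ (isingEx J (fun σ => spinPair i j σ * spinPair k l σ) - corr J i j * corr J k l) *
      (isingZ J * isingZ J) := by
    unfold corr; linarith
  exact sub_nonneg.1 (nonneg_of_mul_nonneg_left this hZ)

end Ising

section Bracket

set_option linter.unusedSectionVars false

variable {V : Type*} [Fintype V] [DecidableEq V]

/-- The edge weight of the double Ising model in relative coordinates. -/
def dblWt (J : V → V → ℝ) (σ τ : V → Bool) (i j : V) : ℝ :=
  if τ i = τ j then exp (2 * J i j * (spin (σ i) * spin (σ j))) - 1 else 0

lemma one_add_dblWt (J : V → V → ℝ) (σ τ : V → Bool) (i j : V) :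
    1 + dblWt J σ τ i j =
      exp ((J i j + J i j * spinPair i j τ) * (spin (σ i) * spin (σ j))) := by
  unfold dblWt spinPair
  rw [spin_mul_spin_eq (τ i)]
  split_ifs
  · rw [add_sub_cancel]; congr 1; ring
  · simp

lemma fullWt_dblWt (J : V → V → ℝ) (σ τ : V → Bool) (U : Finset V) :
    fullWt (dblWt J σ τ) U = exp (∑ p ∈ U ×ˢ U,
      (J p.1 p.2 + J p.1 p.2 * spinPair p.1 p.2 τ) * (spin (σ p.1) * spin (σ p.2))) := by
  rw [fullWt, exp_sum]
  exact Finset.prod_congr rfl fun p _ => one_add_dblWt J σ τ p.1 p.2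

lemma isingWt_restrictTo_mul (J : V → V → ℝ) (U : Finset V) (σ τ : V → Bool) :
    isingWt (restrictTo J U) σ * isingWt (restrictTo J U) (mulConf σ τ) =
      fullWt (dblWt J σ τ) U := by
  rw [isingWt_mul_isingWt, fullWt_dblWt]
  congr 1
  rw [← Finset.sum_subset (Finset.subset_univ (U ×ˢ U))]
  · refine Finset.sum_congr rfl fun p hp => ?_
    simp [restrictTo, Finset.mem_product.1 hp]
  · intro p _ hp
    rw [Finset.mem_product] at hp
    simp [restrictTo, hp]

lemma isingWt_mul_restrictTo (J : V → V → ℝ) (S : Finset V) (σ τ : V → Bool) :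
    isingWt J σ * isingWt (restrictTo J S) (mulConf σ τ) =
      fullWt (dblWt J σ τ) S *
        exp (∑ p ∈ (S ×ˢ S)ᶜ, J p.1 p.2 * (spin (σ p.1) * spin (σ p.2))) := by
  rw [isingWt_mul_isingWt, fullWt_dblWt, ← exp_add]
  congr 1
  rw [← Finset.sum_add_sum_compl (S ×ˢ S)]
  congr 1
  · refine Finset.sum_congr rfl fun p hp => ?_
    simp [restrictTo, Finset.mem_product.1 hp]
  · refine Finset.sum_congr rfl fun p hp => ?_
    rw [Finset.mem_compl, Finset.mem_product] at hp
    simp [restrictTo, hp]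

lemma restrictTo_univ (J : V → V → ℝ) : restrictTo J Finset.univ = J := by
  funext i j; simp [restrictTo]

lemma clusterWt_congr {u u' : V → V → ℝ} {C : Finset V}
    (h : ∀ i ∈ C, ∀ j ∈ C, u i j = u' i j) : clusterWt u C = clusterWt u' C := by
  classical
  refine Finset.sum_congr rfl fun ω hω => Finset.prod_congr rfl fun e he => ?_
  have := Finset.mem_product.1 (Finset.mem_powerset.1 (Finset.mem_filter.1 hω).1 he)
  exact h _ this.1 _ this.2

lemma fullWt_congr {u u' : V → V → ℝ} {U : Finset V}
    (h : ∀ i ∈ U, ∀ j ∈ U, u i j = u' i j) : fullWt u U = fullWt u' U :=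
  Finset.prod_congr rfl fun e he => by
    have := Finset.mem_product.1 he
    rw [h _ this.1 _ this.2]

lemma dblWt_flipOn_left (J : V → V → ℝ) (C : Finset V) (σ τ : V → Bool) {i j : V}
    (h : i ∈ C ↔ j ∈ C) : dblWt J (flipOn C σ) τ i j = dblWt J σ τ i j := by
  have := spinPair_flipOn C σ h
  unfold spinPair at this
  rw [dblWt, this, dblWt]

lemma dblWt_flipOn_right (J : V → V → ℝ) (C : Finset V) (σ τ : V → Bool) {i j : V}
    (h : i ∈ C ↔ j ∈ C) : dblWt J σ (flipOn C τ) i j = dblWt J σ τ i j := by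
  have : (flipOn C τ i = flipOn C τ j) = (τ i = τ j) := by
    unfold flipOn
    by_cases hi : i ∈ C
    · rw [if_pos hi, if_pos (h.1 hi)]; simp
    · rw [if_neg hi, if_neg fun hj => hi (h.2 hj)]
  simp only [dblWt, this]

lemma clusterWt_mul_fullWt_congr {u u' : V → V → ℝ} {U C : Finset V}
    (h : ∀ i j, (i ∈ C ↔ j ∈ C) → u i j = u' i j) :
    clusterWt u C * fullWt u (U \ C) = clusterWt u' C * fullWt u' (U \ C) := by
  rw [clusterWt_congr fun i hi j hj => h i j (by simp [hi, hj]),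
    fullWt_congr fun i hi j hj => h i j (by
      simp [(Finset.mem_sdiff.1 hi).2, (Finset.mem_sdiff.1 hj).2])]

/-- On a cluster, the relative spin is constant. -/
lemma spinPair_mul_clusterWt (J : V → V → ℝ) (σ τ : V → Bool) {C : Finset V} {a b : V}
    (ha : a ∈ C) (hb : b ∈ C) :
    spinPair a b τ * clusterWt (dblWt J σ τ) C = clusterWt (dblWt J σ τ) C := by
  classical
  rw [clusterWt, Finset.mul_sum]
  refine Finset.sum_congr rfl fun ω hω => ?_
  by_cases h0 : ∏ e ∈ ω, dblWt J σ τ e.1 e.2 = 0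
  · rw [h0, mul_zero]
  have hτ : ∀ e ∈ ω, τ e.1 = τ e.2 := by
    intro e he
    by_contra hne
    exact Finset.prod_ne_zero_iff.1 h0 e he (by simp [dblWt, hne])
  have hab : τ a = τ b := by
    have := (Finset.mem_filter.1 hω).2 a ha b hb
    induction this with
    | rel x y h => exact hτ _ h
    | refl x => rfl
    | symm x y _ ih => exact (ih hb ha).symm
    | trans x y z h1 h2 ih1 ih2 =>
      have aux : ∀ x y, EdgeJoined ω x y → τ x = τ y := by
        intro x y h
        induction h with
        | rel x y h => exact hτ _ h
        | refl x => rfl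
        | symm x y _ ih => exact ih.symm
        | trans x y z _ _ ih1 ih2 => exact ih1.trans ih2
      exact (aux _ _ h1).trans (aux _ _ h2)
  rw [spinPair, hab, spin_mul_self, one_mul]

lemma isFerro_dblWt {J : V → V → ℝ} (h : ∀ i j, 0 ≤ J i j) (τ : V → Bool) (i j : V) :
    IsFerro fun σ => dblWt J σ τ i j := by
  unfold dblWt
  split_ifs
  · exact IsFerro.exp_pair_sub_one (mul_nonneg zero_le_two (h i j)) i j
  · exact IsFerro.const le_rfl

lemma isFerro_clusterWt {J : V → V → ℝ} (h : ∀ i j, 0 ≤ J i j) (τ : V → Bool) (C : Finset V) :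
    IsFerro fun σ => clusterWt (dblWt J σ τ) C :=
  IsFerro.finset_sum fun _ _ => IsFerro.finset_prod fun _ _ => isFerro_dblWt h τ _ _

lemma isFerro_fullWt {J : V → V → ℝ} (h : ∀ i j, 0 ≤ J i j) (τ : V → Bool) (U : Finset V) :
    IsFerro fun σ => fullWt (dblWt J σ τ) U :=
  IsFerro.finset_prod fun _ _ => (IsFerro.const zero_le_one).add (isFerro_dblWt h τ _ _)

/-- The contribution of the cluster `C` to the double sum of `f` over the graph `U`. -/
def clusterSum (J : V → V → ℝ) (U C : Finset V) (f : (V → Bool) → (V → Bool) → ℝ) : ℝ :=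
  ∑ σ, ∑ τ, f σ τ * (clusterWt (dblWt J σ τ) C * fullWt (dblWt J σ τ) (U \ C))

lemma sum_fullWt_eq_sum_clusterSum (J : V → V → ℝ) {U : Finset V} {v : V} (hv : v ∈ U)
    (f : (V → Bool) → (V → Bool) → ℝ) :
    ∑ σ, ∑ τ, f σ τ * fullWt (dblWt J σ τ) U =
      ∑ C ∈ U.powerset with v ∈ C, clusterSum J U C f := by
  unfold clusterSum
  simp_rw [fullWt_eq_sum_cluster _ hv, Finset.mul_sum]
  rw [Finset.sum_comm' (t' := Finset.univ) (s' := fun _ => U.powerset.filter fun C => v ∈ C)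
    (by simp)]
  · refine Finset.sum_congr rfl fun σ _ => ?_
    rw [Finset.sum_comm]

lemma clusterSum_const_mul (J : V → V → ℝ) (U C : Finset V) (r : ℝ)
    (f : (V → Bool) → (V → Bool) → ℝ) :
    clusterSum J U C (fun σ τ => r * f σ τ) = r * clusterSum J U C f := by
  simp only [clusterSum, Finset.mul_sum, mul_assoc]

lemma clusterSum_sum {ι : Type*} (J : V → V → ℝ) (U C : Finset V) (s : Finset ι)
    (f : ι → (V → Bool) → (V → Bool) → ℝ) :
    clusterSum J U C (fun σ τ => ∑ k ∈ s, f k σ τ) = ∑ k ∈ s, clusterSum J U C (f k) := by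
  classical
  induction s using Finset.induction_on with
  | empty => simp [clusterSum]
  | insert a s ha ih =>
    rw [Finset.sum_insert ha, ← ih]
    simp only [clusterSum, Finset.sum_insert ha, add_mul, Finset.sum_add_distrib]

lemma clusterSum_eq_zero_left (J : V → V → ℝ) (U C : Finset V)
    {f : (V → Bool) → (V → Bool) → ℝ} (hf : ∀ σ τ, f (flipOn C σ) τ = -f σ τ) :
    clusterSum J U C f = 0 := by
  rw [clusterSum, Finset.sum_comm]
  refine Finset.sum_eq_zero fun τ _ => sum_eq_zero_of_flipOn C _ fun σ => ?_
  rw [hf, clusterWt_mul_fullWt_congr fun i j h => dblWt_flipOn_left J C σ τ h, neg_mul]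

lemma clusterSum_eq_zero_right (J : V → V → ℝ) (U C : Finset V)
    {f : (V → Bool) → (V → Bool) → ℝ} (hf : ∀ σ τ, f σ (flipOn C τ) = -f σ τ) :
    clusterSum J U C f = 0 := by
  refine Finset.sum_eq_zero fun σ _ => sum_eq_zero_of_flipOn C _ fun τ => ?_
  rw [hf, clusterWt_mul_fullWt_congr fun i j h => dblWt_flipOn_right J C σ τ h, neg_mul]

lemma clusterSum_spinPair (J : V → V → ℝ) (U C : Finset V) {a b : V} (ha : a ∈ C) (hb : b ∈ C)
    (f : (V → Bool) → (V → Bool) → ℝ) :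
    clusterSum J U C (fun σ τ => f σ τ * spinPair a b τ) = clusterSum J U C f := by
  refine Finset.sum_congr rfl fun σ _ => Finset.sum_congr rfl fun τ _ => ?_
  rw [mul_assoc, ← mul_assoc (spinPair a b τ), spinPair_mul_clusterWt J σ τ ha hb]

lemma clusterSum_mono {J : V → V → ℝ} (h : ∀ i j, 0 ≤ J i j) (U C : Finset V)
    {f g : (V → Bool) → (V → Bool) → ℝ} (hfg : ∀ τ, IsFerro fun σ => g σ τ - f σ τ) :
    clusterSum J U C f ≤ clusterSum J U C g := by
  rw [clusterSum, clusterSum, Finset.sum_comm, Finset.sum_comm (f := fun σ τ => g σ τ * _)]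
  refine Finset.sum_le_sum fun τ _ => ?_
  rw [← sub_nonneg, ← Finset.sum_sub_distrib]
  refine ((hfg τ).mul ((isFerro_clusterWt h τ C).mul (isFerro_fullWt h τ (U \ C)))).congr
    (fun σ => ?_) |>.sum_nonneg
  ring

/-- Inserting a relative two-point function forces both points into the cluster of the root. -/
lemma sum_spinPair_fullWt (J : V → V → ℝ) {U : Finset V} {a b : V} (ha : a ∈ U)
    {f : (V → Bool) → (V → Bool) → ℝ} (hf : ∀ C σ τ, f σ (flipOn C τ) = f σ τ) :
    ∑ σ, ∑ τ, (f σ τ * spinPair a b τ) * fullWt (dblWt J σ τ) U =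
      ∑ C ∈ U.powerset with a ∈ C ∧ b ∈ C, clusterSum J U C f := by
  rw [sum_fullWt_eq_sum_clusterSum J ha]
  rw [← Finset.filter_filter, Finset.sum_filter (s := Finset.filter _ _)]
  refine Finset.sum_congr rfl fun C hC => ?_
  have haC : a ∈ C := (Finset.mem_filter.1 hC).2
  split_ifs with hb
  · exact clusterSum_spinPair J U C haC hb f
  · refine clusterSum_eq_zero_right J U C fun σ τ => ?_
    rw [hf, spinPair_flipOn_neg C τ (by simp [haC, hb]), mul_neg]

/-- The Lieb–Simon inequality. -/
theorem corr_le_sum_corr_mul_corr {J : V → V → ℝ} (h : ∀ i j, 0 ≤ J i j) {S : Finset V} {o z : V}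
    (ho : o ∈ S) (hz : z ∉ S) :
    corr J o z ≤ ∑ x ∈ S, ∑ y ∈ Sᶜ, (J x y + J y x) * (corr (restrictTo J S) o x * corr J y z) := by
  set E : (V → Bool) → ℝ := fun σ =>
    exp (∑ p ∈ (S ×ˢ S)ᶜ, J p.1 p.2 * (spin (σ p.1) * spin (σ p.2))) with hE
  have hZ := mul_pos (isingZ_pos J) (isingZ_pos (restrictTo J S))
  refine le_of_mul_le_mul_right ?_ hZ
  have hL : corr J o z * (isingZ J * isingZ (restrictTo J S)) =
      ∑ C ∈ S.powerset with o ∈ C, clusterSum J S C fun σ _ => spinPair o z σ * E σ := by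
    rw [← sum_fullWt_eq_sum_clusterSum J ho]
    have h1 := isingSum_mul_isingSum J (restrictTo J S) (spinPair o z) (fun _ => 1)
    rw [isingSum_one, isingSum_eq] at h1
    rw [corr, ← mul_assoc, h1]
    refine Finset.sum_congr rfl fun σ _ => Finset.sum_congr rfl fun τ _ => ?_
    rw [isingWt_mul_restrictTo]
    ring
  have hR : ∀ x ∈ S, ∀ y, corr (restrictTo J S) o x * corr J y z *
      (isingZ J * isingZ (restrictTo J S)) = ∑ C ∈ S.powerset with o ∈ C ∧ x ∈ C,
        clusterSum J S C fun σ _ => spinPair o z σ * spinPair x y σ * E σ := by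
    intro x hx y
    rw [← sum_spinPair_fullWt J ho fun _ _ _ => rfl]
    have h1 := isingSum_mul_isingSum J (restrictTo J S) (spinPair y z) (spinPair o x)
    rw [isingSum_eq, isingSum_eq] at h1
    rw [corr, corr, show ∀ a b c d : ℝ, a * b * (c * d) = b * c * (a * d) by intros; ring, h1]
    refine Finset.sum_congr rfl fun σ _ => Finset.sum_congr rfl fun τ _ => ?_
    rw [isingWt_mul_restrictTo, spinPair_mulConf]
    have h2 := spin_mul_self (σ x)
    simp only [spinPair]
    linear_combination (0 : ℝ) * h2
  rw [hL, Finset.sum_mul]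
  have hR' : ∑ x ∈ S, (∑ y ∈ Sᶜ, (J x y + J y x) * (corr (restrictTo J S) o x * corr J y z)) *
      (isingZ J * isingZ (restrictTo J S)) = ∑ C ∈ S.powerset with o ∈ C, ∑ x ∈ C, ∑ y ∈ Sᶜ,
        (J x y + J y x) * clusterSum J S C
          (fun σ _ => spinPair o z σ * spinPair x y σ * E σ) := by
    rw [Finset.sum_comm' (t' := S) (s' := fun x => S.powerset.filter fun C => o ∈ C ∧ x ∈ C)]
    · refine Finset.sum_congr rfl fun x hx => ?_
      rw [Finset.sum_mul, Finset.sum_comm]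
      refine Finset.sum_congr rfl fun y _ => ?_
      rw [mul_assoc, hR x hx y, Finset.mul_sum]
    · intro C x
      simp only [Finset.mem_filter, Finset.mem_powerset]
      constructor
      · rintro ⟨⟨h1, h2⟩, h3⟩
        exact ⟨⟨h1, h2, h3⟩, h1 h3⟩
      · rintro ⟨⟨h1, h2, h3⟩, _⟩
        exact ⟨⟨h1, h2⟩, h3⟩
  rw [hR']
  refine Finset.sum_le_sum fun C hC => ?_
  obtain ⟨hCS, hoC⟩ : C ⊆ S ∧ o ∈ C := by simpa using hC
  have hzC : z ∉ C := fun h => hz (hCS h)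
  set B : Finset (V × V) := C ×ˢ Sᶜ ∪ Sᶜ ×ˢ C with hB
  have hBS : B ⊆ (S ×ˢ S)ᶜ := by
    intro p hp
    simp only [hB, Finset.mem_union, Finset.mem_product, Finset.mem_compl] at hp ⊢
    tauto
  set H : (V → Bool) → ℝ := fun σ => ∑ p ∈ B, J p.1 p.2 * (spin (σ p.1) * spin (σ p.2)) with hH
  set E2 : (V → Bool) → ℝ := fun σ =>
    exp (∑ p ∈ (S ×ˢ S)ᶜ \ B, J p.1 p.2 * (spin (σ p.1) * spin (σ p.2))) with hE2
  have hEE : ∀ σ, E σ = exp (H σ) * E2 σ := by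
    intro σ
    rw [hE, hE2, hH]
    simp only
    rw [← exp_add, add_comm, Finset.sum_sdiff hBS]
  have hE2flip : ∀ σ, E2 (flipOn C σ) = E2 σ := by
    intro σ
    simp only [hE2]
    congr 1
    refine Finset.sum_congr rfl fun p hp => ?_
    have : p.1 ∈ C ↔ p.2 ∈ C := by
      have h1 : p.1 ∈ C → p.1 ∈ S := fun h => hCS h
      have h2 : p.2 ∈ C → p.2 ∈ S := fun h => hCS h
      simp only [hB, Finset.mem_sdiff, Finset.mem_union, Finset.mem_product,
        Finset.mem_compl] at hp
      tauto
    have := spinPair_flipOn C σ this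
    unfold spinPair at this
    rw [this]
  have hzero : clusterSum J S C (fun σ _ => spinPair o z σ * E2 σ) = 0 := by
    refine clusterSum_eq_zero_left J S C fun σ τ => ?_
    rw [hE2flip, spinPair_flipOn_neg C σ (by simp [hoC, hzC]), neg_mul]
  have hmono : clusterSum J S C (fun σ _ => spinPair o z σ * E σ) ≤
      clusterSum J S C (fun σ _ => spinPair o z σ * H σ * E σ + spinPair o z σ * E2 σ) := by
    refine clusterSum_mono h S C fun τ => ?_
    refine ((isFerro_spinPair o z).mul ((IsFerro.mul_exp_sum_sub B (fun p => J p.1 p.2)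
      (fun p _ => h _ _) Prod.fst Prod.snd).mul (IsFerro.exp_sum ((S ×ˢ S)ᶜ \ B)
        (fun p => J p.1 p.2) (fun p _ => h _ _) Prod.fst Prod.snd))).congr fun σ => ?_
    rw [hEE σ]
    simp only [hH, hE2]
    ring
  refine hmono.trans (le_of_eq ?_)
  have hadd : clusterSum J S C
      (fun σ _ => spinPair o z σ * H σ * E σ + spinPair o z σ * E2 σ) =
      clusterSum J S C (fun σ _ => spinPair o z σ * H σ * E σ) +
        clusterSum J S C (fun σ _ => spinPair o z σ * E2 σ) := by
    simp only [clusterSum, add_mul, Finset.sum_add_distrib]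
  rw [hadd, hzero, add_zero]
  have hHexp : ∀ σ, H σ = ∑ x ∈ C, ∑ y ∈ Sᶜ, (J x y + J y x) * spinPair x y σ := by
    intro σ
    simp only [hH, hB]
    rw [Finset.sum_union]
    · rw [Finset.sum_product, Finset.sum_product_right, ← Finset.sum_add_distrib]
      refine Finset.sum_congr rfl fun x _ => ?_
      rw [← Finset.sum_add_distrib]
      refine Finset.sum_congr rfl fun y _ => ?_
      simp only [spinPair]
      ring
    · rw [Finset.disjoint_left]
      rintro p hp hp'
      have h1 := (Finset.mem_product.1 hp).1
      have h2 := (Finset.mem_product.1 hp').1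
      exact Finset.mem_compl.1 h2 (hCS h1)
  simp_rw [← clusterSum_const_mul, ← clusterSum_sum]
  congr 1
  funext σ τ
  rw [hHexp, Finset.mul_sum, Finset.sum_mul]
  refine Finset.sum_congr rfl fun x _ => ?_
  rw [Finset.mul_sum, Finset.sum_mul]
  exact Finset.sum_congr rfl fun y _ => by ring

end Bracket

section Sharpness

set_option linter.unusedSectionVars false

variable {V : Type*} [Fintype V] [DecidableEq V]

lemma sum_filter_and {ι : Type*} (s : Finset ι) (P Q : ι → Prop) [DecidablePred P]
    [DecidablePred Q] (f : ι → ℝ) :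
    ∑ i ∈ s with P i ∧ Q i, f i = ∑ i ∈ s with P i, if Q i then f i else 0 := by
  rw [← Finset.filter_filter, Finset.sum_filter]

/-- Functions of the spins inside and outside `C` decouple under the uniform measure. -/
lemma sum_mul_sum_of_dependsOn (C : Finset V) (F G : (V → Bool) × (V → Bool) → ℝ)
    (hF : ∀ p q : (V → Bool) × (V → Bool),
      (∀ i ∈ C, p.1 i = q.1 i) → (∀ i ∈ C, p.2 i = q.2 i) → F p = F q)
    (hG : ∀ p q : (V → Bool) × (V → Bool),
      (∀ i ∉ C, p.1 i = q.1 i) → (∀ i ∉ C, p.2 i = q.2 i) → G p = G q) :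
    (∑ p, F p) * ∑ q, G q =
      (Fintype.card ((V → Bool) × (V → Bool)) : ℝ) * ∑ p, F p * G p := by
  let mix : (V → Bool) × (V → Bool) → (V → Bool) × (V → Bool) → (V → Bool) × (V → Bool) :=
    fun p q => (C.piecewise p.1 q.1, C.piecewise p.2 q.2)
  let T : ((V → Bool) × (V → Bool)) × ((V → Bool) × (V → Bool)) →
      ((V → Bool) × (V → Bool)) × ((V → Bool) × (V → Bool)) :=
    fun r => (mix r.1 r.2, mix r.2 r.1)
  have hT : Function.Involutive T := by
    rintro ⟨⟨p, p'⟩, ⟨q, q'⟩⟩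
    simp only [T, mix, Prod.mk.injEq]
    refine ⟨⟨?_, ?_⟩, ?_, ?_⟩ <;> funext i <;> by_cases h : i ∈ C <;> simp [h]
  rw [Finset.sum_mul_sum, ← Finset.sum_product', Finset.univ_product_univ,
    ← Equiv.sum_comp (Function.Involutive.toPerm T hT)]
  have : ∀ r : ((V → Bool) × (V → Bool)) × ((V → Bool) × (V → Bool)),
      F (Function.Involutive.toPerm T hT r).1 * G (Function.Involutive.toPerm T hT r).2 = F r.1 * G r.1 := by
    intro r
    simp only [Function.Involutive.coe_toPerm, T, mix]
    rw [hF _ r.1 (fun i hi => by simp [hi]) (fun i hi => by simp [hi]),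
      hG _ r.1 (fun i hi => by simp [hi]) (fun i hi => by simp [hi])]
  simp_rw [this]
  rw [Fintype.sum_prod_type, Finset.mul_sum]
  refine Finset.sum_congr rfl fun p _ => ?_
  dsimp only
  rw [Finset.sum_const, Finset.card_univ, nsmul_eq_mul]

lemma clusterWt_dblWt_congr (J : V → V → ℝ) {C : Finset V} {p q : (V → Bool) × (V → Bool)}
    (h1 : ∀ i ∈ C, p.1 i = q.1 i) (h2 : ∀ i ∈ C, p.2 i = q.2 i) :
    clusterWt (dblWt J p.1 p.2) C = clusterWt (dblWt J q.1 q.2) C :=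
  clusterWt_congr fun i hi j hj => by simp only [dblWt, h1 i hi, h1 j hj, h2 i hi, h2 j hj]

lemma fullWt_dblWt_congr (J : V → V → ℝ) {U : Finset V} {p q : (V → Bool) × (V → Bool)}
    (h1 : ∀ i ∈ U, p.1 i = q.1 i) (h2 : ∀ i ∈ U, p.2 i = q.2 i) :
    fullWt (dblWt J p.1 p.2) U = fullWt (dblWt J q.1 q.2) U :=
  fullWt_congr fun i hi j hj => by simp only [dblWt, h1 i hi, h1 j hj, h2 i hi, h2 j hj]

/-- The total weight of the configurations in which `C` is a cluster. -/
def clusterMass (J : V → V → ℝ) (C : Finset V) : ℝ := clusterSum J Finset.univ C fun _ _ => 1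

lemma clusterMass_nonneg {J : V → V → ℝ} (h : ∀ i j, 0 ≤ J i j) (C : Finset V) :
    0 ≤ clusterMass J C := by
  have := clusterSum_mono h Finset.univ C (f := fun _ _ => 0) (g := fun _ _ => 1)
    fun _ => by simpa using IsFerro.const zero_le_one
  simpa [clusterMass, clusterSum] using this

/-- Given that `C` is a cluster, the spins outside `C` form two independent Ising models. -/
lemma clusterSum_eq_mul_clusterMass (J : V → V → ℝ) (C : Finset V) (f g : (V → Bool) → ℝ)
    (hf : ∀ σ σ', (∀ i ∉ C, σ i = σ' i) → f σ = f σ')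
    (hg : ∀ σ σ', (∀ i ∉ C, σ i = σ' i) → g σ = g σ') :
    clusterSum J Finset.univ C (fun σ τ => f σ * g (mulConf σ τ)) =
      isingEx (restrictTo J Cᶜ) f * isingEx (restrictTo J Cᶜ) g * clusterMass J C := by
  have key : ∀ f g : (V → Bool) → ℝ, (∀ σ σ', (∀ i ∉ C, σ i = σ' i) → f σ = f σ') →
      (∀ σ σ', (∀ i ∉ C, σ i = σ' i) → g σ = g σ') →
      (∑ p : (V → Bool) × (V → Bool), clusterWt (dblWt J p.1 p.2) C) *
        (isingSum (restrictTo J Cᶜ) f * isingSum (restrictTo J Cᶜ) g) =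
      (Fintype.card ((V → Bool) × (V → Bool)) : ℝ) *
        clusterSum J Finset.univ C (fun σ τ => f σ * g (mulConf σ τ)) := by
    intro f g hf hg
    rw [isingSum_mul_isingSum]
    have h1 := sum_mul_sum_of_dependsOn C (fun p => clusterWt (dblWt J p.1 p.2) C)
      (fun p => f p.1 * g (mulConf p.1 p.2) * fullWt (dblWt J p.1 p.2) Cᶜ)
      (fun p q h1 h2 => clusterWt_dblWt_congr J h1 h2)
      (fun p q h1 h2 => by
        rw [hf _ _ h1, hg (mulConf p.1 p.2) (mulConf q.1 q.2) fun i hi => by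
          simp only [mulConf, h1 i hi, h2 i hi],
          fullWt_dblWt_congr J (fun i hi => h1 i (Finset.mem_compl.1 hi))
            (fun i hi => h2 i (Finset.mem_compl.1 hi))])
    simp_rw [isingWt_restrictTo_mul]
    rw [Fintype.sum_prod_type (f := fun p : (V → Bool) × (V → Bool) =>
      f p.1 * g (mulConf p.1 p.2) * fullWt (dblWt J p.1 p.2) Cᶜ)] at h1
    rw [h1, Fintype.sum_prod_type, clusterSum, Finset.compl_eq_univ_sdiff]
    congr 1
    refine Finset.sum_congr rfl fun σ _ => Finset.sum_congr rfl fun τ _ => ?_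
    ring
  have h1 := key f g hf hg
  have h2 := key (fun _ => 1) (fun _ => 1) (fun _ _ _ => rfl) (fun _ _ _ => rfl)
  simp only [mul_one] at h2
  rw [isingSum_one, ← clusterMass] at h2
  rw [isingSum_eq, isingSum_eq] at h1
  have hcard : (Fintype.card ((V → Bool) × (V → Bool)) : ℝ) ≠ 0 := by
    exact_mod_cast Fintype.card_ne_zero
  refine mul_left_cancel₀ hcard ?_
  rw [← h1]
  linear_combination isingEx (restrictTo J Cᶜ) f * isingEx (restrictTo J Cᶜ) g * h2

lemma spinPair_congr {C : Finset V} {a b : V} (ha : a ∉ C) (hb : b ∉ C) (σ σ' : V → Bool)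
    (h : ∀ i ∉ C, σ i = σ' i) : spinPair a b σ = spinPair a b σ' := by
  simp only [spinPair, h a ha, h b hb]

lemma clusterSum_spinPair_of_notMem (J : V → V → ℝ) {C : Finset V} {a b : V} (ha : a ∉ C)
    (hb : b ∉ C) : clusterSum J Finset.univ C (fun σ _ => spinPair a b σ) =
      corr (restrictTo J Cᶜ) a b * clusterMass J C := by
  have := clusterSum_eq_mul_clusterMass J C (spinPair a b) (fun _ => 1)
    (spinPair_congr ha hb) (fun _ _ _ => rfl)
  simp only [mul_one, isingEx_const] at this
  exact this

lemma clusterSum_spinPair_eq_zero (J : V → V → ℝ) {C : Finset V} {a b : V}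
    (h : ¬(a ∈ C ↔ b ∈ C)) : clusterSum J Finset.univ C (fun σ _ => spinPair a b σ) = 0 :=
  clusterSum_eq_zero_left J _ C fun σ _ => spinPair_flipOn_neg C σ h

lemma isingWt_mul_mulConf (J : V → V → ℝ) (σ τ : V → Bool) :
    isingWt J σ * isingWt J (mulConf σ τ) = fullWt (dblWt J σ τ) Finset.univ := by
  have := isingWt_restrictTo_mul J Finset.univ σ τ
  rwa [restrictTo_univ] at this

lemma isingEx_mul_isingEx_eq_sum (J : V → V → ℝ) (v : V) (f g : (V → Bool) → ℝ) :
    isingEx J f * isingEx J g * (isingZ J * isingZ J) =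
      ∑ C : Finset V with v ∈ C, clusterSum J Finset.univ C fun σ τ => f σ * g (mulConf σ τ) := by
  have h1 := isingSum_mul_isingSum J J f g
  rw [isingSum_eq, isingSum_eq] at h1
  have h2 := sum_fullWt_eq_sum_clusterSum J (Finset.mem_univ v) fun σ τ => f σ * g (mulConf σ τ)
  rw [Finset.powerset_univ] at h2
  rw [← h2]
  simp_rw [← isingWt_mul_mulConf]
  linarith

lemma isingEx_mul_corr_eq_sum (J : V → V → ℝ) (a b : V) (f : (V → Bool) → ℝ) :
    isingEx J (fun σ => f σ * spinPair a b σ) * corr J a b * (isingZ J * isingZ J) =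
      ∑ C : Finset V with a ∈ C ∧ b ∈ C, clusterSum J Finset.univ C fun σ _ => f σ := by
  have h1 := isingSum_mul_isingSum J J (fun σ => f σ * spinPair a b σ) (spinPair a b)
  rw [isingSum_eq, isingSum_eq] at h1
  have h2 := sum_spinPair_fullWt J (b := b) (Finset.mem_univ a) (f := fun σ _ => f σ)
    fun _ _ _ => rfl
  rw [Finset.powerset_univ] at h2
  rw [← h2, corr]
  simp_rw [← isingWt_mul_mulConf]
  rw [show ∀ a b c : ℝ, a * b * (c * c) = a * c * (b * c) by intros; ring, h1]
  refine Finset.sum_congr rfl fun σ _ => Finset.sum_congr rfl fun τ _ => ?_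
  rw [spinPair_mulConf]
  linear_combination f σ * spinPair a b τ * (isingWt J σ * isingWt J (mulConf σ τ)) *
    spinPair_mul_self a b σ

/-- Lower bound for a truncated four-point function in terms of clusters of the ghost vertex. -/
lemma sum_corr_mul_clusterMass_le {J : V → V → ℝ} (h : ∀ i j, 0 ≤ J i j) (o g x y : V) :
    ∑ C : Finset V with (g ∈ C ∧ y ∈ C) ∧ o ∉ C ∧ x ∉ C,
        corr (restrictTo J Cᶜ) o x * clusterMass J C ≤
      (isingEx J (fun σ => spinPair o g σ * spinPair x y σ) - corr J o g * corr J x y) *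
        (isingZ J * isingZ J) := by
  have hres : ∀ (C : Finset V) (i j : V), 0 ≤ restrictTo J C i j := by
    intro C i j
    unfold restrictTo
    split_ifs
    exacts [h i j, le_rfl]
  have hresle : ∀ (C : Finset V) (i j : V), |restrictTo J C i j| ≤ J i j := by
    intro C i j
    rw [abs_of_nonneg (hres C i j)]
    unfold restrictTo
    split_ifs
    exacts [le_rfl, h i j]
  set T := isingZ J * isingZ J with hTdef
  have hT : 0 < T := mul_pos (isingZ_pos J) (isingZ_pos J)
  set s : Finset V → ℝ := fun C => clusterSum J Finset.univ C fun σ _ => spinPair o x σ with hs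
  set B := ∑ C : Finset V with (g ∈ C ∧ y ∈ C) ∧ o ∈ C, s C with hBdef
  set L := ∑ C : Finset V with (g ∈ C ∧ y ∈ C) ∧ o ∉ C ∧ x ∉ C,
        corr (restrictTo J Cᶜ) o x * clusterMass J C with hL
  set X := isingEx J (fun σ => spinPair o g σ * spinPair x y σ) with hX
  have e1 : X * corr J g y * T = B + L := by
    have h1 := isingEx_mul_corr_eq_sum J g y (spinPair o x)
    rw [show (fun σ => spinPair o x σ * spinPair g y σ) =
      fun σ => spinPair o g σ * spinPair x y σ from funext fun σ => by
        simp only [spinPair]; ring] at h1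
    rw [h1, hBdef, hL, sum_filter_and _ (fun C => g ∈ C ∧ y ∈ C) (fun C => o ∈ C),
      sum_filter_and _ (fun C => g ∈ C ∧ y ∈ C) (fun C => o ∉ C ∧ x ∉ C),
      ← Finset.sum_add_distrib]
    refine Finset.sum_congr rfl fun C _ => ?_
    by_cases ho : o ∈ C
    · simp [ho, hs]
    · by_cases hx : x ∈ C
      · simp only [ho, hx, if_false, not_true, and_false, add_zero]
        exact clusterSum_spinPair_eq_zero J (by simp [ho, hx])
      · simp only [ho, hx, if_false, not_false_eq_true, and_self, if_true, zero_add]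
        exact clusterSum_spinPair_of_notMem J ho hx
  set R2 := ∑ C : Finset V with y ∈ C ∧ (g ∉ C ∧ o ∉ C ∧ x ∉ C),
    corr (restrictTo J Cᶜ) x g * corr (restrictTo J Cᶜ) o g * clusterMass J C with hR2
  have e2 : corr J x g * corr J o g * T = B + R2 := by
    have h1 := isingEx_mul_isingEx_eq_sum J y (spinPair x g) (spinPair o g)
    rw [← corr, ← corr] at h1
    have hB' : B = ∑ C : Finset V with y ∈ C ∧ (g ∈ C ∧ o ∈ C), s C := by
      rw [hBdef]
      refine Finset.sum_congr ?_ fun _ _ => rfl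
      ext C
      simp only [Finset.mem_filter]
      tauto
    rw [h1, hB', hR2, sum_filter_and _ (fun C => y ∈ C) (fun C => g ∈ C ∧ o ∈ C),
      sum_filter_and _ (fun C => y ∈ C) (fun C => g ∉ C ∧ o ∉ C ∧ x ∉ C), ← Finset.sum_add_distrib]
    refine Finset.sum_congr rfl fun C _ => ?_
    by_cases hog : o ∈ C ↔ g ∈ C
    · by_cases ho : o ∈ C
      · have hg := hog.1 ho
        simp only [ho, hg, and_self, if_true, not_true, false_and, if_false, add_zero]
        refine Eq.trans ?_
          (clusterSum_spinPair J Finset.univ C ho hg fun σ _ => spinPair o x σ)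
        congr 1
        funext σ τ
        have h2 : spinPair x g σ * spinPair o g σ = spinPair o x σ := by
          simp only [spinPair]
          linear_combination spin (σ x) * spin (σ o) * spin_mul_self (σ g)
        rw [spinPair_mulConf, ← mul_assoc, h2]
      · have hg : g ∉ C := fun h => ho (hog.2 h)
        by_cases hx : x ∈ C
        · simp only [ho, hg, hx, and_self, if_false, not_true, and_false, add_zero]
          refine clusterSum_eq_zero_left J _ C fun σ τ => ?_
          rw [spinPair_mulConf, spinPair_mulConf, spinPair_flipOn C σ hog,
            spinPair_flipOn_neg C σ (by simp [hx, hg])]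
          ring
        · simp only [ho, hg, hx, and_self, if_false, not_false_eq_true, if_true, zero_add]
          exact clusterSum_eq_mul_clusterMass J C _ _ (spinPair_congr hx hg)
            (spinPair_congr ho hg)
    · rw [if_neg (by tauto), if_neg (by tauto), add_zero]
      refine clusterSum_eq_zero_right J _ C fun σ τ => ?_
      rw [spinPair_mulConf, spinPair_mulConf, spinPair_flipOn_neg C τ hog]
      ring
  set R3 := ∑ C : Finset V with y ∈ C ∧ (g ∉ C ∧ x ∉ C),
    corr (restrictTo J Cᶜ) x g * clusterMass J C with hR3
  have e3 : corr J x g * T = corr J x y * corr J g y * T + R3 := by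
    have h1 := isingEx_mul_isingEx_eq_sum J y (spinPair x g) (fun _ => 1)
    have h2 := isingEx_mul_corr_eq_sum J y g (spinPair x g)
    rw [isingEx_const, ← corr, mul_one] at h1
    rw [show (fun σ => spinPair x g σ * spinPair y g σ) = spinPair x y from
      funext fun σ => by
        have := spin_mul_self (σ g)
        simp only [spinPair]
        linear_combination spin (σ x) * spin (σ y) * this, ← corr, corr_comm J y g] at h2
    rw [h1, h2, hR3, sum_filter_and _ (fun C => y ∈ C) (fun C => g ∈ C),
      sum_filter_and _ (fun C => y ∈ C) (fun C => g ∉ C ∧ x ∉ C), ← Finset.sum_add_distrib]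
    refine Finset.sum_congr rfl fun C _ => ?_
    simp only [mul_one]
    by_cases hg : g ∈ C
    · simp [hg]
    · by_cases hx : x ∈ C
      · simp only [hg, hx, if_false, not_true, and_false, add_zero]
        exact clusterSum_spinPair_eq_zero J (by simp [hg, hx])
      · simp only [hg, hx, if_false, not_false_eq_true, and_self, if_true, zero_add]
        exact clusterSum_spinPair_of_notMem J hx hg
  have hog0 : 0 ≤ corr J o g := corr_nonneg h o g
  have hR : R2 ≤ corr J o g * R3 := by
    rw [hR2, hR3, Finset.mul_sum]
    refine (Finset.sum_le_sum (g := fun C => corr J o g *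
      (corr (restrictTo J Cᶜ) x g * clusterMass J C)) fun C _ => ?_).trans
      (Finset.sum_le_sum_of_subset_of_nonneg (fun C => ?_) fun C _ _ => ?_)
    · have h1 := corr_le_corr (hresle Cᶜ) o g
      have h2 := mul_nonneg (corr_nonneg (hres Cᶜ) x g) (clusterMass_nonneg h C)
      have := mul_le_mul_of_nonneg_right h1 h2
      linarith
    · simp only [Finset.mem_filter]
      tauto
    · exact mul_nonneg hog0 (mul_nonneg (corr_nonneg (hres Cᶜ) x g) (clusterMass_nonneg h C))
  have hD : 0 ≤ X - corr J o g * corr J x y := sub_nonneg.2 (corr_mul_corr_le h o g x y)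
  have hLe : L ≤ corr J g y * ((X - corr J o g * corr J x y) * T) := by
    have : corr J o g * (corr J x g * T) = corr J o g * (corr J x y * corr J g y * T + R3) := by
      rw [e3]
    nlinarith
  refine hLe.trans ?_
  have := mul_le_mul_of_nonneg_right (corr_le_one J g y) (mul_nonneg hD hT.le)
  rwa [one_mul] at this

/-- The differential inequality of Duminil-Copin and Tassion, with an explicit lower bound `θ`
for the boundary sums. -/
theorem mul_one_sub_sq_le_sum {J : V → V → ℝ} (h : ∀ i j, 0 ≤ J i j) (o g : V) (θ : ℝ)
    (hθ : ∀ S : Finset V, o ∈ S → g ∉ S →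
      θ ≤ ∑ x ∈ S, ∑ y ∈ Sᶜ, J x y * corr (restrictTo J S) o x) :
    θ * (1 - corr J o g ^ 2) ≤ ∑ x, ∑ y, J x y *
      (isingEx J (fun σ => spinPair o g σ * spinPair x y σ) - corr J o g * corr J x y) := by
  set T := isingZ J * isingZ J with hTdef
  have hT : 0 < T := mul_pos (isingZ_pos J) (isingZ_pos J)
  refine le_of_mul_le_mul_right ?_ hT
  have e4 : (1 - corr J o g ^ 2) * T = ∑ C : Finset V with g ∈ C ∧ o ∉ C, clusterMass J C := by
    have h1 := isingEx_mul_isingEx_eq_sum J g (fun _ => 1) (fun _ => 1)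
    have h2 := isingEx_mul_corr_eq_sum J g o (fun _ => 1)
    rw [isingEx_const, one_mul, one_mul] at h1
    simp only [one_mul] at h1 h2
    rw [← Finset.filter_filter, Finset.sum_filter] at h2
    rw [← Finset.filter_filter, Finset.sum_filter]
    have h3 : isingEx J (fun σ => spinPair g o σ) = corr J o g := by rw [corr_comm]; rfl
    rw [h3, corr_comm J g o] at h2
    rw [sub_mul, one_mul, pow_two, hTdef, h2, h1, ← Finset.sum_sub_distrib]
    refine Finset.sum_congr rfl fun C _ => ?_
    by_cases ho : o ∈ C <;> simp [ho, clusterMass]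
  rw [mul_assoc, e4, Finset.mul_sum]
  calc ∑ C : Finset V with g ∈ C ∧ o ∉ C, θ * clusterMass J C
      ≤ ∑ C : Finset V with g ∈ C ∧ o ∉ C, ∑ x ∈ Cᶜ, ∑ y ∈ C,
          J x y * (corr (restrictTo J Cᶜ) o x * clusterMass J C) := by
        refine Finset.sum_le_sum fun C hC => ?_
        obtain ⟨hg, ho⟩ := (Finset.mem_filter.1 hC).2
        have := mul_le_mul_of_nonneg_right (hθ Cᶜ (by simpa using ho) (by simpa using hg))
          (clusterMass_nonneg h C)
        rw [compl_compl, Finset.sum_mul] at this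
        simp_rw [Finset.sum_mul, mul_assoc] at this
        exact this
    _ = ∑ x, ∑ y, J x y * ∑ C : Finset V with (g ∈ C ∧ y ∈ C) ∧ o ∉ C ∧ x ∉ C,
          corr (restrictTo J Cᶜ) o x * clusterMass J C := by
        simp_rw [Finset.mul_sum, Finset.sum_sigma']
        refine Finset.sum_nbij' (fun p => ⟨p.2.1, p.2.2, p.1⟩) (fun p => ⟨p.2.2, p.1, p.2.1⟩)
          ?_ ?_ ?_ ?_ ?_
        all_goals simp
        all_goals tauto
    _ ≤ _ := by
        rw [Finset.sum_mul]
        refine Finset.sum_le_sum fun x _ => ?_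
        rw [Finset.sum_mul]
        refine Finset.sum_le_sum fun y _ => ?_
        rw [mul_assoc]
        exact mul_le_mul_of_nonneg_left (sum_corr_mul_clusterMass_le h o g x y) (h x y)

end Sharpness

section Magnetization

set_option linter.unusedSectionVars false

variable {V : Type*} [Fintype V] [DecidableEq V]

lemma pairEnergy_const_mul (J : V → V → ℝ) (b : ℝ) (σ : V → Bool) :
    pairEnergy (fun i j => b * J i j) σ = b * pairEnergy J σ := by
  simp only [pairEnergy, Finset.mul_sum, mul_assoc]

lemma hasDerivAt_isingSum (J : V → V → ℝ) (f : (V → Bool) → ℝ) (b : ℝ) :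
    HasDerivAt (fun b => isingSum (fun i j => b * J i j) f)
      (isingSum (fun i j => b * J i j) fun σ => f σ * pairEnergy J σ) b := by
  simp only [isingSum, isingWt, pairEnergy_const_mul]
  refine HasDerivAt.fun_sum fun σ _ => ?_
  have h1 : HasDerivAt (fun b : ℝ => exp (b * pairEnergy J σ))
      (exp (b * pairEnergy J σ) * (1 * pairEnergy J σ)) b :=
    ((hasDerivAt_id b).mul_const (pairEnergy J σ)).exp
  refine (h1.const_mul (f σ)).congr_deriv ?_
  ring

lemma isingSum_mul_pairEnergy (J K : V → V → ℝ) (f : (V → Bool) → ℝ) :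
    isingSum K (fun σ => f σ * pairEnergy J σ) =
      ∑ x, ∑ y, J x y * isingSum K (fun σ => f σ * spinPair x y σ) := by
  simp only [isingSum, pairEnergy, Finset.mul_sum, Finset.sum_mul]
  rw [Finset.sum_comm, Fintype.sum_prod_type]
  refine Finset.sum_congr rfl fun x _ => Finset.sum_congr rfl fun y _ =>
    Finset.sum_congr rfl fun σ _ => ?_
  simp only [spinPair]
  ring

lemma hasDerivAt_corr (J : V → V → ℝ) (o g : V) (b : ℝ) :
    HasDerivAt (fun b => corr (fun i j => b * J i j) o g)
      (∑ x, ∑ y, J x y * (isingEx (fun i j => b * J i j) (fun σ => spinPair o g σ * spinPair x y σ)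
        - corr (fun i j => b * J i j) o g * corr (fun i j => b * J i j) x y)) b := by
  have h1 := hasDerivAt_isingSum J (spinPair o g) b
  have h2 := hasDerivAt_isingSum J (fun _ => 1) b
  have hZ : ∀ b : ℝ, isingSum (fun i j => b * J i j) (fun _ : V → Bool => (1 : ℝ)) ≠ 0 := fun b => by
    rw [isingSum_one]; exact (isingZ_pos _).ne'
  refine ((h1.div h2 (hZ b)).congr_of_eventuallyEq (Filter.Eventually.of_forall fun b => ?_)).congr_deriv ?_
  · simp only [corr, isingEx, Pi.div_apply, isingSum_one]
  · rw [isingSum_mul_pairEnergy, isingSum_mul_pairEnergy, isingSum_one]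
    set K : V → V → ℝ := fun i j => b * J i j
    simp only [one_mul]
    have hZ' := (isingZ_pos K).ne'
    simp only [corr, isingEx, mul_sub, Finset.sum_sub_distrib]
    rw [sub_div, Finset.sum_mul, Finset.mul_sum, Finset.sum_div, Finset.sum_div]
    congr 1
    · refine Finset.sum_congr rfl fun x _ => ?_
      rw [Finset.sum_mul, Finset.sum_div]
      refine Finset.sum_congr rfl fun y _ => ?_
      field_simp
    · refine Finset.sum_congr rfl fun x _ => ?_
      rw [Finset.mul_sum, Finset.sum_div]
      refine Finset.sum_congr rfl fun y _ => ?_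
      change isingSum K (spinPair o g) * (J x y * isingSum K (spinPair x y)) / isingZ K ^ 2 = _
      field_simp

/-- If all boundary sums at `b₀` are at least `θ`, the magnetization at `b₁ > b₀` is bounded
below. -/
theorem div_le_corr_of_le_sum {J : V → V → ℝ} (h : ∀ i j, 0 ≤ J i j) (o g : V) {θ b₀ b₁ : ℝ}
    (hθ0 : 0 ≤ θ) (hb0 : 0 ≤ b₀) (hb : b₀ < b₁)
    (hθ : ∀ S : Finset V, o ∈ S → g ∉ S →
      θ ≤ ∑ x ∈ S, ∑ y ∈ Sᶜ, J x y * corr (restrictTo (fun i j => b₀ * J i j) S) o x) :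
    θ * (b₁ - b₀) / (1 + θ * (b₁ - b₀)) ≤ corr (fun i j => b₁ * J i j) o g := by
  set M : ℝ → ℝ := fun b => corr (fun i j => b * J i j) o g with hM
  have hpos : ∀ b : ℝ, 0 ≤ b → ∀ i j, 0 ≤ b * J i j := fun b hb i j => mul_nonneg hb (h i j)
  have hmono : ∀ b b' : ℝ, 0 ≤ b → b ≤ b' → M b ≤ M b' := by
    intro b b' hb hbb'
    refine corr_le_corr (fun i j => ?_) o g
    rw [abs_of_nonneg (hpos b hb i j)]
    exact mul_le_mul_of_nonneg_right hbb' (h i j)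
  have hd : ∀ b, b₀ < b → θ * (1 - M b ^ 2) ≤ deriv M b := by
    intro b hbb
    have hb' : 0 < b := hb0.trans_lt hbb
    rw [(hasDerivAt_corr J o g b).deriv]
    have := mul_one_sub_sq_le_sum (hpos b hb'.le) o g (b * θ) (fun S ho hg => by
      refine (mul_le_mul_of_nonneg_left (hθ S ho hg) hb'.le).trans ?_
      rw [Finset.mul_sum]
      refine Finset.sum_le_sum fun x _ => ?_
      rw [Finset.mul_sum]
      refine Finset.sum_le_sum fun y _ => ?_
      rw [mul_assoc]
      refine mul_le_mul_of_nonneg_left (mul_le_mul_of_nonneg_left ?_ (h x y)) hb'.le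
      refine corr_le_corr (fun i j => ?_) o x
      unfold restrictTo
      split_ifs
      · rw [abs_of_nonneg (hpos b₀ hb0 i j)]
        exact mul_le_mul_of_nonneg_right hbb.le (h i j)
      · simp)
    simp_rw [mul_assoc, ← Finset.mul_sum] at this
    exact le_of_mul_le_mul_left this hb'
  have hM1 : M b₁ ≤ 1 := corr_le_one _ o g
  have hMb0 : 0 ≤ M b₀ := corr_nonneg (hpos b₀ hb0) o g
  have hmvt := (convex_Icc b₀ b₁).mul_sub_le_image_sub_of_le_deriv (f := M)
    (C := θ * (1 - M b₁ ^ 2))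
    (fun b _ => (hasDerivAt_corr J o g b).continuousAt.continuousWithinAt)
    (fun b _ => (hasDerivAt_corr J o g b).differentiableAt.differentiableWithinAt)
    (fun b hbi => by
      rw [interior_Icc] at hbi
      refine le_trans (mul_le_mul_of_nonneg_left ?_ hθ0) (hd b hbi.1)
      have h1 := hmono b b₁ (hb0.trans hbi.1.le) hbi.2.le
      have h2 : 0 ≤ M b := corr_nonneg (hpos b (hb0.trans hbi.1.le)) o g
      nlinarith)
    b₀ (Set.left_mem_Icc.2 hb.le) b₁ (Set.right_mem_Icc.2 hb.le) hb.le
  have hκ : 0 ≤ θ * (b₁ - b₀) := mul_nonneg hθ0 (sub_pos.2 hb).le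
  have hM10 : 0 ≤ M b₁ := hMb0.trans (hmono b₀ b₁ hb0 hb.le)
  rw [div_le_iff₀ (by positivity)]
  have : θ * (b₁ - b₀) * M b₁ ^ 2 ≤ θ * (b₁ - b₀) * M b₁ :=
    mul_le_mul_of_nonneg_left (by nlinarith) hκ
  change _ ≤ M b₁ * _
  nlinarith

end Magnetization

section GhostField

set_option linter.unusedSectionVars false

variable {V W : Type*} [Fintype V] [DecidableEq V] [Fintype W] [DecidableEq W]

lemma sum_comp_injective {e : W → V} (he : Function.Injective e) :
    ∃ n : ℝ, 0 < n ∧ ∀ F : (W → Bool) → ℝ, ∑ σ : V → Bool, F (σ ∘ e) = n * ∑ σ, F σ := by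
  classical
  let p : V → Prop := fun v => v ∈ Set.range e
  refine ⟨Fintype.card ({v // ¬p v} → Bool), by exact_mod_cast Fintype.card_pos, fun F => ?_⟩
  have h1 : ∀ σ : V → Bool, F (σ ∘ e) =
      (fun r : ({v // p v} → Bool) × ({v // ¬p v} → Bool) =>
        F (r.1 ∘ Equiv.ofInjective e he)) (Equiv.piEquivPiSubtypeProd p (fun _ => Bool) σ) := by
    intro σ
    rfl
  refine (Finset.sum_congr rfl fun σ _ => h1 σ).trans ?_
  rw [Equiv.sum_comp (Equiv.piEquivPiSubtypeProd p fun _ => Bool) (fun r => F (r.1 ∘ Equiv.ofInjective e he)), Fintype.sum_prod_type]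
  dsimp only
  simp_rw [Finset.sum_const, Finset.card_univ, nsmul_eq_mul]
  rw [← Finset.mul_sum]
  congr 1
  exact Equiv.sum_comp (Equiv.arrowCongr (Equiv.ofInjective e he).symm (Equiv.refl Bool)) F

lemma pairEnergy_comp {J : V → V → ℝ} {e : W → V} (he : Function.Injective e)
    (hJ : ∀ i j, J i j ≠ 0 → i ∈ Set.range e ∧ j ∈ Set.range e) (σ : V → Bool) :
    pairEnergy J σ = pairEnergy (fun a b => J (e a) (e b)) (σ ∘ e) := by
  unfold pairEnergy
  symm
  have hinj : Function.Injective (Prod.map e e) := he.prodMap he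
  refine (Fintype.sum_of_injective (Prod.map e e) hinj _ _ ?_ ?_)
  · rintro ⟨i, j⟩ hij
    by_contra hne
    obtain ⟨⟨a, rfl⟩, b, rfl⟩ := hJ i j fun h0 => hne (by simp [h0])
    exact hij ⟨(a, b), rfl⟩
  · rintro ⟨a, b⟩
    rfl

/-- Correlations only depend on the couplings of the coupled spins. -/
lemma corr_comp {J : V → V → ℝ} {e : W → V} (he : Function.Injective e)
    (hJ : ∀ i j, J i j ≠ 0 → i ∈ Set.range e ∧ j ∈ Set.range e) (a b : W) :
    corr J (e a) (e b) = corr (fun a b => J (e a) (e b)) a b := by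
  obtain ⟨n, hn, h⟩ := sum_comp_injective he
  have h1 := h fun σ => spinPair a b σ * isingWt (fun a b => J (e a) (e b)) σ
  have h2 := h fun σ => isingWt (fun a b => J (e a) (e b)) σ
  have hwt : ∀ σ, isingWt J σ = isingWt (fun a b => J (e a) (e b)) (σ ∘ e) := fun σ => by
    rw [isingWt, isingWt, pairEnergy_comp he hJ]
  unfold corr isingEx isingSum isingZ
  simp_rw [hwt]
  rw [h2]
  have h3 : ∀ σ : V → Bool, spinPair (e a) (e b) σ = spinPair a b (σ ∘ e) := fun _ => rfl
  simp_rw [h3]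
  rw [h1, mul_div_mul_left _ _ hn.ne']

/-- Couplings on `V` together with a ghost vertex that carries the external field `h`. -/
def withField (J : V → V → ℝ) (h : V → ℝ) : Option V → Option V → ℝ
  | some i, some j => J i j
  | some i, none => h i / 2
  | none, some j => h j / 2
  | none, none => 0

/-- The Boltzmann weight in an external field. -/
def fieldWt (J : V → V → ℝ) (h : V → ℝ) (σ : V → Bool) : ℝ :=
  exp (pairEnergy J σ + ∑ i, h i * spin (σ i))

lemma fieldWt_pos (J : V → V → ℝ) (h : V → ℝ) (σ : V → Bool) : 0 < fieldWt J h σ := exp_pos _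

lemma withField_const_mul (J : V → V → ℝ) (h : V → ℝ) (b : ℝ) :
    withField (fun i j => b * J i j) (fun i => b * h i) = fun i j => b * withField J h i j := by
  funext i j
  cases i <;> cases j <;> simp [withField, mul_div_assoc]

lemma withField_nonneg {J : V → V → ℝ} {h : V → ℝ} (hJ : ∀ i j, 0 ≤ J i j) (hh : ∀ i, 0 ≤ h i)
    (i j : Option V) : 0 ≤ withField J h i j := by
  rcases i with _ | i <;> rcases j with _ | j
  exacts [le_rfl, div_nonneg (hh j) zero_le_two, div_nonneg (hh i) zero_le_two, hJ i j]

lemma pairEnergy_withField (J : V → V → ℝ) (h : V → ℝ) (σ : Option V → Bool) :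
    pairEnergy (withField J h) σ =
      pairEnergy J (fun i => σ (some i)) + ∑ i, h i * (spin (σ (some i)) * spin (σ none)) := by
  simp only [pairEnergy, Fintype.sum_prod_type, Fintype.sum_option, withField, zero_mul, zero_add]
  rw [← Finset.sum_add_distrib, ← Finset.sum_add_distrib]
  exact Finset.sum_congr rfl fun i _ => by ring

/-- The extension of a spin configuration by a plus spin at the ghost vertex. -/
def withPlus (σ : V → Bool) : Option V → Bool := fun i => i.elim true σ

lemma isingWt_withField_withPlus (J : V → V → ℝ) (h : V → ℝ) (σ : V → Bool) :
    isingWt (withField J h) (withPlus σ) = fieldWt J h σ := by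
  have h1 : spin (withPlus σ none) = 1 := if_pos rfl
  simp only [isingWt, pairEnergy_withField, fieldWt, h1, mul_one]
  rfl

lemma isingWt_flipOn_univ (J : V → V → ℝ) (σ : V → Bool) :
    isingWt J (flipOn Finset.univ σ) = isingWt J σ := by
  unfold isingWt pairEnergy
  congr 1
  refine Finset.sum_congr rfl fun p _ => ?_
  have := spinPair_flipOn Finset.univ σ (i := p.1) (j := p.2) (by simp)
  unfold spinPair at this
  rw [this]

lemma isingSum_withField (J : V → V → ℝ) (h : V → ℝ) (F : (Option V → Bool) → ℝ)
    (hF : ∀ σ, F (flipOn Finset.univ σ) = F σ) :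
    isingSum (withField J h) F = 2 * ∑ σ : V → Bool, F (withPlus σ) * fieldWt J h σ := by
  have key : ∀ G : (Option V → Bool) → ℝ, (∀ σ, G (flipOn Finset.univ σ) = G σ) →
      ∑ σ, G σ = 2 * ∑ σ : V → Bool, G (withPlus σ) := by
    intro G hG
    rw [← Equiv.sum_comp (Equiv.piOptionEquivProd (β := fun _ : Option V => Bool)).symm,
      Fintype.sum_prod_type, Fintype.sum_bool, two_mul]
    congr 1
    · refine Finset.sum_congr rfl fun σ _ => congrArg G ?_
      funext i
      cases i <;> rfl
    · rw [← sum_comp_flipOn Finset.univ]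
      refine Finset.sum_congr rfl fun σ _ => ?_
      rw [← hG]
      congr 1
      funext i
      cases i <;> simp [flipOn, withPlus, Equiv.piOptionEquivProd]
  rw [isingSum, key]
  · simp_rw [isingWt_withField_withPlus]
  · intro σ
    rw [hF, isingWt_flipOn_univ]

lemma isingZ_withField (J : V → V → ℝ) (h : V → ℝ) :
    isingZ (withField J h) = 2 * ∑ σ, fieldWt J h σ := by
  rw [← isingSum_one, isingSum_withField J h _ fun _ => rfl]
  simp

lemma corr_withField_mul (J : V → V → ℝ) (h : V → ℝ) (i j : Option V) :
    corr (withField J h) i j * ∑ σ, fieldWt J h σ =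
      ∑ σ, spinPair i j (withPlus σ) * fieldWt J h σ := by
  have h1 := isingSum_eq (withField J h) (spinPair i j)
  rw [isingSum_withField J h _ fun σ => spinPair_flipOn Finset.univ σ (by simp),
    isingZ_withField] at h1
  unfold corr
  linarith

end GhostField

/-- Ferromagnetic, translation-invariant, summable pair couplings on `ℤ`. -/
structure IsCoupling (K : ℤ → ℤ → ℝ) : Prop where
  nonneg : ∀ i j, 0 ≤ K i j
  symm : ∀ i j, K i j = K j i
  diag : ∀ i, K i i = 0
  shift : ∀ i j k, K (i + k) (j + k) = K i j
  summable : ∀ i, Summable (K i)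

/-- The total coupling of `i` to the complement of `Λ`. -/
def extField (K : ℤ → ℤ → ℝ) (Λ : Finset ℤ) (i : ℤ) : ℝ := ∑' j, if j ∈ Λ then 0 else K i j

/-- The couplings in the box `Λ`, with the sites outside `Λ` contracted to a ghost vertex. -/
def ghostK (K : ℤ → ℤ → ℝ) (Λ : Finset ℤ) : Option Λ → Option Λ → ℝ :=
  withField (fun i j => K i j / 2) fun i => extField K Λ i

/-- The two-point function in the finite set `S` with free boundary conditions. -/
def freeCorr (K : ℤ → ℤ → ℝ) (β : ℝ) (S : Finset ℤ) (x y : S) : ℝ :=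
  corr (fun i j : S => β * (K i j / 2)) x y

/-- The inclusion of a translate of `S` in `Λ`, viewed in `Option Λ`. -/
def shiftEmb (S Λ : Finset ℤ) (i : ℤ) (h : ∀ x ∈ S, x + i ∈ Λ) : S ↪ Option Λ where
  toFun x := some ⟨x + i, h x x.2⟩
  inj' x y hxy := by
    have h1 := congrArg Subtype.val (Option.some_injective _ hxy)
    exact Subtype.ext (add_right_cancel h1)

lemma shiftEmb_apply {S Λ : Finset ℤ} {i : ℤ} (h : ∀ x ∈ S, x + i ∈ Λ) (x : S) :
    shiftEmb S Λ i h x = some ⟨x + i, h x x.2⟩ := rfl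

section Coupling

variable {K : ℤ → ℤ → ℝ}

lemma IsCoupling.summable_ite (hK : IsCoupling K) (p : ℤ → Prop) [DecidablePred p] (i : ℤ) :
    Summable fun j => if p j then 0 else K i j :=
  Summable.of_nonneg_of_le (fun j => by split_ifs; exacts [le_rfl, hK.nonneg i j])
    (fun j => by split_ifs; exacts [hK.nonneg i j, le_rfl]) (hK.summable i)

lemma IsCoupling.extField_nonneg (hK : IsCoupling K) (Λ : Finset ℤ) (i : ℤ) :
    0 ≤ extField K Λ i :=
  tsum_nonneg fun j => by split_ifs; exacts [le_rfl, hK.nonneg i j]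

lemma IsCoupling.ghostK_nonneg (hK : IsCoupling K) (Λ : Finset ℤ) (i j : Option Λ) :
    0 ≤ ghostK K Λ i j :=
  withField_nonneg (V := Λ) (fun i j => div_nonneg (hK.nonneg i j) zero_le_two)
    (fun i => hK.extField_nonneg Λ i) i j

lemma IsCoupling.ghostK_symm (hK : IsCoupling K) (Λ : Finset ℤ) (i j : Option Λ) :
    ghostK K Λ i j = ghostK K Λ j i := by
  rcases i with _ | i <;> rcases j with _ | j <;> simp [ghostK, withField]
  rw [hK.symm]

lemma IsCoupling.freeCorr_nonneg (hK : IsCoupling K) {β : ℝ} (h0 : 0 ≤ β) (S : Finset ℤ)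
    (x y : S) : 0 ≤ freeCorr K β S x y :=
  corr_nonneg (V := S) (fun i j => mul_nonneg h0 (div_nonneg (hK.nonneg i j) zero_le_two)) x y

variable {S Λ : Finset ℤ} {i : ℤ} (h : ∀ x ∈ S, x + i ∈ Λ)

lemma some_mem_map_shiftEmb (j : Λ) :
    some j ∈ Finset.univ.map (shiftEmb S Λ i h) ↔ (j : ℤ) - i ∈ S := by
  simp only [Finset.mem_map, Finset.mem_univ, true_and, shiftEmb_apply, Option.some_inj,
    Subtype.ext_iff, Subtype.exists]
  constructor
  · rintro ⟨x, hx, hxj⟩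
    rwa [← hxj, add_sub_cancel_right]
  · exact fun hj => ⟨_, hj, sub_add_cancel _ _⟩

lemma none_notMem_map_shiftEmb : none ∉ Finset.univ.map (shiftEmb S Λ i h) := by
  simp [shiftEmb_apply]

lemma IsCoupling.corr_restrictTo_ghostK (hK : IsCoupling K) (β : ℝ) (a b : S) :
    corr (restrictTo (fun x y => β * ghostK K Λ x y) (Finset.univ.map (shiftEmb S Λ i h)))
      (shiftEmb S Λ i h a) (shiftEmb S Λ i h b) = freeCorr K β S a b := by
  rw [corr_comp (shiftEmb S Λ i h).injective, freeCorr]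
  · congr 1
    funext x y
    rw [restrictTo, if_pos ⟨Finset.mem_map_of_mem _ (Finset.mem_univ _),
      Finset.mem_map_of_mem _ (Finset.mem_univ _)⟩]
    simp [ghostK, withField, shiftEmb_apply, hK.shift]
  · intro x y hxy
    unfold restrictTo at hxy
    have := (ite_ne_right_iff.1 hxy).1
    simpa using this

lemma IsCoupling.sum_ghostK_mul (hK : IsCoupling K) (g : Option Λ → ℝ) (G : ℤ → ℝ)
    (hG : ∀ j : Λ, G j = g (some j)) (hG' : ∀ j ∉ Λ, G j = g none) (a : S) :
    ∑ y ∈ (Finset.univ.map (shiftEmb S Λ i h))ᶜ, ghostK K Λ (shiftEmb S Λ i h a) y * g y =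
      (∑' j, if j - i ∈ S then 0 else K (a + i) j * G j) / 2 := by
  have h1 : ∀ j, (if j - i ∈ S then 0 else K (a + i) j * G j) =
      (if j ∈ Λ then if j - i ∈ S then 0 else K (a + i) j * G j else 0) +
        g none * (if j ∈ Λ then 0 else K (a + i) j) := by
    intro j
    by_cases hj : j ∈ Λ
    · simp [hj]
    · have : j - i ∉ S := fun hS => hj (by simpa using h _ hS)
      rw [if_neg this, if_neg hj, if_neg hj, zero_add, hG' j hj, mul_comm]
  rw [tsum_congr h1, Summable.tsum_add (summable_of_ne_finset_zero (s := Λ) fun j hj => by simp [hj])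
    ((hK.summable_ite _ _).mul_left _), tsum_mul_left, tsum_eq_sum (s := Λ) fun j hj => by simp [hj],
    Finset.sum_congr rfl fun j hj => if_pos hj, ← Finset.sum_coe_sort Λ, add_div, Finset.sum_div]
  have h2 : ∀ F : Option Λ → ℝ, ∑ y ∈ (Finset.univ.map (shiftEmb S Λ i h))ᶜ, F y =
      ∑ y, if y ∈ Finset.univ.map (shiftEmb S Λ i h) then 0 else F y := by
    intro F
    rw [Finset.sum_ite, Finset.sum_const_zero, zero_add]
    congr 1
    ext y
    simp
  rw [h2, Fintype.sum_option, if_neg (none_notMem_map_shiftEmb h), add_comm]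
  congr 1
  · refine Finset.sum_congr rfl fun j _ => ?_
    simp only [some_mem_map_shiftEmb, hG]
    split_ifs
    · simp
    · simp [ghostK, withField, shiftEmb_apply]
      ring
  · simp [ghostK, withField, shiftEmb_apply, extField]
    ring

end Coupling

/-- The boundary functional of the finite set `S`. -/
def boundarySum (K : ℤ → ℤ → ℝ) (β : ℝ) (S : Finset ℤ) (o : S) : ℝ :=
  ∑ x : S, freeCorr K β S o x * extField K S x

lemma IsCoupling.div_le_corr_ghostK {K : ℤ → ℤ → ℝ} (hK : IsCoupling K) {β β' θ : ℝ} (h0 : 0 ≤ β)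
    (hβ : β < β') (hθ0 : 0 ≤ θ)
    (hθ : ∀ (S : Finset ℤ) (h : 0 ∈ S), 2 * θ ≤ boundarySum K β S ⟨0, h⟩) {Λ : Finset ℤ}
    (hΛ : 0 ∈ Λ) :
    θ * (β' - β) / (1 + θ * (β' - β)) ≤
      corr (fun i j => β' * ghostK K Λ i j) (some ⟨0, hΛ⟩) none := by
  refine div_le_corr_of_le_sum (hK.ghostK_nonneg Λ) _ _ hθ0 h0 hβ fun S' ho hg => ?_
  let S : Finset ℤ := Λ.filter fun x => ∃ h : x ∈ Λ, some ⟨x, h⟩ ∈ S'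
  have hS : ∀ x ∈ S, x + 0 ∈ Λ := fun x hx => by
    rw [add_zero]
    exact (Finset.mem_filter.1 hx).1
  have hS' : S' = Finset.univ.map (shiftEmb S Λ 0 hS) := by
    ext y
    rcases y with _ | y
    · exact iff_of_false hg (none_notMem_map_shiftEmb hS)
    · rw [some_mem_map_shiftEmb]
      simp [S]
  have h0S : 0 ∈ S := Finset.mem_filter.2 ⟨hΛ, hΛ, ho⟩
  have ho' : (some ⟨0, hΛ⟩ : Option Λ) = shiftEmb S Λ 0 hS ⟨0, h0S⟩ := rfl
  have hsum : ∀ a : S, ∑ y ∈ (Finset.univ.map (shiftEmb S Λ 0 hS))ᶜ,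
      ghostK K Λ (shiftEmb S Λ 0 hS a) y = extField K S a / 2 := by
    intro a
    have := hK.sum_ghostK_mul hS (fun _ => 1) (fun _ => 1) (fun _ => rfl) (fun _ _ => rfl) a
    simpa [extField] using this
  rw [hS', ho', Finset.sum_map]
  simp_rw [← Finset.sum_mul, hK.corr_restrictTo_ghostK, hsum]
  have := hθ S h0S
  unfold boundarySum at this
  rw [← mul_le_mul_iff_right₀ (zero_lt_two (α := ℝ))]
  refine this.trans_eq ?_
  rw [Finset.mul_sum]
  exact Finset.sum_congr rfl fun x _ => by ring

/-- The interaction energy of the pair `p`, counted if it touches `Λ`. -/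
def pairTerm (K : ℤ → ℤ → ℝ) (Λ : Finset ℤ) (ω : Config) (p : ℤ × ℤ) : ℝ :=
  if p.1 < p.2 ∧ (p.1 ∈ Λ ∨ p.2 ∈ Λ) then K p.1 p.2 * spin (ω p.1) * spin (ω p.2) else 0

/-- The field that the spins of `ω` outside `Λ` exert on the site `i`. -/
def boundaryField (K : ℤ → ℤ → ℝ) (Λ : Finset ℤ) (ω : Config) (i : ℤ) : ℝ :=
  ∑' j, if j ∈ Λ then 0 else K i j * spin (ω j)

/-- The interaction energy of the ordered pair `p` if `p.1 ∈ Λ`; pairs inside `Λ` count half. -/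
def orderedTerm (K : ℤ → ℤ → ℝ) (Λ : Finset ℤ) (ω : Config) (p : ℤ × ℤ) : ℝ :=
  if p.1 ∈ Λ then (if p.2 ∈ Λ then 1 / 2 else 1) * (K p.1 p.2 * (spin (ω p.1) * spin (ω p.2)))
  else 0

lemma concat_apply_mem {Λ : Finset ℤ} (a : Λ → Bool) (ω : Config) (i : Λ) :
    concat Λ a ω i = a i := dif_pos i.2

lemma concat_apply_notMem {Λ : Finset ℤ} (a : Λ → Bool) (ω : Config) {i : ℤ} (hi : i ∉ Λ) :
    concat Λ a ω i = ω i := dif_neg hi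

lemma concat_concat (Λ : Finset ℤ) (a b : Λ → Bool) (ω : Config) :
    concat Λ a (concat Λ b ω) = concat Λ a ω := by
  funext i
  unfold concat
  split_ifs <;> rfl

section Energy

variable {K : ℤ → ℤ → ℝ} (hK : IsCoupling K) (Λ : Finset ℤ) (ω : Config)
include hK

lemma IsCoupling.abs_mul_spin (i j : ℤ) (a b : Bool) : |K i j * (spin a * spin b)| = K i j := by
  rw [abs_mul, abs_mul, abs_spin, abs_spin, one_mul, mul_one, abs_of_nonneg (hK.nonneg i j)]

lemma IsCoupling.abs_orderedTerm_le (p : ℤ × ℤ) :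
    |orderedTerm K Λ ω p| ≤ if p.1 ∈ Λ then K p.1 p.2 else 0 := by
  have h0 := hK.nonneg p.1 p.2
  unfold orderedTerm
  split_ifs
  · rw [abs_mul, hK.abs_mul_spin]
    norm_num
    linarith
  · rw [abs_mul, hK.abs_mul_spin]
    norm_num
  · simp

lemma IsCoupling.summable_orderedTerm : Summable (orderedTerm K Λ ω) := by
  refine Summable.of_norm_bounded ?_ fun p => hK.abs_orderedTerm_le Λ ω p
  rw [summable_prod_of_nonneg]
  · refine ⟨fun i => ?_, summable_of_ne_finset_zero (s := Λ) fun i hi => by simp [hi]⟩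
    by_cases hi : i ∈ Λ
    · simpa [hi] using hK.summable i
    · simp [hi]
  · intro p
    dsimp only
    split_ifs
    exacts [hK.nonneg _ _, le_rfl]

lemma IsCoupling.pairTerm_eq (p : ℤ × ℤ) : pairTerm K Λ ω p =
    (if p.1 < p.2 then orderedTerm K Λ ω p else 0) +
      (if p.1 < p.2 then orderedTerm K Λ ω p.swap else 0) := by
  obtain ⟨i, j⟩ := p
  have hs := hK.symm j i
  simp only [pairTerm, orderedTerm, Prod.fst_swap, Prod.snd_swap, hs]
  by_cases h1 : i < j <;> by_cases h2 : i ∈ Λ <;> by_cases h3 : j ∈ Λ <;>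
    simp [h1, h2, h3] <;> ring

lemma IsCoupling.summable_ite_orderedTerm (P : ℤ × ℤ → Prop) [DecidablePred P] :
    Summable fun p => if P p then orderedTerm K Λ ω p else 0 :=
  Summable.of_norm_bounded (hK.summable_orderedTerm Λ ω).norm fun p => by
    split_ifs
    exacts [le_rfl, by simp]

lemma IsCoupling.summable_swap_orderedTerm :
    Summable fun p : ℤ × ℤ => if p.1 < p.2 then orderedTerm K Λ ω p.swap else 0 :=
  (Equiv.prodComm ℤ ℤ).summable_iff.1
    ((hK.summable_ite_orderedTerm Λ ω fun p => p.2 < p.1).congr fun _ => rfl)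

lemma IsCoupling.summable_pairTerm : Summable (pairTerm K Λ ω) :=
  ((hK.summable_ite_orderedTerm Λ ω fun p => p.1 < p.2).add
    (hK.summable_swap_orderedTerm Λ ω)).congr fun p => (hK.pairTerm_eq Λ ω p).symm

lemma IsCoupling.tsum_pairTerm : ∑' p, pairTerm K Λ ω p = ∑' p, orderedTerm K Λ ω p := by
  have h1 : ∑' p : ℤ × ℤ, (if p.1 < p.2 then orderedTerm K Λ ω p.swap else 0) =
      ∑' p : ℤ × ℤ, if p.2 < p.1 then orderedTerm K Λ ω p else 0 :=
    ((Equiv.prodComm ℤ ℤ).tsum_eq _).symm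
  rw [tsum_congr (hK.pairTerm_eq Λ ω), Summable.tsum_add (hK.summable_ite_orderedTerm Λ ω _)
    (hK.summable_swap_orderedTerm Λ ω), h1,
    ← Summable.tsum_add (hK.summable_ite_orderedTerm Λ ω _) (hK.summable_ite_orderedTerm Λ ω _)]
  refine tsum_congr fun p => ?_
  rcases lt_trichotomy p.1 p.2 with h | h | h
  · simp [h, h.le]
  · simp [orderedTerm, h, hK.diag]
  · simp [h, h.le]

lemma IsCoupling.abs_boundaryField_term_le (i j : ℤ) :
    ‖if j ∈ Λ then 0 else K i j * spin (ω j)‖ ≤ K i j := by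
  have h0 := hK.nonneg i j
  split_ifs
  · simpa
  · rw [norm_mul, Real.norm_eq_abs, Real.norm_eq_abs, abs_spin, mul_one, abs_of_nonneg h0]

lemma IsCoupling.tsum_orderedTerm : ∑' p, orderedTerm K Λ ω p =
    ∑ i ∈ Λ, (∑ j ∈ Λ, K i j / 2 * (spin (ω i) * spin (ω j)) +
      boundaryField K Λ ω i * spin (ω i)) := by
  rw [(hK.summable_orderedTerm Λ ω).tsum_prod,
    tsum_eq_sum (s := Λ) fun i hi => by simp [orderedTerm, hi]]
  refine Finset.sum_congr rfl fun i hi => ?_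
  have h1 : ∀ j, orderedTerm K Λ ω (i, j) =
      (if j ∈ Λ then K i j / 2 * (spin (ω i) * spin (ω j)) else 0) +
        (if j ∈ Λ then 0 else K i j * spin (ω j)) * spin (ω i) := by
    intro j
    simp only [orderedTerm, hi, if_true]
    split_ifs <;> ring
  rw [tsum_congr h1, Summable.tsum_add
    (summable_of_ne_finset_zero (s := Λ) fun j hj => by simp [hj])
    ((Summable.of_norm_bounded (hK.summable i)
      fun j => hK.abs_boundaryField_term_le Λ ω i j).mul_right _), tsum_mul_right,
    tsum_eq_sum (s := Λ) fun j hj => by simp [hj], Finset.sum_congr rfl fun j hj => if_pos hj]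
  rfl

lemma IsCoupling.exp_neg_hamiltonian (β : ℝ) (a : Λ → Bool) :
    exp (-hamiltonian K β Λ (concat Λ a ω)) =
      fieldWt (fun i j : Λ => β * (K i j / 2)) (fun i => β * boundaryField K Λ ω i) a := by
  have h1 : hamiltonian K β Λ (concat Λ a ω) = -β * ∑' p, pairTerm K Λ (concat Λ a ω) p := rfl
  have h2 : ∀ i, boundaryField K Λ (concat Λ a ω) i = boundaryField K Λ ω i := fun i =>
    tsum_congr fun j => by
      split_ifs with hj
      · rfl
      · rw [concat_apply_notMem a ω hj]
  rw [h1, hK.tsum_pairTerm, hK.tsum_orderedTerm, fieldWt]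
  congr 1
  rw [neg_mul, neg_neg, Finset.sum_add_distrib, mul_add]
  simp only [h2, pairEnergy, Fintype.sum_prod_type]
  simp only [← Finset.sum_coe_sort Λ, concat_apply_mem, Finset.mul_sum]
  simp only [mul_assoc]

lemma IsCoupling.gibbsKernel_eq (β : ℝ) (a : Λ → Bool) : gibbsKernel K β Λ a ω =
    fieldWt (fun i j : Λ => β * (K i j / 2)) (fun i => β * boundaryField K Λ ω i) a /
      ∑ b, fieldWt (fun i j : Λ => β * (K i j / 2)) (fun i => β * boundaryField K Λ ω i) b := by
  unfold gibbsKernel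
  simp_rw [hK.exp_neg_hamiltonian]

omit ω in
lemma IsCoupling.continuous_boundaryField (i : ℤ) :
    Continuous fun ω => boundaryField K Λ ω i := by
  refine continuous_tsum (fun j => ?_) (hK.summable i)
    fun j ω => hK.abs_boundaryField_term_le Λ ω i j
  split_ifs
  · exact continuous_const
  · exact continuous_const.mul ((continuous_of_discreteTopology (f := spin)).comp
      (continuous_apply j))

omit ω in
lemma IsCoupling.continuous_gibbsKernel (β : ℝ) (a : Λ → Bool) :
    Continuous fun ω => gibbsKernel K β Λ a ω := by
  have h1 : ∀ b : Λ → Bool, Continuous fun ω =>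
      fieldWt (fun i j : Λ => β * (K i j / 2)) (fun i => β * boundaryField K Λ ω i) b := by
    intro b
    unfold fieldWt
    refine Real.continuous_exp.comp (continuous_const.add (continuous_finsetSum _ fun i _ => ?_))
    exact (continuous_const.mul (hK.continuous_boundaryField Λ i)).mul continuous_const
  simp_rw [hK.gibbsKernel_eq]
  exact (h1 a).div (continuous_finsetSum _ fun b _ => h1 b)
    fun ω => (Finset.sum_pos (fun b _ => fieldWt_pos _ _ b) Finset.univ_nonempty).ne'

omit hK in
lemma gibbsKernel_pos (K : ℤ → ℤ → ℝ) (β : ℝ) (a : Λ → Bool) : 0 < gibbsKernel K β Λ a ω :=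
  div_pos (exp_pos _) (Finset.sum_pos (fun _ _ => exp_pos _) Finset.univ_nonempty)

omit hK in
lemma sum_gibbsKernel (K : ℤ → ℤ → ℝ) (β : ℝ) : ∑ a, gibbsKernel K β Λ a ω = 1 := by
  unfold gibbsKernel
  rw [← Finset.sum_div, div_self]
  exact (Finset.sum_pos (fun _ _ => exp_pos _) Finset.univ_nonempty).ne'

lemma IsCoupling.hamiltonian_sub (β : ℝ) {Δ : Finset ℤ} (hΔ : Δ ⊆ Λ) (d : Δ → Bool) :
    hamiltonian K β Λ ω - hamiltonian K β Δ ω =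
      hamiltonian K β Λ (concat Δ d ω) - hamiltonian K β Δ (concat Δ d ω) := by
  have h1 : ∀ (Γ : Finset ℤ) (η : Config), hamiltonian K β Γ η = -β * ∑' p, pairTerm K Γ η p :=
    fun _ _ => rfl
  simp only [h1, ← mul_sub]
  rw [← (hK.summable_pairTerm _ _).tsum_sub (hK.summable_pairTerm _ _),
    ← (hK.summable_pairTerm _ _).tsum_sub (hK.summable_pairTerm _ _)]
  congr 1
  refine tsum_congr fun p => ?_
  by_cases hp : p.1 ∈ Δ ∨ p.2 ∈ Δ
  · have hp' : p.1 ∈ Λ ∨ p.2 ∈ Λ := hp.imp (fun h => hΔ h) fun h => hΔ h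
    simp [pairTerm, hp, hp']
  · have h2 := not_or.1 hp
    simp [pairTerm, hp, concat_apply_notMem d ω h2.1, concat_apply_notMem d ω h2.2]

lemma IsCoupling.gibbsKernel_mul_gibbsKernel (β : ℝ) {Δ : Finset ℤ} (hΔ : Δ ⊆ Λ)
    (a a' : Λ → Bool) (d d' : Δ → Bool)
    (h1 : concat Λ a' ω = concat Δ d (concat Λ a ω))
    (h2 : concat Λ a ω = concat Δ d' (concat Λ a' ω)) :
    gibbsKernel K β Λ a ω * gibbsKernel K β Δ d (concat Λ a ω) =
      gibbsKernel K β Λ a' ω * gibbsKernel K β Δ d' (concat Λ a' ω) := by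
  have h3 : ∀ b, concat Δ b (concat Λ a' ω) = concat Δ b (concat Λ a ω) := fun b => by
    rw [h1, concat_concat]
  unfold gibbsKernel
  simp_rw [h3]
  rw [div_mul_div_comm, div_mul_div_comm, ← h1, ← h3 d', ← h2, ← exp_add, ← exp_add]
  congr 2
  have := hK.hamiltonian_sub Λ (concat Λ a ω) β hΔ d
  rw [← h1] at this
  linarith

/-- Finite-volume Gibbs measures are invariant under the kernels of smaller volumes. -/
lemma IsCoupling.sum_gibbsKernel_mul_sum (β : ℝ) {Δ : Finset ℤ} (hΔ : Δ ⊆ Λ) (F : Config → ℝ) :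
    ∑ a, gibbsKernel K β Λ a ω *
        ∑ d, gibbsKernel K β Δ d (concat Λ a ω) * F (concat Δ d (concat Λ a ω)) =
      ∑ a, gibbsKernel K β Λ a ω * F (concat Λ a ω) := by
  let T : (Λ → Bool) × (Δ → Bool) → (Λ → Bool) × (Δ → Bool) := fun q =>
    (fun i => concat Δ q.2 (concat Λ q.1 ω) i, fun i => concat Λ q.1 ω i)
  have hT1 : ∀ q, concat Λ (T q).1 ω = concat Δ q.2 (concat Λ q.1 ω) := by
    intro q
    funext i
    by_cases hi : i ∈ Λ
    · exact concat_apply_mem _ ω ⟨i, hi⟩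
    · rw [concat_apply_notMem _ _ hi, concat_apply_notMem _ _ fun h => hi (hΔ h),
        concat_apply_notMem _ _ hi]
  have hT2 : ∀ q, concat Λ q.1 ω = concat Δ (T q).2 (concat Λ (T q).1 ω) := by
    intro q
    rw [hT1, concat_concat]
    funext i
    by_cases hi : i ∈ Δ
    · exact (concat_apply_mem (T q).2 (concat Λ q.1 ω) ⟨i, hi⟩).symm
    · rw [concat_apply_notMem (T q).2 _ hi]
  have hT : Function.Involutive T := by
    rintro ⟨a, d⟩
    refine Prod.ext (funext fun i => ?_) (funext fun i => ?_)
    · change concat Δ (T (a, d)).2 (concat Λ (T (a, d)).1 ω) i = a i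
      rw [← hT2, concat_apply_mem]
    · change concat Λ (T (a, d)).1 ω i = d i
      rw [hT1, concat_apply_mem]
  calc ∑ a, gibbsKernel K β Λ a ω *
        ∑ d, gibbsKernel K β Δ d (concat Λ a ω) * F (concat Δ d (concat Λ a ω))
      = ∑ q : (Λ → Bool) × (Δ → Bool), gibbsKernel K β Λ q.1 ω *
          gibbsKernel K β Δ q.2 (concat Λ q.1 ω) * F (concat Δ q.2 (concat Λ q.1 ω)) := by
        simp_rw [Fintype.sum_prod_type, Finset.mul_sum, mul_assoc]
    _ = ∑ q, gibbsKernel K β Λ (T q).1 ω *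
          gibbsKernel K β Δ (T q).2 (concat Λ (T q).1 ω) * F (concat Λ (T q).1 ω) := by
        refine Finset.sum_congr rfl fun q _ => ?_
        rw [hK.gibbsKernel_mul_gibbsKernel Λ ω β hΔ _ _ _ _ (hT1 q) (hT2 q), hT1]
    _ = ∑ q : (Λ → Bool) × (Δ → Bool), gibbsKernel K β Λ q.1 ω *
          gibbsKernel K β Δ q.2 (concat Λ q.1 ω) * F (concat Λ q.1 ω) :=
        Equiv.sum_comp hT.toPerm (fun q => gibbsKernel K β Λ q.1 ω *
          gibbsKernel K β Δ q.2 (concat Λ q.1 ω) * F (concat Λ q.1 ω))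
    _ = _ := by
        rw [Fintype.sum_prod_type]
        refine Finset.sum_congr rfl fun a _ => ?_
        dsimp only
        rw [← Finset.sum_mul, ← Finset.mul_sum, sum_gibbsKernel, mul_one]

end Energy

/-- The box `[-N, N]`. -/
def box (N : ℕ) : Finset ℤ := Finset.Icc (-(N : ℤ)) N

lemma zero_mem_box (N : ℕ) : 0 ∈ box N := by simp [box]

lemma eventually_mem_box (i : ℤ) : ∀ᶠ N in Filter.atTop, i ∈ box N := by
  filter_upwards [Filter.eventually_ge_atTop i.natAbs] with N hN
  simp only [box, Finset.mem_Icc]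
  omega

lemma eventually_subset_box (S : Finset ℤ) : ∀ᶠ N in Filter.atTop, S ⊆ box N :=
  (Filter.eventually_all_finset S).2 fun i _ => eventually_mem_box i

lemma measurable_concat (Λ : Finset ℤ) (a : Λ → Bool) : Measurable (concat Λ a) := by
  refine measurable_pi_iff.2 fun j => ?_
  unfold concat
  split_ifs
  exacts [measurable_const, measurable_pi_apply j]

lemma continuous_concat (Λ : Finset ℤ) (a : Λ → Bool) : Continuous (concat Λ a) := by
  refine continuous_pi fun j => ?_
  unfold concat
  split_ifs
  exacts [continuous_const, continuous_apply j]

lemma continuous_spin_apply (i : ℤ) : Continuous fun ω : Config => spin (ω i) :=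
  (continuous_of_discreteTopology (f := spin)).comp (continuous_apply i)

/-- The finite-volume Gibbs measure in `Λ` with boundary condition `ω`. -/
def boxMeasure (K : ℤ → ℤ → ℝ) (β : ℝ) (Λ : Finset ℤ) (ω : Config) : Measure Config :=
  ∑ a, ENNReal.ofReal (gibbsKernel K β Λ a ω) • Measure.dirac (concat Λ a ω)

instance (K : ℤ → ℤ → ℝ) (β : ℝ) (Λ : Finset ℤ) (ω : Config) :
    IsProbabilityMeasure (boxMeasure K β Λ ω) := by
  constructor
  simp only [boxMeasure, Measure.coe_finsetSum, Finset.sum_apply, Measure.smul_apply,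
    measure_univ, smul_eq_mul, mul_one]
  rw [← ENNReal.ofReal_sum_of_nonneg fun a _ => (gibbsKernel_pos Λ ω K β a).le, sum_gibbsKernel,
    ENNReal.ofReal_one]

lemma integral_boxMeasure (K : ℤ → ℤ → ℝ) (β : ℝ) (Λ : Finset ℤ) (ω : Config)
    (f : Config → ℝ) :
    ∫ η, f η ∂boxMeasure K β Λ ω = ∑ a, gibbsKernel K β Λ a ω * f (concat Λ a ω) := by
  unfold boxMeasure
  rw [integral_finsetSum_measure fun a _ =>
    (integrable_dirac (by simp)).smul_measure ENNReal.ofReal_ne_top]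
  refine Finset.sum_congr rfl fun a _ => ?_
  rw [integral_smul_measure, integral_dirac, ENNReal.toReal_ofReal (gibbsKernel_pos Λ ω K β a).le,
    smul_eq_mul]

lemma integrable_of_continuous {X : Type*} [TopologicalSpace X] [CompactSpace X]
    [MeasurableSpace X] [BorelSpace X] [SecondCountableTopology X]
    (μ : Measure X) [IsFiniteMeasure μ] {f : X → ℝ} (hf : Continuous f) : Integrable f μ :=
  (BoundedContinuousFunction.mkOfCompact ⟨f, hf⟩).integrable μ

/-- An identity for the integrals of continuous functions extends to measures. -/
lemma sum_map_withDensity_eq {X ι : Type*} [TopologicalSpace X] [CompactSpace X]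
    [MeasurableSpace X] [BorelSpace X] [SecondCountableTopology X] [HasOuterApproxClosed X]
    [Fintype ι] {μ : Measure X} [IsFiniteMeasure μ] {w : ι → X → ℝ} (hw : ∀ i, Continuous (w i))
    (hw0 : ∀ i x, 0 ≤ w i x) {g : ι → X → X} (hg : ∀ i, Continuous (g i))
    (h : ∀ F : X → ℝ, Continuous F → ∫ x, ∑ i, w i x * F (g i x) ∂μ = ∫ x, F x ∂μ) :
    ∑ i, (μ.withDensity fun x => ENNReal.ofReal (w i x)).map (g i) = μ := by
  have hfin : ∀ i, IsFiniteMeasure (μ.withDensity fun x => ENNReal.ofReal (w i x)) := fun i =>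
    isFiniteMeasure_withDensity_ofReal (integrable_of_continuous μ (hw i)).2
  refine ext_of_forall_integral_eq_of_IsFiniteMeasure fun f => ?_
  rw [← h f f.continuous, integral_finsetSum_measure fun i _ => f.integrable _,
    integral_finsetSum _ (f := fun i x => w i x * f (g i x))
      fun i _ => integrable_of_continuous μ ((hw i).mul (f.continuous.comp (hg i)))]
  refine Finset.sum_congr rfl fun i _ => ?_
  rw [integral_map (hg i).measurable.aemeasurable f.continuous.aestronglyMeasurable,
    integral_withDensity_eq_integral_toReal_smul (hw i).measurable.ennreal_ofReal (by simp)]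
  refine integral_congr_ae (.of_forall fun x => ?_)
  simp only [smul_eq_mul, ENNReal.toReal_ofReal (hw0 i x)]

section Kernel

variable {K : ℤ → ℤ → ℝ} (hK : IsCoupling K) (β : ℝ) (μ : Measure Config)
  [IsProbabilityMeasure μ]
include hK

/-- A probability measure that is invariant under all Gibbs kernels, tested against continuous
functions, is a Gibbs measure. -/
lemma IsCoupling.isGibbs_of_integral (h : ∀ (Δ : Finset ℤ) (F : Config → ℝ), Continuous F →
    ∫ η, ∑ d, gibbsKernel K β Δ d η * F (concat Δ d η) ∂μ = ∫ η, F η ∂μ) : IsGibbs K β μ := by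
  refine ⟨inferInstance, fun Δ a B hB => ?_⟩
  let w : (Δ → Bool) → Config → ENNReal := fun d η => ENNReal.ofReal (gibbsKernel K β Δ d η)
  have hc : ∀ d, Continuous fun η => gibbsKernel K β Δ d η := hK.continuous_gibbsKernel Δ β
  let μ' : Measure Config := ∑ d, (μ.withDensity (w d)).map (concat Δ d)
  have hμ : μ' = μ := sum_map_withDensity_eq hc (fun d η => (gibbsKernel_pos Δ η K β d).le)
    (continuous_concat Δ) fun F hF => h Δ F hF
  obtain ⟨B', hB', rfl⟩ := hB
  set B : Set Config := (fun (ω : Config) (j : {j : ℤ // j ∉ Δ}) => ω j.1) ⁻¹' B' with hBdef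
  have hBm : MeasurableSet B :=
    measurable_pi_iff.2 (fun j => measurable_pi_apply _) hB'
  have hcyl : MeasurableSet (cylinderEvent Δ a) := by
    have : cylinderEvent Δ a = ⋂ i : Δ, (fun ω : Config => ω i) ⁻¹' {a i} := by
      ext ω
      simp [cylinderEvent]
    rw [this]
    exact MeasurableSet.iInter fun i => measurable_pi_apply _ (measurableSet_singleton _)
  have hpre : ∀ d, concat Δ d ⁻¹' (cylinderEvent Δ a ∩ B) = if d = a then B else ∅ := by
    intro d
    have h1 : ∀ η, concat Δ d η ∈ B ↔ η ∈ B := by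
      intro η
      have : (fun j : {j : ℤ // j ∉ Δ} => concat Δ d η j.1) = fun j => η j.1 :=
        funext fun j => concat_apply_notMem d η j.2
      change (fun j : {j : ℤ // j ∉ Δ} => concat Δ d η j.1) ∈ B' ↔ _
      rw [this]
      rfl
    have h2 : ∀ η, concat Δ d η ∈ cylinderEvent Δ a ↔ d = a := by
      intro η
      simp only [cylinderEvent, Set.mem_ofPred_eq, concat_apply_mem]
      exact funext_iff.symm
    ext η
    rw [Set.mem_preimage, Set.mem_inter_iff, h1, h2]
    split_ifs with hd <;> simp [hd]
  have key : μ (cylinderEvent Δ a ∩ B) = ∫⁻ η in B, w a η ∂μ := by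
    calc μ (cylinderEvent Δ a ∩ B) = μ' (cylinderEvent Δ a ∩ B) := by rw [hμ]
      _ = ∑ d, (μ.withDensity (w d)) (if d = a then B else ∅) := by
        simp only [μ', Measure.coe_finsetSum, Finset.sum_apply]
        refine Finset.sum_congr rfl fun d _ => ?_
        rw [Measure.map_apply (measurable_concat Δ d) (hcyl.inter hBm), hpre]
      _ = (μ.withDensity (w a)) B := by
        rw [Finset.sum_eq_single a]
        · rw [if_pos rfl]
        · intro d _ hd
          rw [if_neg hd, measure_empty]
        · simp
      _ = _ := withDensity_apply _ hBm
  rw [key, integral_eq_lintegral_of_nonneg_ae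
    (.of_forall fun η => (gibbsKernel_pos Δ η K β a).le) (hc a).aestronglyMeasurable]

omit μ [IsProbabilityMeasure μ] in
lemma IsCoupling.exists_isGibbs (ω : Config) {f : Config → ℝ} (hf : Continuous f) {r : ℝ}
    (hr : ∀ N, r ≤ ∑ a, gibbsKernel K β (box N) a ω * f (concat (box N) a ω)) :
    ∃ μ : Measure Config, IsGibbs K β μ ∧ r ≤ ∫ η, f η ∂μ := by
  let P : ℕ → ProbabilityMeasure Config := fun N => ⟨boxMeasure K β (box N) ω, inferInstance⟩
  let U : Ultrafilter ℕ := Filter.hyperfilter ℕ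
  have hU : (U : Filter ℕ) ≤ Filter.atTop := Nat.hyperfilter_le_atTop
  obtain ⟨Q, -, hQ⟩ := isCompact_univ.ultrafilter_le_nhds (U.map P) (by simp)
  have hlim : ∀ F : Config → ℝ, Continuous F →
      Filter.Tendsto (fun N => ∑ a, gibbsKernel K β (box N) a ω * F (concat (box N) a ω)) U
        (nhds (∫ η, F η ∂(Q : Measure Config))) := by
    intro F hF
    have := ProbabilityMeasure.tendsto_iff_forall_integral_tendsto.1 (show Filter.Tendsto P U _ from hQ)
      (BoundedContinuousFunction.mkOfCompact ⟨F, hF⟩)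
    refine this.congr fun N => ?_
    exact integral_boxMeasure K β (box N) ω F
  refine ⟨Q, hK.isGibbs_of_integral β Q fun Δ F hF => ?_, ?_⟩
  · refine tendsto_nhds_unique ((hlim _ (continuous_finsetSum _ fun d _ =>
      (hK.continuous_gibbsKernel Δ β d).mul (hF.comp (continuous_concat Δ d)))).congr' ?_)
      (hlim F hF)
    filter_upwards [hU (eventually_subset_box Δ)] with N hN
    exact hK.sum_gibbsKernel_mul_sum (box N) ω β hN F
  · exact ge_of_tendsto (hlim f hf) (.of_forall hr)

end Kernel

section NonUnique

variable {K : ℤ → ℤ → ℝ} (hK : IsCoupling K) (β : ℝ)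
include hK

lemma IsCoupling.sum_gibbsKernel_const_true {Λ : Finset ℤ} (i : Λ) :
    ∑ a, gibbsKernel K β Λ a (fun _ => true) * spin (a i) =
      corr (fun x y => β * ghostK K Λ x y) (some i) none := by
  have h1 : ∀ i, boundaryField K Λ (fun _ => true) i = extField K Λ i := fun i =>
    tsum_congr fun j => by simp [spin]
  have h2 := corr_withField_mul (fun i j : Λ => β * (K i j / 2)) (fun i => β * extField K Λ i)
    (some i) none
  rw [withField_const_mul] at h2
  have hpos : 0 < ∑ σ, fieldWt (fun i j : Λ => β * (K i j / 2))
      (fun i => β * extField K Λ i) σ :=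
    Finset.sum_pos (fun b _ => fieldWt_pos _ _ b) Finset.univ_nonempty
  rw [ghostK, eq_div_of_mul_eq hpos.ne' h2, Finset.sum_div]
  refine Finset.sum_congr rfl fun a _ => ?_
  rw [hK.gibbsKernel_eq]
  simp_rw [h1]
  have h3 : spinPair (some i) none (withPlus a) = spin (a i) := by
    have h4 : spin (withPlus a none) = 1 := if_pos rfl
    rw [spinPair, h4, mul_one]
    rfl
  rw [h3]
  ring

lemma IsCoupling.sum_gibbsKernel_const_false {Λ : Finset ℤ} (i : Λ) :
    ∑ a, gibbsKernel K β Λ a (fun _ => false) * -spin (a i) =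
      ∑ a, gibbsKernel K β Λ a (fun _ => true) * spin (a i) := by
  have h1 : ∀ i, boundaryField K Λ (fun _ => false) i = -boundaryField K Λ (fun _ => true) i := by
    intro i
    unfold boundaryField
    rw [← tsum_neg]
    exact tsum_congr fun j => by split_ifs <;> simp [spin]
  have h2 : ∀ a : Λ → Bool, fieldWt (fun i j : Λ => β * (K i j / 2))
        (fun i => β * boundaryField K Λ (fun _ => false) i) (flipOn Finset.univ a) =
      fieldWt (fun i j : Λ => β * (K i j / 2))
        (fun i => β * boundaryField K Λ (fun _ => true) i) a := by
    intro a
    have h3 := isingWt_flipOn_univ (fun i j : Λ => β * (K i j / 2)) a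
    unfold isingWt at h3
    unfold fieldWt
    rw [exp_add, exp_add, h3]
    simp [h1, spin_flipOn]
  have h4 : ∀ a : Λ → Bool, gibbsKernel K β Λ (flipOn Finset.univ a) (fun _ => false) =
      gibbsKernel K β Λ a (fun _ => true) := by
    intro a
    rw [hK.gibbsKernel_eq, hK.gibbsKernel_eq, h2, ← sum_comp_flipOn Finset.univ]
    simp_rw [h2]
  rw [← sum_comp_flipOn Finset.univ]
  refine Finset.sum_congr rfl fun a _ => ?_
  rw [h4]
  simp [spin_flipOn]

theorem IsCoupling.not_existsUnique_isGibbs {m : ℝ} (hm : 0 < m)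
    (h : ∀ N, m ≤ corr (fun x y => β * ghostK K (box N) x y) (some ⟨0, zero_mem_box N⟩) none) :
    ¬∃! μ : Measure Config, IsGibbs K β μ := by
  intro hu
  obtain ⟨μ, hμ, h1⟩ := hK.exists_isGibbs β (fun _ => true) (continuous_spin_apply 0) (r := m)
    fun N => by
      have := hK.sum_gibbsKernel_const_true β ⟨0, zero_mem_box N⟩
      simp_rw [← concat_apply_mem _ (fun _ => true)] at this
      rw [this]
      exact h N
  obtain ⟨μ', hμ', h2⟩ := hK.exists_isGibbs β (fun _ => false)
    (f := fun ω => -spin (ω 0)) (continuous_spin_apply 0).neg (r := m) fun N => by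
      have := hK.sum_gibbsKernel_const_false β ⟨0, zero_mem_box N⟩
      rw [hK.sum_gibbsKernel_const_true] at this
      simp_rw [← concat_apply_mem _ (fun _ => false)] at this
      rw [this]
      exact h N
  rw [hu.unique hμ hμ', ← neg_le_neg_iff] at h1
  rw [integral_neg] at h2
  linarith

/-- Below the critical point some finite set has a small boundary functional. -/
theorem IsCoupling.exists_boundarySum_lt (h0 : 0 ≤ β) (hβ : β < betaC K) {ε : ℝ} (hε : 0 < ε) :
    ∃ (S : Finset ℤ) (o : 0 ∈ S), boundarySum K β S ⟨0, o⟩ < ε := by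
  by_contra! hcon
  have hne : {β : ℝ | 0 ≤ β ∧ ∃! μ : Measure Config, IsGibbs K β μ}.Nonempty := by
    by_contra hemp
    rw [Set.not_nonempty_iff_eq_empty] at hemp
    rw [betaC, hemp, Real.sSup_empty] at hβ
    linarith
  obtain ⟨β', ⟨-, hu⟩, hβ'⟩ := exists_lt_of_lt_csSup hne hβ
  refine hK.not_existsUnique_isGibbs β' ?_ (fun N => hK.div_le_corr_ghostK h0 hβ' (half_pos hε).le
    (fun S o => ?_) (zero_mem_box N)) hu
  · have : 0 < ε / 2 * (β' - β) := mul_pos (half_pos hε) (sub_pos.2 hβ')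
    positivity
  · rw [mul_div_cancel₀ _ two_ne_zero]
    exact hcon S o

end NonUnique

/-- The two-point function with plus boundary condition in the box `[-N, N]`, extended by `1`. -/
def plusCorr (K : ℤ → ℤ → ℝ) (β : ℝ) (N : ℕ) (i j : ℤ) : ℝ :=
  if h : i ∈ box N ∧ j ∈ box N then
    corr (fun x y => β * ghostK K (box N) x y) (some ⟨i, h.1⟩) (some ⟨j, h.2⟩)
  else 1

lemma sum_le_div_of_forall_card {α : Type*} {q : α → ℝ} {s ρ : ℝ} (hq : ∀ d, q d ≤ 1)
    (hρ : ρ < 1)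
    (h : ∀ (m : ℕ) (C : ℝ), (∀ F : Finset α, F.card ≤ m → ∑ d ∈ F, q d ≤ C) →
      ∀ F : Finset α, F.card ≤ m → ∑ d ∈ F, q d ≤ s + ρ * C) (F : Finset α) :
    ∑ d ∈ F, q d ≤ s / (1 - ρ) := by
  let A : Set ℝ := {r | ∃ G : Finset α, G.card ≤ F.card ∧ r = ∑ d ∈ G, q d}
  have hA : BddAbove A := by
    refine ⟨F.card, ?_⟩
    rintro r ⟨G, hG, rfl⟩
    refine (Finset.sum_le_card_nsmul G q 1 fun d _ => hq d).trans ?_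
    rw [nsmul_eq_mul, mul_one]
    exact_mod_cast hG
  have hne : A.Nonempty := ⟨_, F, le_rfl, rfl⟩
  have h1 : sSup A ≤ s + ρ * sSup A := by
    refine csSup_le hne ?_
    rintro r ⟨G, hG, rfl⟩
    exact h F.card (sSup A) (fun G' hG' => le_csSup hA ⟨G', hG', rfl⟩) G hG
  rw [le_div_iff₀ (by linarith)]
  have h2 : ∑ d ∈ F, q d ≤ sSup A := le_csSup hA ⟨F, le_rfl, rfl⟩
  nlinarith

section Decay

variable {K : ℤ → ℤ → ℝ} (hK : IsCoupling K) {β : ℝ} (h0 : 0 ≤ β)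
include hK h0

lemma IsCoupling.mul_ghostK_nonneg (Λ : Finset ℤ) (x y : Option Λ) : 0 ≤ β * ghostK K Λ x y :=
  mul_nonneg h0 (hK.ghostK_nonneg Λ x y)

lemma IsCoupling.plusCorr_mem_Icc (N : ℕ) (i j : ℤ) :
    plusCorr K β N i j ∈ Set.Icc (0 : ℝ) 1 := by
  unfold plusCorr
  split_ifs
  · exact ⟨corr_nonneg (hK.mul_ghostK_nonneg h0 _) _ _, corr_le_one _ _ _⟩
  · simp

lemma IsCoupling.plusCorr_le {S : Finset ℤ} (o : 0 ∈ S) {N : ℕ} {i z : ℤ}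
    (hS : ∀ x ∈ S, x + i ∈ box N) (hz : z ∈ box N) (hzS : z - i ∉ S) :
    plusCorr K β N i z ≤ ∑ x : S, freeCorr K β S ⟨0, o⟩ x *
      (β * ∑' j, if j - i ∈ S then 0 else K (x + i) j * plusCorr K β N j z) := by
  have hi : i ∈ box N := by simpa using hS 0 o
  have hA := hK.mul_ghostK_nonneg h0 (box N)
  have ho : shiftEmb S (box N) i hS ⟨0, o⟩ = some ⟨i, hi⟩ := by
    simp [shiftEmb_apply]
  rw [plusCorr, dif_pos ⟨hi, hz⟩, ← ho]
  refine (corr_le_sum_corr_mul_corr hA (S := Finset.univ.map (shiftEmb S (box N) i hS))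
    (Finset.mem_map_of_mem _ (Finset.mem_univ _)) ?_).trans ?_
  · rwa [some_mem_map_shiftEmb]
  rw [Finset.sum_map]
  refine Finset.sum_le_sum fun x _ => ?_
  rw [hK.corr_restrictTo_ghostK]
  let g : Option (box N) → ℝ := fun y =>
    y.elim 1 fun j => corr (fun x y => β * ghostK K (box N) x y) (some j) (some ⟨z, hz⟩)
  have hg : ∀ y, corr (fun x y => β * ghostK K (box N) x y) y (some ⟨z, hz⟩) ≤ g y := by
    rintro (_ | j)
    exacts [corr_le_one _ _ _, le_rfl]
  have hsum := hK.sum_ghostK_mul hS g (fun j => plusCorr K β N j z)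
    (fun j => dif_pos ⟨j.2, hz⟩) (fun j hj => dif_neg fun h => hj h.1) x
  have hf := hK.freeCorr_nonneg h0 S ⟨0, o⟩ x
  calc _ ≤ ∑ y ∈ (Finset.univ.map (shiftEmb S (box N) i hS))ᶜ,
        freeCorr K β S ⟨0, o⟩ x * (2 * β) *
          (ghostK K (box N) (shiftEmb S (box N) i hS x) y * g y) := by
        refine Finset.sum_le_sum fun y _ => ?_
        rw [hK.ghostK_symm _ y]
        have h1 := mul_le_mul_of_nonneg_left (hg y)
          (mul_nonneg hf (hA (shiftEmb S (box N) i hS x) y))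
        calc _ = 2 * (freeCorr K β S ⟨0, o⟩ x *
              (β * ghostK K (box N) (shiftEmb S (box N) i hS x) y) *
                corr (fun x y => β * ghostK K (box N) x y) y (some ⟨z, hz⟩)) := by ring
          _ ≤ _ := mul_le_mul_of_nonneg_left h1 zero_le_two
          _ = _ := by ring
    _ = _ := by
        rw [← Finset.mul_sum, hsum]
        ring

/-- Exhaustion by boxes turns a set with a small boundary functional into a summable bound on
correlations with plus boundary conditions. -/
theorem IsCoupling.exists_summable_bound {S : Finset ℤ} (o : 0 ∈ S)
    (hS : β * boundarySum K β S ⟨0, o⟩ < 1) :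
    ∃ q : ℤ → ℝ, (∀ d, 0 ≤ q d) ∧ Summable q ∧
      ∀ (i j : ℤ) (r : ℝ), (∀ᶠ N in Filter.atTop, r ≤ plusCorr K β N i j) → r ≤ q (j - i) := by
  let U : Ultrafilter ℕ := Filter.hyperfilter ℕ
  have hU : (U : Filter ℕ) ≤ Filter.atTop := Nat.hyperfilter_le_atTop
  have hex : ∀ i j, ∃ l ∈ Set.Icc (0 : ℝ) 1,
      Filter.Tendsto (fun N => plusCorr K β N i j) U (nhds l) := fun i j =>
    isCompact_Icc.ultrafilter_le_nhds (U.map fun N : ℕ => plusCorr K β N i j)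
      (Filter.tendsto_principal.2 (.of_forall fun N => hK.plusCorr_mem_Icc h0 N i j))
  choose p hp hlim using hex
  have hbdd : ∀ d, BddAbove (Set.range fun i => p i (i + d)) := fun d =>
    ⟨1, Set.forall_mem_range.2 fun i => (hp _ _).2⟩
  let q : ℤ → ℝ := fun d => ⨆ i, p i (i + d)
  have hpq : ∀ i j, p i j ≤ q (j - i) := fun i j => by
    have := le_ciSup (hbdd (j - i)) i
    rwa [add_sub_cancel] at this
  have hq0 : ∀ d, 0 ≤ q d := fun d => (hp 0 (0 + d)).1.trans (le_ciSup (hbdd d) 0)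
  have hq1 : ∀ d, q d ≤ 1 := fun d => ciSup_le fun i => (hp _ _).2
  have hsumm : ∀ (x : ℤ) (g : ℤ → ℝ), (∀ k, 0 ≤ g k) → (∃ C, ∀ k, g k ≤ C) →
      Summable fun k => if k ∈ S then 0 else K x k * g k := by
    rintro x g hg ⟨C, hC⟩
    refine Summable.of_nonneg_of_le (fun k => ?_) (fun k => ?_) ((hK.summable x).mul_right C)
    · split_ifs
      exacts [le_rfl, mul_nonneg (hK.nonneg _ _) (hg k)]
    · have := mul_le_mul_of_nonneg_left (hC k) (hK.nonneg x k)
      split_ifs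
      exacts [(mul_nonneg (hK.nonneg _ _) (hg k)).trans this, this]
  have hp_le : ∀ i z, z - i ∉ S → p i z ≤ ∑ x : S, freeCorr K β S ⟨0, o⟩ x *
      (β * ∑' j, if j - i ∈ S then 0 else K (x + i) j * p j z) := by
    intro i z hz
    have ht : ∀ x : S, Filter.Tendsto
        (fun N => ∑' j, if j - i ∈ S then 0 else K (x + i) j * plusCorr K β N j z) U
        (nhds (∑' j, if j - i ∈ S then 0 else K (x + i) j * p j z)) := by
      intro x
      refine tendsto_tsum_of_dominated_convergence (hK.summable (x + i)) (fun j => ?_)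
        (.of_forall fun N j => ?_)
      · split_ifs
        exacts [tendsto_const_nhds, (hlim j z).const_mul _]
      · have h1 := hK.plusCorr_mem_Icc h0 N j z
        have h2 := hK.nonneg (x + i) j
        split_ifs
        · simpa
        · rw [Real.norm_of_nonneg (mul_nonneg h2 h1.1)]
          exact mul_le_of_le_one_right h2 h1.2
    refine le_of_tendsto_of_tendsto (hlim i z)
      (tendsto_finsetSum _ fun x _ => ((ht x).const_mul β).const_mul _) ?_
    filter_upwards [hU (eventually_mem_box z),
      hU ((Filter.eventually_all_finset S).2 fun x _ => eventually_mem_box (x + i))]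
      with N hN1 hN2
    exact hK.plusCorr_le h0 o hN2 hN1 hz
  have hq_le : ∀ d ∉ S, q d ≤ ∑ x : S, freeCorr K β S ⟨0, o⟩ x *
      (β * ∑' k, if k ∈ S then 0 else K x k * q (d - k)) := by
    intro d hd
    refine ciSup_le fun i => (hp_le i (i + d) (by rwa [add_sub_cancel_left])).trans ?_
    refine Finset.sum_le_sum fun x _ => mul_le_mul_of_nonneg_left
      (mul_le_mul_of_nonneg_left ?_ h0) (hK.freeCorr_nonneg h0 S _ x)
    rw [← (Equiv.addRight i).tsum_eq]
    simp only [Equiv.coe_addRight, add_sub_cancel_right, hK.shift]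
    refine Summable.tsum_le_tsum (fun k => ?_)
      (hsumm x (fun k => p (k + i) (i + d)) (fun k => (hp _ _).1) ⟨1, fun k => (hp _ _).2⟩)
      (hsumm x (fun k => q (d - k)) (fun k => hq0 _) ⟨1, fun k => hq1 _⟩)
    split_ifs
    · exact le_rfl
    · refine mul_le_mul_of_nonneg_left ((hpq _ _).trans_eq (congrArg q ?_)) (hK.nonneg _ _)
      ring
  refine ⟨q, hq0, summable_of_sum_le hq0 (c := S.card / (1 - β * boundarySum K β S ⟨0, o⟩))
    (sum_le_div_of_forall_card hq1 hS fun m C hC F hF => ?_), fun i j r hr => ?_⟩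
  · classical
    have hC0 : 0 ≤ C := by simpa using hC ∅ (by simp)
    rw [← Finset.sum_inter_add_sum_sdiff F S]
    refine add_le_add ?_ ?_
    · refine (Finset.sum_le_card_nsmul _ q 1 fun d _ => hq1 d).trans ?_
      rw [nsmul_eq_mul, mul_one]
      exact_mod_cast Finset.card_le_card Finset.inter_subset_right
    · have hFS : (F \ S).card ≤ m := (Finset.card_le_card Finset.sdiff_subset).trans hF
      calc ∑ d ∈ F \ S, q d ≤ ∑ d ∈ F \ S, ∑ x : S, freeCorr K β S ⟨0, o⟩ x *
            (β * ∑' k, if k ∈ S then 0 else K x k * q (d - k)) :=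
            Finset.sum_le_sum fun d hd => hq_le d (Finset.mem_sdiff.1 hd).2
        _ = ∑ x : S, freeCorr K β S ⟨0, o⟩ x *
            (β * ∑' k, if k ∈ S then 0 else K x k * ∑ d ∈ F \ S, q (d - k)) := by
            rw [Finset.sum_comm]
            refine Finset.sum_congr rfl fun x _ => ?_
            rw [← Finset.mul_sum, ← Finset.mul_sum, ← Summable.tsum_finsetSum fun d _ =>
              hsumm x (fun k => q (d - k)) (fun k => hq0 _) ⟨1, fun k => hq1 _⟩]
            congr 3
            funext k
            split_ifs
            · simp
            · rw [Finset.mul_sum]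
        _ ≤ ∑ x : S, freeCorr K β S ⟨0, o⟩ x * (β * (extField K S x * C)) := by
            refine Finset.sum_le_sum fun x _ => mul_le_mul_of_nonneg_left
              (mul_le_mul_of_nonneg_left ?_ h0) (hK.freeCorr_nonneg h0 S _ x)
            have hle : ∀ k, ∑ d ∈ F \ S, q (d - k) ≤ C := by
              intro k
              have := hC ((F \ S).map (Equiv.subRight k).toEmbedding) (by rwa [Finset.card_map])
              rwa [Finset.sum_map] at this
            rw [extField, ← tsum_mul_right]
            refine Summable.tsum_le_tsum (fun k => ?_)
              (hsumm x _ (fun k => Finset.sum_nonneg fun d _ => hq0 _) ⟨C, hle⟩)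
              ((hK.summable_ite _ _).mul_right C)
            split_ifs
            · simp
            · exact mul_le_mul_of_nonneg_left (hle k) (hK.nonneg _ _)
        _ = β * boundarySum K β S ⟨0, o⟩ * C := by
            rw [boundarySum, Finset.mul_sum, Finset.sum_mul]
            exact Finset.sum_congr rfl fun x _ => by ring
  · exact (ge_of_tendsto (hlim i j) (hU hr)).trans (hpq i j)

end Decay

section Transfer

lemma dysonK_of_lt (J : ℕ → ℝ) {i j : ℤ} {k : ℕ} (h : j = i + (k + 1)) :
    dysonK J i j = J (k + 1) := by
  rw [dysonK, if_neg (by omega)]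
  congr 1
  omega

lemma dysonK_symm (J : ℕ → ℝ) (i j : ℤ) : dysonK J i j = dysonK J j i := by
  unfold dysonK
  rw [← neg_sub, Int.natAbs_neg]
  simp only [eq_comm]

lemma isCoupling_dysonK {J : ℕ → ℝ} (hJ : ∀ k, 1 ≤ k → 0 ≤ J k)
    (hs : Summable fun k : ℕ => J (k + 1)) : IsCoupling (dysonK J) where
  nonneg i j := by
    unfold dysonK
    split_ifs with h
    exacts [le_rfl, hJ _ (by omega)]
  symm := dysonK_symm J
  diag i := if_pos rfl
  shift i j k := by simp [dysonK]
  summable i := by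
    rw [← (Equiv.addLeft i).summable_iff]
    refine Summable.of_nat_of_neg_add_one (f := dysonK J i ∘ Equiv.addLeft i) ?_ ?_
    · refine (summable_nat_add_iff 1).1 (hs.congr fun k => ?_)
      rw [Function.comp_apply, dysonK_of_lt J (k := k) (by simp)]
    · refine hs.congr fun k => ?_
      rw [Function.comp_apply, dysonK_symm, dysonK_of_lt J (k := k)]
      simp
      ring

/-- The configuration starting with the word `a` and continuing with `x`. -/
def prefixP (n : ℕ) (a : Fin n → Bool) (x : ConfigP) : ConfigP :=
  fun i => if h : i < n then a ⟨i, h⟩ else x (i - n)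

lemma prefixP_val {n : ℕ} (a : Fin n → Bool) (x : ConfigP) (i : Fin n) :
    prefixP n a x i = a i := by
  simp [prefixP]

lemma prefixP_add (n : ℕ) (a : Fin n → Bool) (x : ConfigP) (m : ℕ) :
    prefixP n a x (n + m) = x m := by
  simp [prefixP]

lemma prefixP_cons {n : ℕ} (b : Bool) (a : Fin n → Bool) (x : ConfigP) :
    prefixP (n + 1) (Fin.cons b a) x = consP b (prefixP n a x) := by
  funext i
  rcases i with _ | i
  · simp [prefixP, consP]
  · simp only [prefixP, consP, add_lt_add_iff_right, Nat.add_sub_add_right]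
    split_ifs
    exacts [rfl, rfl]

lemma continuous_prefixP (n : ℕ) (a : Fin n → Bool) : Continuous (prefixP n a) := by
  refine continuous_pi fun j => ?_
  unfold prefixP
  split_ifs
  exacts [continuous_const, continuous_apply _]

lemma consP_eq_prefixP (b : Bool) (x : ConfigP) : consP b x = prefixP 1 (fun _ => b) x := by
  funext i
  rcases i with _ | i <;> simp [prefixP, consP]

lemma continuous_consP (b : Bool) : Continuous (consP b) := by
  simp only [funext (consP_eq_prefixP b)]
  exact continuous_prefixP 1 _

/-- The field at `i` created by the configuration `x` placed to the right of `n`. -/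
def tailField (K : ℤ → ℤ → ℝ) (n : ℕ) (x : ConfigP) (i : ℤ) : ℝ :=
  ∑' m : ℕ, K i (n + m) * spin (x m)

/-- The weight of the word `a` in front of `x`. -/
def prefixWt (K : ℤ → ℤ → ℝ) (β : ℝ) (n : ℕ) (x : ConfigP) (a : Fin n → Bool) : ℝ :=
  fieldWt (fun i j : Fin n => β * (K i j / 2)) (fun i => β * tailField K n x i) a

lemma potential_consP (J : ℕ → ℝ) (b : Bool) (x : ConfigP) :
    potential J (consP b x) = spin b * tailField (dysonK J) 1 x 0 := by
  unfold potential tailField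
  rw [← tsum_mul_left]
  refine tsum_congr fun m => ?_
  rw [dysonK_of_lt J (k := m) (by push_cast; ring)]
  change J (m + 1) * spin b * spin (x m) = _
  ring

variable {K : ℤ → ℤ → ℝ} (hK : IsCoupling K)
include hK

lemma IsCoupling.summable_nat (i : ℤ) (n : ℕ) : Summable fun m : ℕ => K i (n + m) :=
  (hK.summable i).comp_injective fun a b h => by simpa using h

lemma IsCoupling.abs_mul_spin_single (i j : ℤ) (b : Bool) : |K i j * spin b| = K i j := by
  rw [abs_mul, abs_of_nonneg (hK.nonneg i j)]
  cases b <;> simp [spin]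

lemma IsCoupling.summable_tail (i : ℤ) (n : ℕ) (x : ConfigP) :
    Summable fun m : ℕ => K i (n + m) * spin (x m) :=
  Summable.of_norm_bounded (hK.summable_nat i n) fun _ => (hK.abs_mul_spin_single _ _ _).le

lemma IsCoupling.continuous_tailField (n : ℕ) (i : ℤ) :
    Continuous fun x => tailField K n x i :=
  continuous_tsum (fun m => continuous_const.mul
    ((continuous_of_discreteTopology (f := spin)).comp (continuous_apply m)))
    (hK.summable_nat i n) fun _ _ => (hK.abs_mul_spin_single _ _ _).le

lemma IsCoupling.tailField_succ (n : ℕ) (x : ConfigP) (i : ℤ) :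
    tailField K (n + 1) x (i + 1) = tailField K n x i := by
  refine tsum_congr fun m => ?_
  rw [← hK.shift i _ 1]
  push_cast
  ring_nf

lemma IsCoupling.tailField_prefixP (n : ℕ) (a : Fin n → Bool) (x : ConfigP) :
    tailField K 1 (prefixP n a x) 0 =
      ∑ j : Fin n, K 0 (j + 1) * spin (a j) + tailField K (n + 1) x 0 := by
  unfold tailField
  rw [← (hK.summable_tail 0 1 _).sum_add_tsum_nat_add n, ← Fin.sum_univ_eq_sum_range
    (fun m : ℕ => K 0 ((1 : ℕ) + m) * spin (prefixP n a x m))]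
  congr 1
  · refine Finset.sum_congr rfl fun j _ => ?_
    rw [prefixP_val, add_comm (j : ℤ)]
    rfl
  · refine tsum_congr fun m => ?_
    rw [add_comm m n, prefixP_add]
    push_cast
    ring_nf

lemma IsCoupling.prefixWt_cons (β : ℝ) (n : ℕ) (x : ConfigP) (b : Bool) (a : Fin n → Bool) :
    prefixWt K β (n + 1) x (Fin.cons b a) =
      prefixWt K β n x a * exp (β * (spin b * tailField K 1 (prefixP n a x) 0)) := by
  unfold prefixWt fieldWt
  rw [← exp_add]
  congr 1
  have h1 : ∀ i j : ℤ, K (i + 1) (j + 1) = K i j := fun i j => hK.shift i j 1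
  simp only [pairEnergy, Fintype.sum_prod_type, Fin.sum_univ_succ, Fin.cons_zero, Fin.cons_succ,
    Fin.val_zero, Fin.val_succ, Nat.cast_add, Nat.cast_one, Nat.cast_zero, h1, hK.diag,
    hK.tailField_succ, hK.tailField_prefixP, Finset.sum_add_distrib]
  have h2 : ∀ i : Fin n, β * (K (i + 1) 0 / 2) * (spin (a i) * spin b) =
      β * (K 0 (i + 1) / 2) * (spin b * spin (a i)) := fun i => by rw [hK.symm]; ring
  simp only [h2]
  have h3 : β * (spin b * (∑ j : Fin n, K 0 (j + 1) * spin (a j) + tailField K (n + 1) x 0)) =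
      ∑ j : Fin n, β * (K 0 (j + 1) / 2) * (spin b * spin (a j)) +
      ∑ j : Fin n, β * (K 0 (j + 1) / 2) * (spin b * spin (a j)) +
        β * tailField K (n + 1) x 0 * spin b := by
    rw [← Finset.sum_add_distrib, mul_add, mul_add, Finset.mul_sum, Finset.mul_sum]
    congr 1
    · exact Finset.sum_congr rfl fun j _ => by ring
    · ring
  rw [h3]
  ring

lemma IsCoupling.continuous_prefixWt (β : ℝ) (n : ℕ) (a : Fin n → Bool) :
    Continuous fun x => prefixWt K β n x a := by
  unfold prefixWt fieldWt
  refine continuous_exp.comp (continuous_const.add (continuous_finsetSum _ fun i _ => ?_))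
  exact (continuous_const.mul (hK.continuous_tailField n _)).mul continuous_const

end Transfer

lemma prefixWt_pos (K : ℤ → ℤ → ℝ) (β : ℝ) (n : ℕ) (x : ConfigP) (a : Fin n → Bool) :
    0 < prefixWt K β n x a := fieldWt_pos _ _ _

section Eigen

variable {J : ℕ → ℝ} (hK : IsCoupling (dysonK J)) {β lam : ℝ} {ν : Measure ConfigP}
  (hν : IsEigenprob J β lam ν)

include hK

lemma continuous_transferWt (b : Bool) :
    Continuous fun x => exp (β * potential J (consP b x)) := by
  simp only [potential_consP]
  exact continuous_exp.comp (continuous_const.mul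
    (continuous_const.mul (hK.continuous_tailField 1 0)))

lemma continuous_transfer {f : ConfigP → ℝ} (hf : Continuous f) :
    Continuous (transfer J β f) :=
  continuous_finsetSum _ fun b _ => (continuous_transferWt hK b).mul
    (hf.comp (continuous_consP b))

include hν

lemma IsEigenprob.pow_mul_integral (n : ℕ) {f : ConfigP → ℝ} (hf : Continuous f) :
    lam ^ n * ∫ x, f x ∂ν = ∫ x, ∑ a, prefixWt (dysonK J) β n x a * f (prefixP n a x) ∂ν := by
  induction n generalizing f with
  | zero =>
    rw [pow_zero, one_mul]
    refine integral_congr_ae (ae_of_all _ fun x => ?_)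
    have h1 : ∀ a, prefixWt (dysonK J) β 0 x a = 1 := fun a => by
      simp [prefixWt, fieldWt, pairEnergy]
    have h2 : ∀ a, prefixP 0 a x = x := fun a => by funext i; simp [prefixP]
    change f x = ∑ a, _
    rw [Fintype.sum_unique, h1, h2, one_mul]
  | succ n ih =>
    rw [pow_succ, mul_assoc, ← hν.2 f hf, ih (continuous_transfer hK hf)]
    refine integral_congr_ae (ae_of_all _ fun x => ?_)
    change _ = ∑ a, _
    rw [← (Fin.consEquiv fun _ : Fin (n + 1) => Bool).sum_comp, Fintype.sum_prod_type_right]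
    refine Finset.sum_congr rfl fun a _ => ?_
    rw [transfer, Finset.mul_sum]
    refine Finset.sum_congr rfl fun b _ => ?_
    change _ = prefixWt (dysonK J) β (n + 1) x (Fin.cons b a) * f (prefixP (n + 1) (Fin.cons b a) x)
    rw [hK.prefixWt_cons, prefixP_cons, potential_consP, mul_assoc]

lemma IsEigenprob.lintegral_eq (hlam : 0 < lam) (n : ℕ) {f : ConfigP → ENNReal}
    (hf : Measurable f) :
    ∫⁻ x, f x ∂ν = ∫⁻ x, ∑ a, ENNReal.ofReal (prefixWt (dysonK J) β n x a / lam ^ n) *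
      f (prefixP n a x) ∂ν := by
  have := hν.1
  have hc : ∀ a, Continuous fun x => prefixWt (dysonK J) β n x a / lam ^ n :=
    fun a => (hK.continuous_prefixWt β n a).div_const _
  have h := sum_map_withDensity_eq (μ := ν)
    (w := fun (a : Fin n → Bool) x => prefixWt (dysonK J) β n x a / lam ^ n)
    (g := fun a => prefixP n a) hc
    (fun a x => div_nonneg (prefixWt_pos _ _ _ _ _).le (pow_pos hlam n).le)
    (fun a => continuous_prefixP n a) (fun F hF => by
      have h1 := hν.pow_mul_integral hK n hF
      rw [mul_comm, ← eq_div_iff (pow_pos hlam n).ne'] at h1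
      rw [h1, ← integral_div]
      refine integral_congr_ae (ae_of_all _ fun x => ?_)
      change ∑ a, _ = _ / _
      rw [Finset.sum_div]
      exact Finset.sum_congr rfl fun a _ => by ring)
  have hm : ∀ a, Measurable fun x => ENNReal.ofReal (prefixWt (dysonK J) β n x a / lam ^ n) :=
    fun a => (hc a).measurable.ennreal_ofReal
  conv_lhs => rw [← h]
  rw [lintegral_finsetSum_measure, lintegral_finsetSum]
  · refine Finset.sum_congr rfl fun a _ => ?_
    rw [lintegral_map hf (continuous_prefixP n a).measurable,
      lintegral_withDensity_eq_lintegral_mul (g := fun x => f (prefixP n a x)) _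
        (f := fun x => ENNReal.ofReal (prefixWt (dysonK J) β n x a / lam ^ n)) (hm a)
        (hf.comp (continuous_prefixP n a).measurable)]
    rfl
  · exact fun a _ => (hm a).mul (hf.comp (continuous_prefixP n a).measurable)

end Eigen

section Correlations

variable {K : ℤ → ℤ → ℝ} (hK : IsCoupling K) {β : ℝ} (h0 : 0 ≤ β)
include hK

lemma IsCoupling.abs_tailField_le (N : ℕ) (x : ConfigP) (i : ℤ) :
    |tailField K (N + 1) x i| ≤ extField K (box N) i := by
  have hinj : Function.Injective fun m : ℕ => ((N + 1 : ℕ) : ℤ) + m := fun a b h => by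
    simpa using h
  have hs := hK.summable_ite (· ∈ box N) i
  have h1 : ∀ m : ℕ, K i ((N + 1 : ℕ) + m) =
      if ((N + 1 : ℕ) : ℤ) + m ∈ box N then 0 else K i ((N + 1 : ℕ) + m) := fun m =>
    (if_neg (by simp only [box, Finset.mem_Icc]; omega)).symm
  calc |tailField K (N + 1) x i| ≤ ∑' m : ℕ, K i ((N + 1 : ℕ) + m) :=
        tsum_of_norm_bounded (f := fun m : ℕ => K i ((N + 1 : ℕ) + m) * spin (x m))
          (hK.summable_nat i (N + 1)).hasSum
          fun m => (hK.abs_mul_spin_single _ _ _).le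
    _ ≤ extField K (box N) i := by
      rw [tsum_congr h1]
      exact Summable.tsum_le_tsum_of_inj _ hinj
        (fun j _ => by split_ifs; exacts [le_rfl, hK.nonneg i j]) (fun m => le_rfl)
        (hs.comp_injective hinj) hs

include h0

lemma IsCoupling.corr_prefix_le (N : ℕ) (x : ConfigP) (i j : Fin (N + 1)) :
    corr (withField (fun i j : Fin (N + 1) => β * (K i j / 2))
      fun i => β * tailField K (N + 1) x i) (some i) (some j) ≤ plusCorr K β N i j := by
  have hb : ∀ i : Fin (N + 1), (i : ℤ) ∈ box N := fun i => by
    have := i.2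
    simp only [box, Finset.mem_Icc]
    omega
  let f : Fin (N + 1) ↪ box N := ⟨fun i => ⟨i, hb i⟩, fun i j h => by
    simpa [Fin.ext_iff] using h⟩
  let e : Option (Fin (N + 1)) ↪ Option (box N) := f.optionMap
  let A : Option (box N) → Option (box N) → ℝ :=
    withField (fun i j : box N => β * (K i j / 2)) fun i => β * tailField K (N + 1) x i
  have h1 := corr_comp (J := restrictTo A (Finset.univ.map e)) e.injective (fun a b h => by
    have : a ∈ Finset.univ.map e ∧ b ∈ Finset.univ.map e := by
      by_contra hab
      exact h (if_neg hab)
    simpa using this) (some i) (some j)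
  have h2 : (fun a b => restrictTo A (Finset.univ.map e) (e a) (e b)) =
      withField (fun i j : Fin (N + 1) => β * (K i j / 2))
        fun i => β * tailField K (N + 1) x i := by
    funext a b
    rw [restrictTo, if_pos ⟨Finset.mem_map_of_mem _ (Finset.mem_univ _),
      Finset.mem_map_of_mem _ (Finset.mem_univ _)⟩]
    rcases a with _ | a <;> rcases b with _ | b <;> rfl
  rw [h2] at h1
  rw [← h1, plusCorr, dif_pos ⟨hb i, hb j⟩]
  refine corr_le_corr (fun a b => ?_) _ _
  have h3 := hK.mul_ghostK_nonneg h0 (box N) a b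
  have h4 : |A a b| ≤ β * ghostK K (box N) a b := by
    rcases a with _ | a <;> rcases b with _ | b
    · simp [A, ghostK, withField]
    · simp only [A, ghostK, withField, abs_div, abs_mul, abs_two, abs_of_nonneg h0]
      rw [mul_div_assoc]
      gcongr
      exact hK.abs_tailField_le N x b
    · simp only [A, ghostK, withField, abs_div, abs_mul, abs_two, abs_of_nonneg h0]
      rw [mul_div_assoc]
      gcongr
      exact hK.abs_tailField_le N x a
    · exact (abs_of_nonneg h3).le
  unfold restrictTo
  split_ifs
  exacts [h4, by simpa using h3]

lemma IsCoupling.sum_prefixWt_le (N : ℕ) (x : ConfigP) (i j : Fin (N + 1)) :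
    ∑ a, prefixWt K β (N + 1) x a * (spin (a i) * spin (a j)) ≤
      plusCorr K β N i j * ∑ a, prefixWt K β (N + 1) x a := by
  have h1 := corr_withField_mul (fun i j : Fin (N + 1) => β * (K i j / 2))
    (fun i => β * tailField K (N + 1) x i) (some i) (some j)
  calc _ = ∑ a, spinPair (some i) (some j) (withPlus a) * prefixWt K β (N + 1) x a :=
        Finset.sum_congr rfl fun a _ => mul_comm _ _
    _ = _ := h1.symm
    _ ≤ _ := mul_le_mul_of_nonneg_right (hK.corr_prefix_le h0 N x i j)
      (Finset.sum_nonneg fun a _ => (prefixWt_pos _ _ _ _ _).le)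

end Correlations

lemma continuous_spin_applyP (i : ℕ) : Continuous fun x : ConfigP => spin (x i) :=
  (continuous_of_discreteTopology (f := spin)).comp (continuous_apply i)

section Eigen

variable {J : ℕ → ℝ} (hK : IsCoupling (dysonK J)) {β lam : ℝ} (h0 : 0 ≤ β) (hlam : 0 < lam)
  {ν : Measure ConfigP} (hν : IsEigenprob J β lam ν)

include hK hν

lemma IsEigenprob.integral_sum_prefixWt (n : ℕ) :
    ∫ x, ∑ a, prefixWt (dysonK J) β n x a ∂ν = lam ^ n := by
  have := hν.1
  have h1 := hν.pow_mul_integral hK n (f := fun _ => 1) continuous_const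
  simpa using h1.symm

include h0 hlam

lemma IsEigenprob.integral_spin_le_plusCorr {N i j : ℕ} (hi : i ≤ N) (hj : j ≤ N) :
    ∫ x, spin (x i) * spin (x j) ∂ν ≤ plusCorr (dysonK J) β N i j := by
  have := hν.1
  have hc : Continuous fun x => ∑ a, prefixWt (dysonK J) β (N + 1) x a :=
    continuous_finsetSum _ fun a _ => hK.continuous_prefixWt β _ a
  refine le_of_mul_le_mul_left ?_ (pow_pos hlam (N + 1))
  rw [hν.pow_mul_integral hK _ (f := fun x => spin (x i) * spin (x j)) ((continuous_spin_applyP i).mul (continuous_spin_applyP j)),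
    ← hν.integral_sum_prefixWt hK (N + 1), mul_comm, ← integral_const_mul]
  refine integral_mono (integrable_of_continuous ν ?_)
    (integrable_of_continuous ν (continuous_const.mul hc)) fun x => ?_
  · exact continuous_finsetSum _ fun a _ => (hK.continuous_prefixWt β _ a).mul
      (((continuous_spin_applyP i).mul (continuous_spin_applyP j)).comp (continuous_prefixP _ a))
  · have h1 := hK.sum_prefixWt_le h0 N x ⟨i, Nat.lt_succ_of_le hi⟩ ⟨j, Nat.lt_succ_of_le hj⟩
    have h2 := fun a : Fin (N + 1) → Bool => prefixP_val a x ⟨i, Nat.lt_succ_of_le hi⟩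
    have h3 := fun a : Fin (N + 1) → Bool => prefixP_val a x ⟨j, Nat.lt_succ_of_le hj⟩
    simp only at h1 h2 h3
    simpa only [h2, h3] using h1

lemma IsEigenprob.exists_summable_bound (hβ : β < betaC (dysonK J)) :
    ∃ q : ℤ → ℝ, (∀ d, 0 ≤ q d) ∧ Summable q ∧
      ∀ i j : ℕ, ∫ x, spin (x i) * spin (x j) ∂ν ≤ q (j - i) := by
  have hpos : (0 : ℝ) < 1 / (β + 1) := by positivity
  obtain ⟨S, o, hS⟩ := hK.exists_boundarySum_lt β h0 hβ hpos
  obtain ⟨q, hq0, hqs, hq⟩ := hK.exists_summable_bound h0 o (by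
    calc β * boundarySum (dysonK J) β S ⟨0, o⟩ ≤ β * (1 / (β + 1)) :=
          mul_le_mul_of_nonneg_left hS.le h0
      _ < 1 := by rw [mul_one_div, div_lt_one (by linarith)]; linarith)
  refine ⟨q, hq0, hqs, fun i j => hq i j _ ?_⟩
  filter_upwards [Filter.eventually_ge_atTop i, Filter.eventually_ge_atTop j] with N hi hj
  exact hν.integral_spin_le_plusCorr hK h0 hlam hi hj

end Eigen

lemma sum_tsum_add_le {g q : ℕ → ℝ} {c : ℝ} (hg : ∀ d, 0 ≤ g d) (hq : Summable q)
    (h : ∀ d : ℕ, (d + 1) * g d ≤ c * q d) (n : ℕ) :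
    ∑ k ∈ Finset.range n, ∑' m, g (k + m) ≤ c * ∑' d, q d := by
  have hgs : Summable g := Summable.of_nonneg_of_le hg
    (fun d => (le_mul_of_one_le_left (hg d) (by simp)).trans (h d)) (hq.mul_left c)
  have h1 : ∀ k, Summable fun d => if k ≤ d then g d else 0 := fun k =>
    Summable.of_nonneg_of_le (fun d => by split_ifs; exacts [hg d, le_rfl])
      (fun d => by split_ifs; exacts [le_rfl, hg d]) hgs
  have h2 : ∀ k, ∑' m, g (k + m) = ∑' d, if k ≤ d then g d else 0 := fun k => by
    rw [← (h1 k).sum_add_tsum_nat_add k, Finset.sum_eq_zero, zero_add]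
    · exact tsum_congr fun m => by rw [if_pos (Nat.le_add_left k m), add_comm]
    · exact fun d hd => if_neg (by simpa using hd)
  simp only [h2]
  rw [← Summable.tsum_finsetSum fun k _ => h1 k, ← tsum_mul_left]
  refine Summable.tsum_le_tsum (fun d => ?_) (summable_sum fun k _ => h1 k) (hq.mul_left c)
  refine le_trans ?_ (h d)
  rw [← Finset.sum_filter, Finset.sum_const, nsmul_eq_mul]
  refine mul_le_mul_of_nonneg_right ?_ (hg d)
  have h3 : (Finset.range n).filter (· ≤ d) ⊆ Finset.range (d + 1) := fun k hk => by
    simp only [Finset.mem_filter, Finset.mem_range] at hk ⊢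
    omega
  have h4 := Finset.card_le_card h3
  rw [Finset.card_range] at h4
  exact_mod_cast h4

/-- The `n`-fold shift on the half-line. -/
def shiftP (n : ℕ) (y : ConfigP) : ConfigP := fun m => y (n + m)

lemma shiftP_prefixP (n : ℕ) (a : Fin n → Bool) (x : ConfigP) :
    shiftP n (prefixP n a x) = x :=
  funext fun m => prefixP_add n a x m

lemma continuous_shiftP (n : ℕ) : Continuous (shiftP n) :=
  continuous_pi fun m => continuous_apply (n + m)

/-- The interaction between the first `n` spins and the remaining ones. -/
def splitEnergy (K : ℤ → ℤ → ℝ) (n : ℕ) (y : ConfigP) : ℝ :=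
  ∑ i : Fin n, spin (y i) * tailField K n (shiftP n y) i

lemma splitEnergy_prefixP (K : ℤ → ℤ → ℝ) (n : ℕ) (a : Fin n → Bool) (x : ConfigP) :
    splitEnergy K n (prefixP n a x) = ∑ i : Fin n, spin (a i) * tailField K n x i := by
  simp only [splitEnergy, shiftP_prefixP, prefixP_val]

/-- The weight of the word `a` with free boundary conditions. -/
def freeWt (K : ℤ → ℤ → ℝ) (β : ℝ) (n : ℕ) (a : Fin n → Bool) : ℝ :=
  isingWt (fun i j : Fin n => β * (K i j / 2)) a

lemma prefixWt_eq (K : ℤ → ℤ → ℝ) (β : ℝ) (n : ℕ) (x : ConfigP) (a : Fin n → Bool) :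
    prefixWt K β n x a = freeWt K β n a * exp (β * splitEnergy K n (prefixP n a x)) := by
  rw [prefixWt, fieldWt, exp_add, freeWt, isingWt, splitEnergy_prefixP, Finset.mul_sum]
  congr 2
  exact Finset.sum_congr rfl fun i _ => by ring

lemma freeWt_pos (K : ℤ → ℤ → ℝ) (β : ℝ) (n : ℕ) (a : Fin n → Bool) : 0 < freeWt K β n a :=
  isingWt_pos _ _

lemma sum_freeWt_le (K : ℤ → ℤ → ℝ) (β : ℝ) (n : ℕ) (x : ConfigP) :
    ∑ a, freeWt K β n a ≤ ∑ a, prefixWt K β n x a := by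
  have h1 : ∑ a, freeWt K β n a * (β * splitEnergy K n (prefixP n a x)) = 0 := by
    refine sum_eq_zero_of_flipOn Finset.univ _ fun a => ?_
    have h2 : freeWt K β n (flipOn Finset.univ a) = freeWt K β n a := isingWt_flipOn_univ _ a
    simp [h2, splitEnergy_prefixP, spin_flipOn]
  calc _ = ∑ a, freeWt K β n a * (β * splitEnergy K n (prefixP n a x) + 1) := by
        simp only [mul_add, mul_one, Finset.sum_add_distrib]
        rw [h1, zero_add]
    _ ≤ _ := Finset.sum_le_sum fun a _ => by
        rw [prefixWt_eq]
        exact mul_le_mul_of_nonneg_left (add_one_le_exp _) (freeWt_pos K β n a).le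

lemma IsCoupling.continuous_splitEnergy {K : ℤ → ℤ → ℝ} (hK : IsCoupling K) (n : ℕ) :
    Continuous (splitEnergy K n) :=
  continuous_finsetSum _ fun i _ => (continuous_spin_applyP i).mul
    ((hK.continuous_tailField n i).comp (continuous_shiftP n))

lemma IsCoupling.integral_splitEnergy {K : ℤ → ℤ → ℝ} (hK : IsCoupling K) (ν : Measure ConfigP)
    [IsProbabilityMeasure ν] (n : ℕ) :
    ∫ y, splitEnergy K n y ∂ν =
      ∑ i : Fin n, ∑' m : ℕ, K i (n + m) * ∫ y, spin (y i) * spin (y (n + m)) ∂ν := by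
  unfold splitEnergy
  rw [integral_finsetSum (f := fun (i : Fin n) y => spin (y i) * tailField K n (shiftP n y) i) _
    fun i _ => integrable_of_continuous ν
    ((continuous_spin_applyP i).mul ((hK.continuous_tailField n i).comp (continuous_shiftP n)))]
  refine Finset.sum_congr rfl fun i _ => ?_
  have hc : ∀ m : ℕ, Continuous fun y : ConfigP => K i (n + m) * (spin (y i) * spin (y (n + m))) :=
    fun m => continuous_const.mul ((continuous_spin_applyP i).mul (continuous_spin_applyP _))
  have h := hasSum_integral_of_summable_integral_norm
    (fun m : ℕ => integrable_of_continuous ν (hc m)) (by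
      simp only [Real.norm_eq_abs, hK.abs_mul_spin, integral_const, probReal_univ, one_smul]
      exact hK.summable_nat i n)
  simp only [integral_const_mul] at h
  rw [h.tsum_eq]
  refine integral_congr_ae (ae_of_all _ fun y => ?_)
  simp only [tailField]
  rw [← tsum_mul_left]
  exact tsum_congr fun m => by rw [shiftP]; ring

section Eigen

variable {J : ℕ → ℝ} (hK : IsCoupling (dysonK J)) {β lam : ℝ} (h0 : 0 ≤ β) (hlam : 0 < lam)
  {ν : Measure ConfigP} (hν : IsEigenprob J β lam ν)

include hK hν

lemma IsEigenprob.sum_freeWt_le_pow (n : ℕ) : ∑ a, freeWt (dysonK J) β n a ≤ lam ^ n := by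
  have := hν.1
  rw [← hν.integral_sum_prefixWt hK n]
  calc _ = ∫ _, ∑ a, freeWt (dysonK J) β n a ∂ν := by simp
    _ ≤ _ := integral_mono (integrable_const _) (integrable_of_continuous ν
      (continuous_finsetSum _ fun a _ => hK.continuous_prefixWt β n a))
      fun x => sum_freeWt_le _ β n x

include hlam

lemma IsEigenprob.integral_exp_splitEnergy_le (n : ℕ) :
    ∫ y, exp (-(β * splitEnergy (dysonK J) n y)) ∂ν ≤ 1 := by
  have := hν.1
  refine le_of_mul_le_mul_left ?_ (pow_pos hlam n)
  rw [hν.pow_mul_integral hK n (f := fun y => exp (-(β * splitEnergy (dysonK J) n y)))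
    (continuous_exp.comp (continuous_const.mul (hK.continuous_splitEnergy n)).neg), mul_one]
  refine le_trans (le_of_eq ?_) (hν.sum_freeWt_le_pow hK n)
  have h1 : ∀ x (a : Fin n → Bool), prefixWt (dysonK J) β n x a *
      exp (-(β * splitEnergy (dysonK J) n (prefixP n a x))) = freeWt (dysonK J) β n a :=
    fun x a => by
      rw [prefixWt_eq, mul_assoc, ← exp_add, add_neg_cancel, exp_zero, mul_one]
  simp [h1]

lemma IsEigenprob.measure_inter_le (n : ℕ) {E : Set ConfigP} (hE : MeasurableSet E) (t : ℝ) :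
    ν (shiftP n ⁻¹' E ∩ {y | β * splitEnergy (dysonK J) n y ≤ t}) ≤
      ENNReal.ofReal (exp t) * ν E := by
  have hm : MeasurableSet (shiftP n ⁻¹' E ∩ {y | β * splitEnergy (dysonK J) n y ≤ t}) :=
    ((continuous_shiftP n).measurable hE).inter
      ((continuous_const.mul (hK.continuous_splitEnergy n)).measurable measurableSet_Iic)
  rw [← lintegral_indicator_one hm, hν.lintegral_eq hK hlam n (measurable_one.indicator hm),
    ← lintegral_indicator_one hE, ← lintegral_const_mul _ (measurable_one.indicator hE)]
  refine lintegral_mono fun x => ?_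
  by_cases hx : x ∈ E
  · rw [Set.indicator_of_mem hx, Pi.one_apply, mul_one]
    calc _ ≤ ∑ a, ENNReal.ofReal (freeWt (dysonK J) β n a / lam ^ n * exp t) := by
          refine Finset.sum_le_sum fun a _ => ?_
          by_cases h : prefixP n a x ∈ shiftP n ⁻¹' E ∩ {y | β * splitEnergy (dysonK J) n y ≤ t}
          · rw [Set.indicator_of_mem h, Pi.one_apply, mul_one, prefixWt_eq, mul_div_right_comm]
            refine ENNReal.ofReal_le_ofReal (mul_le_mul_of_nonneg_left (exp_le_exp.2 h.2) ?_)
            exact div_nonneg (freeWt_pos _ _ _ _).le (pow_pos hlam n).le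
          · rw [Set.indicator_of_notMem h, mul_zero]
            exact zero_le
      _ = ENNReal.ofReal ((∑ a, freeWt (dysonK J) β n a) / lam ^ n * exp t) := by
          rw [← ENNReal.ofReal_sum_of_nonneg fun a _ => mul_nonneg
            (div_nonneg (freeWt_pos _ _ _ _).le (pow_pos hlam n).le) (exp_pos t).le,
            ← Finset.sum_mul, Finset.sum_div]
      _ ≤ _ := ENNReal.ofReal_le_ofReal (mul_le_of_le_one_left (exp_pos t).le
          ((div_le_one (pow_pos hlam n)).2 (hν.sum_freeWt_le_pow hK n)))
  · have h1 : ∀ a, prefixP n a x ∉ shiftP n ⁻¹' E ∩ {y | β * splitEnergy (dysonK J) n y ≤ t} :=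
      fun a h => hx (by simpa only [Set.mem_preimage, shiftP_prefixP] using h.1)
    simp only [Set.indicator_of_notMem (h1 _), mul_zero, Finset.sum_const_zero]
    exact zero_le

include h0

lemma IsEigenprob.exists_integral_splitEnergy_le (hβ : β < betaC (dysonK J)) {c : ℝ}
    (hO : ∀ k : ℕ, 1 ≤ k → J k ≤ c / k) :
    ∃ B : ℝ, ∀ n, ∫ y, splitEnergy (dysonK J) n y ∂ν ≤ B := by
  have := hν.1
  obtain ⟨q, hq0, hqs, hq⟩ := hν.exists_summable_bound hK h0 hlam hβ
  have hJ : ∀ d : ℕ, 0 ≤ J (d + 1) := fun d => by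
    rw [← dysonK_of_lt J (i := 0) (j := 0 + (d + 1)) rfl]
    exact hK.nonneg _ _
  let r : ℕ → ℝ := fun d => q (d + 1)
  have hr : Summable r := hqs.comp_injective (i := fun d : ℕ => (d : ℤ) + 1) fun a b h => by
    simpa using h
  have hg0 : ∀ d, 0 ≤ J (d + 1) * r d := fun d => mul_nonneg (hJ d) (hq0 _)
  have hgc : ∀ d : ℕ, (d + 1) * (J (d + 1) * r d) ≤ c * r d := fun d => by
    have h2 := hO (d + 1) (by omega)
    rw [le_div_iff₀ (by positivity)] at h2
    push_cast at h2
    calc _ = J (d + 1) * (d + 1) * r d := by ring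
      _ ≤ _ := mul_le_mul_of_nonneg_right h2 (hq0 _)
  have hg : Summable fun d => J (d + 1) * r d := Summable.of_nonneg_of_le hg0
    (fun d => (le_mul_of_one_le_left (hg0 d) (by simp)).trans (hgc d)) (hr.mul_left c)
  refine ⟨c * ∑' d, r d, fun n => ?_⟩
  refine le_trans ?_ (sum_tsum_add_le hg0 hr hgc n)
  rw [hK.integral_splitEnergy, ← Fin.sum_univ_eq_sum_range
    (fun k => ∑' m, J (k + m + 1) * r (k + m)), ← Equiv.sum_comp Fin.revPerm]
  refine Finset.sum_le_sum fun i _ => ?_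
  have h2 : ∀ m : ℕ, dysonK J (Fin.rev i : Fin n) (n + m) = J (i + m + 1) := fun m => by
    refine dysonK_of_lt J ?_
    rw [Fin.val_rev]
    omega
  have h3 : ∀ m : ℕ, (((n + m : ℕ) : ℤ) - (Fin.rev i : Fin n)) = ((i + m : ℕ) : ℤ) + 1 :=
    fun m => by
      rw [Fin.val_rev]
      omega
  have h4 : ∀ m : ℕ, dysonK J (Fin.rev i : Fin n) (n + m) *
      ∫ y, spin (y (Fin.rev i : Fin n)) * spin (y (n + m)) ∂ν ≤ J (i + m + 1) * r (i + m) :=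
    fun m => by
      rw [h2]
      refine mul_le_mul_of_nonneg_left ((hq _ _).trans_eq ?_) (hJ _)
      rw [h3]
  by_cases hs : Summable fun m : ℕ => dysonK J (Fin.rev i : Fin n) (n + m) *
      ∫ y, spin (y (Fin.rev i : Fin n)) * spin (y (n + m)) ∂ν
  · exact hs.tsum_le_tsum h4 (hg.comp_injective (add_right_injective (i : ℕ)))
  · rw [Fin.revPerm_apply, tsum_eq_zero_of_not_summable hs]
    exact tsum_nonneg fun m => hg0 _

end Eigen

section Eigen

variable {J : ℕ → ℝ} (hK : IsCoupling (dysonK J)) {β lam : ℝ} (h0 : 0 ≤ β) (hlam : 0 < lam)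
  {ν : Measure ConfigP} (hν : IsEigenprob J β lam ν)

include hK hν

lemma IsEigenprob.measure_splitEnergy_gt_le (hlam : 0 < lam) (n : ℕ) {C t : ℝ} (ht : 0 < t)
    (hC : β * ∫ y, splitEnergy (dysonK J) n y ∂ν + 1 ≤ C) :
    ν {y | t < β * splitEnergy (dysonK J) n y} ≤ ENNReal.ofReal (C / t) := by
  have := hν.1
  let D : ConfigP → ℝ := fun y => β * splitEnergy (dysonK J) n y
  have hD : Continuous D := continuous_const.mul (hK.continuous_splitEnergy n)
  have hE : Continuous fun y => exp (-D y) := continuous_exp.comp hD.neg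
  have hDi := integrable_of_continuous ν hD
  have hEi := integrable_of_continuous ν hE
  have h1 : t * ν.real {y | t ≤ D y + exp (-D y)} ≤ ∫ y, (D y + exp (-D y)) ∂ν :=
    mul_meas_ge_le_integral_of_nonneg
      (ae_of_all _ fun y => show (0 : ℝ) ≤ D y + exp (-D y) by
        linarith [add_one_le_exp (-D y)]) (hDi.add hEi) t
  have h2 : ∫ y, (D y + exp (-D y)) ∂ν ≤ C := by
    rw [integral_add hDi hEi, integral_const_mul]
    linarith [hν.integral_exp_splitEnergy_le hK hlam n]
  have h3 : {y | t < D y} ⊆ {y | t ≤ D y + exp (-D y)} := fun y hy => by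
    have hy : t < D y := hy
    change t ≤ _
    linarith [exp_pos (-D y)]
  refine (measure_mono h3).trans ?_
  rw [ENNReal.le_ofReal_iff_toReal_le (measure_ne_top _ _)
    (div_nonneg ((mul_nonneg ht.le measureReal_nonneg).trans (h1.trans h2)) ht.le),
    le_div_iff₀ ht, mul_comm]
  exact h1.trans h2

lemma IsEigenprob.exists_measure_preimage_le (h0 : 0 ≤ β) (hlam : 0 < lam)
    (hβ : β < betaC (dysonK J)) {c : ℝ} (hO : ∀ k : ℕ, 1 ≤ k → J k ≤ c / k) :
    ∃ C : ℝ, ∀ (n : ℕ) (E : Set ConfigP), MeasurableSet E → ∀ t : ℝ, 0 < t →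
      ν (shiftP n ⁻¹' E) ≤ ENNReal.ofReal (exp t) * ν E + ENNReal.ofReal (C / t) := by
  obtain ⟨B, hB⟩ := hν.exists_integral_splitEnergy_le hK h0 hlam hβ hO
  refine ⟨β * B + 1, fun n E hE t ht => ?_⟩
  have h1 : shiftP n ⁻¹' E ⊆ (shiftP n ⁻¹' E ∩ {y | β * splitEnergy (dysonK J) n y ≤ t}) ∪
      {y | t < β * splitEnergy (dysonK J) n y} := fun y hy => by
    rcases le_or_gt (β * splitEnergy (dysonK J) n y) t with h | h
    exacts [Or.inl ⟨hy, h⟩, Or.inr h]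
  refine (measure_mono h1).trans ((measure_union_le _ _).trans ?_)
  refine add_le_add (hν.measure_inter_le hK hlam n hE t)
    (hν.measure_splitEnergy_gt_le hK hlam n ht ?_)
  linarith [mul_le_mul_of_nonneg_left (hB n) h0]

end Eigen

/-- The average of the first `N + 1` translates of `ν`. -/
def cesaro (ν : Measure ConfigP) (N : ℕ) : Measure ConfigP :=
  (ENNReal.ofReal (1 / (N + 1))) • ∑ n ∈ Finset.range (N + 1), ν.map (shiftP n)

lemma ofReal_one_div_mul_natCast (N : ℕ) :
    ENNReal.ofReal (1 / (N + 1)) * ((N + 1 : ℕ) : ENNReal) = 1 := by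
  rw [← ENNReal.ofReal_natCast, ← ENNReal.ofReal_mul (by positivity), Nat.cast_succ, one_div,
    inv_mul_cancel₀ (by positivity), ENNReal.ofReal_one]

lemma cesaro_apply_le (ν : Measure ConfigP) (N : ℕ) {E : Set ConfigP} (hE : MeasurableSet E)
    {r : ENNReal} (h : ∀ n, ν (shiftP n ⁻¹' E) ≤ r) : cesaro ν N E ≤ r := by
  simp only [cesaro, Measure.smul_apply, Measure.coe_finsetSum, Finset.sum_apply, smul_eq_mul,
    Measure.map_apply (continuous_shiftP _).measurable hE]
  calc _ ≤ ENNReal.ofReal (1 / (N + 1)) * ∑ n ∈ Finset.range (N + 1), r := by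
        gcongr
        exact h _
    _ = r := by
        rw [Finset.sum_const, Finset.card_range, nsmul_eq_mul, ← mul_assoc,
          ofReal_one_div_mul_natCast, one_mul]

section Invariant

variable (ν : Measure ConfigP) [IsProbabilityMeasure ν]

lemma integral_cesaro (N : ℕ) {f : ConfigP → ℝ} (hf : Continuous f) :
    ∫ x, f x ∂cesaro ν N =
      1 / (N + 1) * ∑ n ∈ Finset.range (N + 1), ∫ x, f (shiftP n x) ∂ν := by
  rw [cesaro, integral_smul_measure, ENNReal.toReal_ofReal (by positivity),
    integral_finsetSum_measure, smul_eq_mul]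
  · congr 1
    exact Finset.sum_congr rfl fun n _ =>
      integral_map (continuous_shiftP n).measurable.aemeasurable
        hf.aestronglyMeasurable
  · exact fun n _ => by
      have := Measure.isProbabilityMeasure_map (μ := ν)
        (continuous_shiftP n).measurable.aemeasurable
      exact integrable_of_continuous _ hf

instance (N : ℕ) : IsProbabilityMeasure (cesaro ν N) := by
  constructor
  simp only [cesaro, Measure.smul_apply, Measure.coe_finsetSum, Finset.sum_apply, smul_eq_mul,
    Measure.map_apply (continuous_shiftP _).measurable MeasurableSet.univ, Set.preimage_univ,
    measure_univ, Finset.sum_const, Finset.card_range, nsmul_eq_mul, mul_one]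
  exact ofReal_one_div_mul_natCast N

lemma abs_integral_cesaro_shift_sub_le (N : ℕ) {f : ConfigP → ℝ} (hf : Continuous f) {M : ℝ}
    (hM : ∀ x, |f x| ≤ M) :
    |∫ x, f (shiftP 1 x) ∂cesaro ν N - ∫ x, f x ∂cesaro ν N| ≤ 1 / (N + 1) * (2 * M) := by
  have h1 : ∀ n x, shiftP 1 (shiftP n x) = shiftP (n + 1) x := fun n x =>
    funext fun m => congrArg x (by ring)
  have h2 : ∀ n, |∫ x, f (shiftP n x) ∂ν| ≤ M := fun n => by
    simpa using norm_integral_le_of_norm_le_const (μ := ν) (C := M)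
      (f := fun x => f (shiftP n x)) (ae_of_all _ fun x => hM (shiftP n x))
  rw [integral_cesaro ν N (f := fun x => f (shiftP 1 x)) (hf.comp (continuous_shiftP 1)), integral_cesaro ν N hf, ← mul_sub,
    ← Finset.sum_sub_distrib, abs_mul, abs_of_nonneg (by positivity : (0 : ℝ) ≤ 1 / (N + 1))]
  refine mul_le_mul_of_nonneg_left ?_ (by positivity)
  simp only [h1]
  rw [Finset.sum_range_sub (fun n => ∫ x, f (shiftP n x) ∂ν), two_mul]
  exact (abs_sub _ _).trans (add_le_add (h2 _) (h2 _))

lemma exists_invariant (C : ℝ) (hC : ∀ (n : ℕ) (E : Set ConfigP), MeasurableSet E →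
    ∀ t : ℝ, 0 < t →
      ν (shiftP n ⁻¹' E) ≤ ENNReal.ofReal (exp t) * ν E + ENNReal.ofReal (C / t)) :
    ∃ μ : Measure ConfigP, IsProbabilityMeasure μ ∧ μ ≪ ν ∧ μ.map (shiftP 1) = μ := by
  let P : ℕ → ProbabilityMeasure ConfigP := fun N => ⟨cesaro ν N, inferInstance⟩
  let U : Ultrafilter ℕ := Filter.hyperfilter ℕ
  obtain ⟨Q, hQ⟩ : ∃ Q, Filter.Tendsto P U (nhds Q) := by
    obtain ⟨Q, -, hQ⟩ := isCompact_univ.ultrafilter_le_nhds (U.map P) (by simp)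
    exact ⟨Q, hQ⟩
  have hU : (U : Filter ℕ) ≤ Filter.atTop := Nat.hyperfilter_le_atTop
  have hlim : ∀ f : ConfigP → ℝ, Continuous f →
      Filter.Tendsto (fun N => ∫ x, f x ∂cesaro ν N) U (nhds (∫ x, f x ∂(Q : Measure ConfigP))) :=
    fun f hf => ProbabilityMeasure.tendsto_iff_forall_integral_tendsto.1 hQ
      (BoundedContinuousFunction.mkOfCompact ⟨f, hf⟩)
  refine ⟨Q, inferInstance, ?_, ?_⟩
  · have hopen : ∀ V : Set ConfigP, IsOpen V → ∀ t : ℝ, 0 < t →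
        (Q : Measure ConfigP) V ≤ ENNReal.ofReal (exp t) * ν V + ENNReal.ofReal (C / t) := by
      intro V hV t ht
      refine (ProbabilityMeasure.le_liminf_measure_open_of_tendsto hQ hV).trans ?_
      refine Filter.liminf_le_of_le (by isBoundedDefault) fun b hb => ?_
      obtain ⟨N, hN⟩ := hb.exists
      exact hN.trans (cesaro_apply_le ν N hV.measurableSet fun n => hC n V hV.measurableSet t ht)
    refine Measure.AbsolutelyContinuous.mk fun E hE hE0 => ?_
    have h1 : ∀ t : ℝ, 0 < t → (Q : Measure ConfigP) E ≤ ENNReal.ofReal (C / t) := by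
      intro t ht
      refine ENNReal.le_of_forall_pos_le_add fun ε hε _ => ?_
      have h2 : (0 : ENNReal) < ε / ENNReal.ofReal (exp t) :=
        ENNReal.div_pos (by simpa using hε.ne') ENNReal.ofReal_ne_top
      obtain ⟨V, hEV, hV, hVε⟩ := E.exists_isOpen_lt_of_lt (μ := ν) _ (hE0.trans_lt h2)
      refine (measure_mono hEV).trans ((hopen V hV t ht).trans ?_)
      rw [add_comm]
      refine add_le_add le_rfl ?_
      rw [mul_comm]
      exact ENNReal.mul_le_of_le_div hVε.le
    have h2 : Filter.Tendsto (fun t : ℝ => ENNReal.ofReal (C / t)) Filter.atTop (nhds 0) := by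
      have := ENNReal.tendsto_ofReal (Filter.Tendsto.const_div_atTop Filter.tendsto_id C)
      simpa using this
    exact le_antisymm (ge_of_tendsto h2
      ((Filter.eventually_gt_atTop 0).mono fun t ht => h1 t ht)) zero_le
  · have := Measure.isProbabilityMeasure_map (μ := (Q : Measure ConfigP))
      (continuous_shiftP 1).measurable.aemeasurable
    refine ext_of_forall_integral_eq_of_IsFiniteMeasure fun f => ?_
    rw [integral_map (continuous_shiftP 1).measurable.aemeasurable
      f.continuous.aestronglyMeasurable]
    have h1 := (hlim _ (f.continuous.comp (continuous_shiftP 1))).sub (hlim _ f.continuous)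
    have h2 : Filter.Tendsto (fun N : ℕ => 1 / ((N : ℝ) + 1) * (2 * ‖f‖)) U (nhds 0) := by
      have := (tendsto_one_div_add_atTop_nhds_zero_nat (𝕜 := ℝ)).mul_const (2 * ‖f‖)
      rw [zero_mul] at this
      exact this.mono_left hU
    have h3 := squeeze_zero_norm (fun N : ℕ => (Real.norm_eq_abs _).trans_le (abs_integral_cesaro_shift_sub_le ν N f.continuous
      f.norm_coe_le_norm)) h2
    exact sub_eq_zero.1 (tendsto_nhds_unique h1 h3)

end Invariant

section Eigen

variable {J : ℕ → ℝ} (hK : IsCoupling (dysonK J)) {β lam : ℝ} (hlam : 0 < lam)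
  {ν : Measure ConfigP} (hν : IsEigenprob J β lam ν)

include hK

lemma prefixWt_one (x : ConfigP) (b : Bool) :
    prefixWt (dysonK J) β 1 x (fun _ => b) = exp (β * potential J (consP b x)) := by
  rw [potential_consP]
  simp [prefixWt, fieldWt, pairEnergy, hK.diag]
  ring_nf

include hν hlam

lemma IsEigenprob.mul_lintegral_eq {f : ConfigP → ENNReal} (hf : Measurable f) :
    ENNReal.ofReal lam * ∫⁻ x, f x ∂ν =
      ∫⁻ x, ∑ b, ENNReal.ofReal (exp (β * potential J (consP b x))) * f (consP b x) ∂ν := by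
  rw [hν.lintegral_eq hK hlam 1 hf, ← lintegral_const_mul' _ _ ENNReal.ofReal_ne_top]
  refine lintegral_congr fun x => ?_
  rw [← (Equiv.funUnique (Fin 1) Bool).symm.sum_comp, Finset.mul_sum]
  refine Finset.sum_congr rfl fun b _ => ?_
  have h1 : (Equiv.funUnique (Fin 1) Bool).symm b = fun _ => b := rfl
  rw [h1, prefixWt_one hK, ← consP_eq_prefixP, ← mul_assoc, ← ENNReal.ofReal_mul hlam.le, pow_one,
    mul_div_cancel₀ _ hlam.ne']

lemma IsEigenprob.exists_eigenfunction {μ : Measure ConfigP} [IsProbabilityMeasure μ]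
    (hac : μ ≪ ν) (hinv : μ.map (shiftP 1) = μ) :
    ∃ h : ConfigP → ℝ, Integrable h ν ∧ (∀ x, 0 ≤ h x) ∧ (0 < ∫ x, h x ∂ν) ∧
      ∀ᵐ x ∂ν, transfer J β h x = lam * h x := by
  have := hν.1
  let H : ConfigP → ENNReal := μ.rnDeriv ν
  have hH : Measurable H := Measure.measurable_rnDeriv μ ν
  have hHlt : ∀ᵐ x ∂ν, H x < ⊤ := Measure.rnDeriv_lt_top μ ν
  have hleb : μ.HaveLebesgueDecomposition ν :=
    Measure.haveLebesgueDecomposition_of_sigmaFinite μ ν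
  have hwd : ν.withDensity H = μ := Measure.withDensity_rnDeriv_eq μ ν hac
  let w : Bool → ConfigP → ENNReal := fun b x =>
    ENNReal.ofReal (exp (β * potential J (consP b x)))
  have hw : ∀ b, Measurable (w b) := fun b =>
    (continuous_transferWt hK b).measurable.ennreal_ofReal
  have hLm : Measurable fun x => ∑ b, w b x * H (consP b x) :=
    Finset.measurable_fun_sum _ fun b _ => (hw b).mul (hH.comp (continuous_consP b).measurable)
  have hLH : (fun x => ∑ b, w b x * H (consP b x)) =ᵐ[ν] fun x => ENNReal.ofReal lam * H x := by
    refine ae_eq_of_forall_setLIntegral_eq_of_sigmaFinite hLm (hH.const_mul _) fun s hs _ => ?_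
    have hs' : MeasurableSet (shiftP 1 ⁻¹' s) := (continuous_shiftP 1).measurable hs
    have hcons : ∀ b x, consP b x ∈ shiftP 1 ⁻¹' s ↔ x ∈ s := fun b x => by
      rw [Set.mem_preimage, consP_eq_prefixP, shiftP_prefixP]
    calc _ = ∫⁻ x, ∑ b, w b x * (shiftP 1 ⁻¹' s).indicator H (consP b x) ∂ν := by
          rw [← lintegral_indicator hs]
          refine lintegral_congr fun x => ?_
          by_cases hx : x ∈ s <;> simp [Set.indicator, hcons, hx]
      _ = ENNReal.ofReal lam * ∫⁻ x, (shiftP 1 ⁻¹' s).indicator H x ∂ν :=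
          (hν.mul_lintegral_eq hK hlam (hH.indicator hs')).symm
      _ = ENNReal.ofReal lam * μ (shiftP 1 ⁻¹' s) := by
          rw [lintegral_indicator hs', ← withDensity_apply _ hs', hwd]
      _ = ENNReal.ofReal lam * μ s := by
          rw [← Measure.map_apply (continuous_shiftP 1).measurable hs, hinv]
      _ = _ := by
          rw [lintegral_const_mul' _ _ ENNReal.ofReal_ne_top, ← withDensity_apply _ hs, hwd]
  refine ⟨fun x => (H x).toReal, Measure.integrable_toReal_rnDeriv, fun x => ENNReal.toReal_nonneg,
    ?_, ?_⟩
  · rw [Measure.integral_toReal_rnDeriv hac]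
    simp
  · filter_upwards [hLH, hHlt] with x hx hxlt
    have hfin : ∑ b, w b x * H (consP b x) ≠ ⊤ := by
      rw [hx]
      exact ENNReal.mul_ne_top ENNReal.ofReal_ne_top hxlt.ne
    have h1 := congrArg ENNReal.toReal hx
    rw [ENNReal.toReal_sum (ENNReal.sum_ne_top.1 hfin), ENNReal.toReal_mul,
      ENNReal.toReal_ofReal hlam.le] at h1
    rw [← h1, transfer]
    refine Finset.sum_congr rfl fun b _ => ?_
    rw [ENNReal.toReal_mul, ENNReal.toReal_ofReal (exp_pos _).le]

end Eigen

/-- If moreover `J(k) = O(k⁻¹)`, then for every `0 ≤ β < β_c(Φ)`,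
the unique eigenprobability `ν` of `L*_{βφ}` (with eigenvalue `lam > 0`) admits a
nonnegative principal eigenfunction `h ∈ L¹(ν)` with `∫ h dν > 0` and
`L_{βφ} h = lam·h` ν-a.e. -/
theorem statement2 (J : ℕ → ℝ) (hJpos : ∀ k : ℕ, 1 ≤ k → 0 ≤ J k)
    (hJsum : Summable fun k : ℕ => J (k + 1))
    (c : ℝ) (hc : 0 < c) (hO : ∀ k : ℕ, 1 ≤ k → J k ≤ c / k)
    (β : ℝ) (h0 : 0 ≤ β) (hβ : β < betaC (dysonK J))
    (lam : ℝ) (hlam : 0 < lam) (ν : Measure ConfigP) (hν : IsEigenprob J β lam ν)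
    (huniq : ∀ (ν' : Measure ConfigP) (lam' : ℝ), 0 < lam' → IsEigenprob J β lam' ν' →
      ν' = ν) :
    ∃ h : ConfigP → ℝ, Integrable h ν ∧ (∀ x, 0 ≤ h x) ∧ (0 < ∫ x, h x ∂ν) ∧
      ∀ᵐ x ∂ν, transfer J β h x = lam * h x := by
  have hK := isCoupling_dysonK hJpos hJsum
  have := hν.1
  obtain ⟨C, hC⟩ := hν.exists_measure_preimage_le hK h0 hlam hβ hO
  obtain ⟨μ, hμ, hac, hinv⟩ := exists_invariant ν C hC
  exact hν.exists_eigenfunction hK hlam hac hinv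

end
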